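/- Let Ω ⊆ ℍ² be a nonempty open connected geodesically convex set of finite hyperbolic area, and let D ⊆ ∂Ω ∩ ℍ² be a nonempty closed connected subarc of the boundary. Let λ ∈ (0, 1/4]. Suppose u is a nonzero real-valued function, smooth on Ω and C¹ up to ∂Ω ∩ ℍ², with ∫_Ω u² dA < ∞ and ∫_Ω |∇u|² dx dy < ∞, satisfying −Δu = λu pointwise in Ω, u = 0 on D, and the Neumann boundary condition at every point of (∂Ω ∩ ℍ²) \ D; and suppose λ is the least element of the mixed spectrum in the variational sense: every smooth w : Ω → ℝ that vanishes on a neighborhood of D in the closure of Ω, with ∫_Ω w² dA < ∞ and ∫_Ω |∇w|² dx dy < ∞, satisfies ∫_Ω |∇w|² dx dy ≥ λ ∫_Ω w² dA. Then u has no interior critical points: for every p ∈ Ω, the gradient of u at p is nonzero. -/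

import Mathlib

open MeasureTheory Filter Set Topology

noncomputable section

/-- The upper half-plane model of the hyperbolic plane. -/
def H2 : Set (ℝ × ℝ) := {p | 0 < p.2}

/-- Inverse hyperbolic cosine. -/
def arcosh (t : ℝ) : ℝ := Real.log (t + Real.sqrt (t ^ 2 - 1))

/-- Hyperbolic distance in the upper half-plane model. -/
def hypDist (a b : ℝ × ℝ) : ℝ :=
  arcosh (1 + ((a.1 - b.1) ^ 2 + (a.2 - b.2) ^ 2) / (2 * a.2 * b.2))

/-- Partial derivative in the `x` direction. -/
def pdx (u : ℝ × ℝ → ℝ) (p : ℝ × ℝ) : ℝ := fderiv ℝ u p (1, 0)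

/-- Partial derivative in the `y` direction. -/
def pdy (u : ℝ × ℝ → ℝ) (p : ℝ × ℝ) : ℝ := fderiv ℝ u p (0, 1)

/-- Squared Euclidean norm of the gradient. -/
def gradSq (u : ℝ × ℝ → ℝ) (p : ℝ × ℝ) : ℝ := pdx u p ^ 2 + pdy u p ^ 2

/-- The hyperbolic Laplacian `Δu = y²(u_xx + u_yy)`. -/
def hypLap (u : ℝ × ℝ → ℝ) (p : ℝ × ℝ) : ℝ :=
  p.2 ^ 2 * (pdx (pdx u) p + pdy (pdy u) p)

/-- Geodesic convexity in the hyperbolic metric. -/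
def GeodesicallyConvex (Ω : Set (ℝ × ℝ)) : Prop :=
  ∀ a ∈ Ω, ∀ b ∈ Ω, ∀ c ∈ H2, hypDist a c + hypDist c b = hypDist a b → c ∈ Ω

/-- `ν` is a Euclidean unit vector, the boundary of `Ω` has a tangent line at `q`
(the line through `q` orthogonal to `ν`), and `ν` points outward from `Ω`. -/
def IsOutwardNormalAt (Ω : Set (ℝ × ℝ)) (q ν : ℝ × ℝ) : Prop :=
  ν.1 ^ 2 + ν.2 ^ 2 = 1 ∧
  Tendsto (fun x : ℝ × ℝ =>
      |(x.1 - q.1) * ν.1 + (x.2 - q.2) * ν.2| /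
        Real.sqrt ((x.1 - q.1) ^ 2 + (x.2 - q.2) ^ 2))
    (𝓝[frontier Ω \ {q}] q) (𝓝 0) ∧
  ∀ᶠ t in 𝓝[>] (0 : ℝ), q + t • ν ∉ Ω

/-! ### The parabola model

The map `(x, y) ↦ (x, x² + y²)` sends hyperbolic geodesics to Euclidean line segments. -/

/-- The chart of the upper half-plane in which geodesics are straight. -/
def parab (p : ℝ × ℝ) : ℝ × ℝ := (p.1, p.1 ^ 2 + p.2 ^ 2)

/-- The inverse of `parab` on the region above the parabola. -/
def parabInv (z : ℝ × ℝ) : ℝ × ℝ := (z.1, Real.sqrt (z.2 - z.1 ^ 2))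

/-- The image of `Ω` under `parab`. -/
def klein (Ω : Set (ℝ × ℝ)) : Set (ℝ × ℝ) := {z | z.1 ^ 2 < z.2 ∧ parabInv z ∈ Ω}

/-- The hyperbolic cosine of the hyperbolic distance between `o` and `p`. -/
def coshDist (o p : ℝ × ℝ) : ℝ := ((p.1 - o.1) ^ 2 + p.2 ^ 2 + o.2 ^ 2) / (2 * p.2 * o.2)

lemma parabInv_parab {p : ℝ × ℝ} (hp : p ∈ H2) : parabInv (parab p) = p := by
  have : (0 : ℝ) < p.2 := hp
  ext
  · rfl
  · simp [parabInv, parab, Real.sqrt_sq this.le]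

lemma parab_parabInv {z : ℝ × ℝ} (hz : z.1 ^ 2 < z.2) : parab (parabInv z) = z := by
  ext
  · rfl
  · simp only [parabInv, parab]
    rw [Real.sq_sqrt (by linarith)]; ring

lemma parab_mem {p : ℝ × ℝ} (hp : p ∈ H2) : (parab p).1 ^ 2 < (parab p).2 := by
  have : (0 : ℝ) < p.2 := hp
  simp only [parab]
  nlinarith

lemma parabInv_mem {z : ℝ × ℝ} (hz : z.1 ^ 2 < z.2) : parabInv z ∈ H2 :=
  Real.sqrt_pos.2 (by linarith)

lemma parab_mem_klein {Ω : Set (ℝ × ℝ)} {p : ℝ × ℝ} (hp : p ∈ H2) :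
    parab p ∈ klein Ω ↔ p ∈ Ω := by
  simp only [klein, mem_ofPred_eq, parabInv_parab hp, parab_mem hp, true_and]

lemma continuous_parab : Continuous parab := by unfold parab; fun_prop

lemma continuous_parabInv : Continuous parabInv := by unfold parabInv; fun_prop

lemma isOpen_H2 : IsOpen H2 := isOpen_lt continuous_const continuous_snd

lemma isOpen_aboveParabola : IsOpen {z : ℝ × ℝ | z.1 ^ 2 < z.2} :=
  isOpen_lt (by fun_prop) continuous_snd

lemma isOpen_klein {Ω : Set (ℝ × ℝ)} (h : IsOpen Ω) : IsOpen (klein Ω) :=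
  isOpen_aboveParabola.inter (h.preimage continuous_parabInv)

lemma convex_aboveParabola : Convex ℝ {z : ℝ × ℝ | z.1 ^ 2 < z.2} := by
  intro z hz w hw a b ha hb hab
  simp only [mem_ofPred_eq, Prod.fst_add, Prod.smul_fst, smul_eq_mul, Prod.snd_add,
    Prod.smul_snd] at *
  have h1 : (a * z.1 + b * w.1) ^ 2 ≤ a * z.1 ^ 2 + b * w.1 ^ 2 := by
    obtain rfl : b = 1 - a := by linarith
    nlinarith [mul_nonneg (mul_nonneg ha hb) (sq_nonneg (z.1 - w.1))]
  rcases ha.lt_or_eq with h | h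
  · nlinarith [mul_lt_mul_of_pos_left hz h, mul_le_mul_of_nonneg_left hw.le hb]
  · subst h
    obtain rfl : b = 1 := by linarith
    linarith

lemma one_le_coshDist {o p : ℝ × ℝ} (ho : o ∈ H2) (hp : p ∈ H2) : 1 ≤ coshDist o p := by
  have h1 : (0 : ℝ) < o.2 := ho
  have h2 : (0 : ℝ) < p.2 := hp
  unfold coshDist
  rw [le_div_iff₀ (by positivity)]
  nlinarith [sq_nonneg (p.1 - o.1), sq_nonneg (p.2 - o.2)]

lemma hypDist_eq {a b : ℝ × ℝ} (ha : a ∈ H2) (hb : b ∈ H2) :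
    hypDist a b = arcosh (coshDist a b) := by
  have h1 : (0 : ℝ) < a.2 := ha
  have h2 : (0 : ℝ) < b.2 := hb
  unfold hypDist coshDist
  congr 1
  field_simp
  ring

/-- A chord in the parabola model is a hyperbolic geodesic. -/
lemma hypDist_add_of_chord {a b c : ℝ × ℝ} (ha : a ∈ H2) (hb : b ∈ H2) (hc : c ∈ H2)
    {t : ℝ} (ht0 : 0 ≤ t) (ht1 : t ≤ 1)
    (hcab : parab c = (1 - t) • parab a + t • parab b) :
    hypDist a c + hypDist c b = hypDist a b := by
  rw [hypDist_eq ha hc, hypDist_eq hc hb, hypDist_eq ha hb]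
  have hC1 := one_le_coshDist ha hb
  have h1 : (0 : ℝ) < a.2 := ha
  have h2 : (0 : ℝ) < b.2 := hb
  have h3 : (0 : ℝ) < c.2 := hc
  set C := coshDist a b with hC
  have hCeq : 2 * a.2 * b.2 * C = (b.1 - a.1) ^ 2 + b.2 ^ 2 + a.2 ^ 2 := by
    rw [hC]; unfold coshDist; field_simp
  have e1 : c.1 = (1 - t) * a.1 + t * b.1 := by simpa [parab] using congrArg Prod.fst hcab
  have e2 : c.1 ^ 2 + c.2 ^ 2 = (1 - t) * (a.1 ^ 2 + a.2 ^ 2) + t * (b.1 ^ 2 + b.2 ^ 2) := by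
    simpa [parab] using congrArg Prod.snd hcab
  have hy : c.2 ^ 2 = (1 - t) ^ 2 * a.2 ^ 2 + t ^ 2 * b.2 ^ 2
      + 2 * t * (1 - t) * (a.2 * b.2 * C) := by
    rw [e1] at e2
    linear_combination e2 - t * (1 - t) * hCeq
  have hA : coshDist a c = ((1 - t) * a.2 + t * b.2 * C) / c.2 := by
    unfold coshDist
    rw [div_eq_div_iff (by positivity) h3.ne', e1]
    linear_combination c.2 * hy - t ^ 2 * c.2 * hCeq
  have hB : coshDist c b = (t * b.2 + (1 - t) * a.2 * C) / c.2 := by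
    unfold coshDist
    rw [div_eq_div_iff (by positivity) h3.ne', e1]
    linear_combination c.2 * hy - (1 - t) ^ 2 * c.2 * hCeq
  have ht1' : 0 ≤ 1 - t := by linarith
  have hS : 0 ≤ C ^ 2 - 1 := by nlinarith
  set S := Real.sqrt (C ^ 2 - 1) with hSdef
  have hS0 : 0 ≤ S := Real.sqrt_nonneg _
  have hS2 : S ^ 2 = C ^ 2 - 1 := Real.sq_sqrt hS
  have rA : Real.sqrt (coshDist a c ^ 2 - 1) = t * b.2 * S / c.2 := by
    have : coshDist a c ^ 2 - 1 = (t * b.2 * S / c.2) ^ 2 := by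
      rw [hA]; field_simp; rw [hS2, hy]; ring
    rw [this, Real.sqrt_sq (by positivity)]
  have rB : Real.sqrt (coshDist c b ^ 2 - 1) = (1 - t) * a.2 * S / c.2 := by
    have : coshDist c b ^ 2 - 1 = ((1 - t) * a.2 * S / c.2) ^ 2 := by
      rw [hB]; field_simp; rw [hS2, hy]; ring
    rw [this, Real.sqrt_sq (by positivity)]
  have hpos1 := one_le_coshDist ha hc
  have hpos2 := one_le_coshDist hc hb
  unfold arcosh
  rw [rA, rB, ← Real.log_mul (by positivity) (by positivity), ← hSdef, hA, hB]
  congr 1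
  field_simp
  rw [hy]
  linear_combination ((1 - t) * t * a.2 * b.2) * hS2

/-- A geodesically convex set is convex in the parabola model. -/
lemma convex_klein {Ω : Set (ℝ × ℝ)} (hΩ : Ω ⊆ H2) (h : GeodesicallyConvex Ω) :
    Convex ℝ (klein Ω) := by
  intro z hz w hw a b ha hb hab
  have hab' := convex_aboveParabola hz.1 hw.1 ha hb hab
  refine ⟨hab', ?_⟩
  refine h _ hz.2 _ hw.2 _ (parabInv_mem hab') ?_
  refine hypDist_add_of_chord (hΩ hz.2) (hΩ hw.2) (parabInv_mem hab') hb (by linarith) ?_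
  rw [parab_parabInv hab', parab_parabInv hz.1, parab_parabInv hw.1,
    show 1 - b = a by linarith]

lemma parab_mem_closure_klein {Ω : Set (ℝ × ℝ)} (hΩ : Ω ⊆ H2) {p : ℝ × ℝ} (hp : p ∈ H2) :
    parab p ∈ closure (klein Ω) ↔ p ∈ closure Ω := by
  constructor
  · intro h
    have := map_mem_closure (t := Ω) continuous_parabInv h (fun z hz => hz.2)
    rwa [parabInv_parab hp] at this
  · intro h
    exact map_mem_closure continuous_parab h (fun z hz => (parab_mem_klein (hΩ hz)).2 hz)

/-- `Ω` is convex along vertical lines. -/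
lemma mem_of_vertical {Ω : Set (ℝ × ℝ)} (hΩ : Ω ⊆ H2) (h : GeodesicallyConvex Ω)
    {x y y₁ y₂ : ℝ} (h1 : (x, y₁) ∈ Ω) (h2 : (x, y₂) ∈ Ω) (h1y : y₁ ≤ y) (hy2 : y ≤ y₂) :
    (x, y) ∈ Ω := by
  have p1 : 0 < y₁ := hΩ h1
  have hp : (x, y) ∈ H2 := show 0 < y by linarith
  rw [← parab_mem_klein hp]
  have hc := convex_klein hΩ h
  rcases h1y.eq_or_lt with rfl | hlt
  · exact (parab_mem_klein hp).2 h1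
  have hd : 0 < y₂ ^ 2 - y₁ ^ 2 := by nlinarith
  have hs0 : 0 ≤ (y ^ 2 - y₁ ^ 2) / (y₂ ^ 2 - y₁ ^ 2) := div_nonneg (by nlinarith) hd.le
  have hs1 : (y ^ 2 - y₁ ^ 2) / (y₂ ^ 2 - y₁ ^ 2) ≤ 1 := by
    rw [div_le_one hd]; nlinarith
  have := hc ((parab_mem_klein (hΩ h1)).2 h1) ((parab_mem_klein (hΩ h2)).2 h2)
    (sub_nonneg.2 hs1) hs0 (by ring)
  convert this using 1
  ext
  · simp [parab]; ring
  · simp [parab]; field_simp; ring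

/-! ### Integration by parts -/

/-- A smooth bump function equal to `1` near a compact set and supported in a neighborhood. -/
lemma exists_bump {K U : Set (ℝ × ℝ)} (hK : IsCompact K) (hU : IsOpen U) (hKU : K ⊆ U) :
    ∃ θ : ℝ × ℝ → ℝ, ContDiff ℝ (⊤ : ℕ∞) θ ∧ HasCompactSupport θ ∧ tsupport θ ⊆ U ∧
      (∀ᶠ x in 𝓝ˢ K, θ x = 1) ∧ ∀ x, θ x ∈ Icc (0 : ℝ) 1 := by
  obtain ⟨L, hL, hKL, hLU⟩ := exists_compact_between hK hU hKU
  obtain ⟨f, hf1, hf0, hf⟩ := exists_contMDiffMap_one_nhds_of_subset_interior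
    (n := (⊤ : ℕ∞)) (modelWithCornersSelf ℝ (ℝ × ℝ)) hK.isClosed hKL
  have hts : tsupport (f : ℝ × ℝ → ℝ) ⊆ L :=
    closure_minimal (fun x hx => by by_contra h; exact hx (hf0 x h)) hL.isClosed
  exact ⟨f, f.contMDiff.contDiff, HasCompactSupport.of_support_subset_isCompact hL
    (fun x hx => by by_contra h; exact hx (hf0 x h)), hts.trans hLU, hf1, hf⟩

/-- A `C¹` function on `Ω` times a bump function supported in `Ω` is globally `C¹`. -/
lemma contDiff_mul_of_tsupport_subset {Ω : Set (ℝ × ℝ)} (hopen : IsOpen Ω) {n : ℕ∞}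
    {F θ : ℝ × ℝ → ℝ} (hF : ContDiffOn ℝ n F Ω) (hθ : ContDiff ℝ n θ)
    (hts : tsupport θ ⊆ Ω) : ContDiff ℝ n (fun x => θ x * F x) := by
  rw [contDiff_iff_contDiffAt]
  intro x
  by_cases hx : x ∈ Ω
  · exact hθ.contDiffAt.mul (hF.contDiffAt (hopen.mem_nhds hx))
  · have h0 : θ =ᶠ[𝓝 x] 0 := notMem_tsupport_iff_eventuallyEq.1 fun h => hx (hts h)
    refine (contDiffAt_const (c := (0 : ℝ))).congr_of_eventuallyEq ?_
    filter_upwards [h0] with y hy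
    simp [hy]

/-- Integration by parts for a Lipschitz function `f` against a `C¹` function `F` on `Ω`, where
the common support is a compact subset of `Ω`. -/
lemma integral_lipschitz_mul_fderiv {Ω : Set (ℝ × ℝ)} (hopen : IsOpen Ω) {F : ℝ × ℝ → ℝ}
    (hF : ContDiffOn ℝ 1 F Ω) {T S : Set (ℝ × ℝ)} (hT : IsClosed T) (hS : IsClosed S)
    (hTS : IsCompact (T ∩ S)) (hTSΩ : T ∩ S ⊆ Ω) (hFT : ∀ x ∈ Ω, x ∉ T → F x = 0)
    {f : ℝ × ℝ → ℝ} {C : NNReal} (hf : LipschitzWith C f) (hfS : ∀ x, x ∉ S → f x = 0)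
    (v : ℝ × ℝ) :
    IntegrableOn (fun x => f x * fderiv ℝ F x v) Ω ∧
    IntegrableOn (fun x => lineDeriv ℝ f x v * F x) Ω ∧
    ∫ x in Ω, f x * fderiv ℝ F x v = - ∫ x in Ω, lineDeriv ℝ f x v * F x := by
  obtain ⟨θ, hθ, hθc, hθΩ, hθ1, -⟩ := exists_bump hTS hopen hTSΩ
  have hg : ContDiff ℝ 1 (fun x => θ x * F x) :=
    contDiff_mul_of_tsupport_subset (n := 1) hopen hF
      (hθ.of_le (by exact_mod_cast le_top)) hθΩ
  have hgc : HasCompactSupport (fun x => θ x * F x) := hθc.mul_right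
  obtain ⟨B, hB⟩ := hg.lipschitzWith_of_hasCompactSupport hgc (by simp)
  have hθ1' : ∀ x ∈ T ∩ S, θ =ᶠ[𝓝 x] 1 := fun x hx =>
    (eventually_nhdsSet_iff_forall.1 hθ1) x hx
  have hoff : ∀ x, x ∉ Ω → θ =ᶠ[𝓝 x] 0 := fun x hx =>
    notMem_tsupport_iff_eventuallyEq.1 fun h => hx (hθΩ h)
  have hF0 : ∀ x ∈ Ω, x ∉ T → F =ᶠ[𝓝 x] 0 := fun x hx hxT => by
    filter_upwards [hopen.mem_nhds hx, hT.isOpen_compl.mem_nhds hxT] with y h1 h2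
    exact hFT y h1 h2
  have hf0 : ∀ x, x ∉ S → f =ᶠ[𝓝 x] 0 := fun x hxS => by
    filter_upwards [hS.isOpen_compl.mem_nhds hxS] with y h1
    exact hfS y h1
  have e1 : ∀ x ∈ Ω, f x * fderiv ℝ (fun x => θ x * F x) x v = f x * fderiv ℝ F x v := by
    intro x hx
    by_cases hxS : x ∈ S
    · by_cases hxT : x ∈ T
      · rw [Filter.EventuallyEq.fderiv_eq (f₁ := fun x => θ x * F x) (f := F)]
        filter_upwards [hθ1' x ⟨hxT, hxS⟩] with y hy
        simp [hy]
      · rw [Filter.EventuallyEq.fderiv_eq (f₁ := fun x => θ x * F x) (f := F)]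
        filter_upwards [hF0 x hx hxT] with y hy
        simp [hy]
    · simp [hfS x hxS]
  have e2 : ∀ x ∈ Ω, lineDeriv ℝ f x v * (θ x * F x) = lineDeriv ℝ f x v * F x := by
    intro x hx
    by_cases hxS : x ∈ S
    · by_cases hxT : x ∈ T
      · simp [(hθ1' x ⟨hxT, hxS⟩).self_of_nhds]
      · simp [hFT x hx hxT]
    · have : lineDeriv ℝ f x v = 0 := by
        rw [(hf0 x hxS).lineDeriv_eq]
        simp [lineDeriv]
      simp [this]
  have o1 : ∀ x, x ∉ Ω → f x * fderiv ℝ (fun x => θ x * F x) x v = 0 := by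
    intro x hx
    rw [Filter.EventuallyEq.fderiv_eq (f₁ := fun x => θ x * F x) (f := fun _ => 0)]
    · simp
    · filter_upwards [hoff x hx] with y hy
      simp [hy]
  have o2 : ∀ x, x ∉ Ω → lineDeriv ℝ f x v * (θ x * F x) = 0 := by
    intro x hx
    simp [(hoff x hx).self_of_nhds]
  have i1 : Integrable (fun x => f x * fderiv ℝ (fun x => θ x * F x) x v) := by
    refine Continuous.integrable_of_hasCompactSupport ?_ ?_
    · exact hf.continuous.mul ((hg.continuous_fderiv (by simp)).clm_apply continuous_const)
    · exact (hgc.fderiv_apply (𝕜 := ℝ) v).mul_left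
  have i2 : Integrable (fun x => lineDeriv ℝ f x v * (θ x * F x)) := by
    simpa [mul_comm] using (hf.locallyIntegrable_lineDeriv (μ := volume) v).integrable_smul_left_of_hasCompactSupport hg.continuous hgc
  refine ⟨(i1.integrableOn).congr_fun (fun x hx => e1 x hx) hopen.measurableSet,
    (i2.integrableOn).congr_fun (fun x hx => e2 x hx) hopen.measurableSet, ?_⟩
  rw [← setIntegral_congr_fun hopen.measurableSet e1, ← setIntegral_congr_fun hopen.measurableSet e2,
    setIntegral_eq_integral_of_forall_compl_eq_zero o1,
    setIntegral_eq_integral_of_forall_compl_eq_zero o2,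
    hf.integral_lineDeriv_mul_eq hB hgc v, ← integral_neg]
  congr 1
  ext x
  rw [((hg.differentiable (by simp)) x).lineDeriv_eq_fderiv, map_neg]
  ring

/-- The integral of a divergence of compactly supported fields vanishes. -/
lemma integral_fderiv_eq_zero {Ω : Set (ℝ × ℝ)} (hopen : IsOpen Ω) {F : ℝ × ℝ → ℝ}
    (hF : ContDiffOn ℝ 1 F Ω) {T : Set (ℝ × ℝ)} (hT : IsCompact T) (hTΩ : T ⊆ Ω)
    (hFT : ∀ x ∈ Ω, x ∉ T → F x = 0) (v : ℝ × ℝ) :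
    IntegrableOn (fun x => fderiv ℝ F x v) Ω ∧ ∫ x in Ω, fderiv ℝ F x v = 0 := by
  obtain ⟨h1, h2, h3⟩ := integral_lipschitz_mul_fderiv hopen hF hT.isClosed isClosed_univ
    (by simpa using hT) (by simpa using hTΩ) hFT (LipschitzWith.const (1 : ℝ)) (by simp) v
  have h0 : ∀ x, lineDeriv ℝ (fun _ : ℝ × ℝ => (1 : ℝ)) x v = 0 := fun x => by
    simp [lineDeriv]
  simp only [one_mul, h0, zero_mul, integral_zero, neg_zero] at h1 h3
  exact ⟨h1, h3⟩

/-! ### The smooth step function -/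

lemma contDiff_step : ContDiff ℝ (⊤ : ℕ∞) Real.smoothTransition := Real.smoothTransition.contDiff

lemma hasDerivAt_step (t : ℝ) :
    HasDerivAt Real.smoothTransition (deriv Real.smoothTransition t) t :=
  (contDiff_step.differentiable (by simp) t).hasDerivAt

lemma deriv_step_nonneg (t : ℝ) : 0 ≤ deriv Real.smoothTransition t :=
  Real.smoothTransition.monotone.deriv_nonneg

lemma deriv_step_of_nonpos {t : ℝ} (ht : t ≤ 0) : deriv Real.smoothTransition t = 0 := by
  refine IsLocalMin.deriv_eq_zero (Eventually.of_forall fun x => ?_)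
  rw [Real.smoothTransition.zero_of_nonpos ht]
  exact Real.smoothTransition.nonneg x

lemma deriv_step_of_one_le {t : ℝ} (ht : 1 ≤ t) : deriv Real.smoothTransition t = 0 := by
  refine IsLocalMax.deriv_eq_zero (Eventually.of_forall fun x => ?_)
  rw [Real.smoothTransition.one_of_one_le ht]
  exact Real.smoothTransition.le_one x

lemma exists_deriv_step_le : ∃ M : ℝ, 0 < M ∧ ∀ t, deriv Real.smoothTransition t ≤ M := by
  obtain ⟨C, hC⟩ := (isCompact_Icc (a := (0 : ℝ)) (b := 1)).exists_bound_of_continuousOn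
    (contDiff_step.continuous_deriv (by simp)).continuousOn
  refine ⟨max C 1, by positivity, fun t => ?_⟩
  by_cases h : t ∈ Icc (0 : ℝ) 1
  · exact (le_abs_self _).trans ((hC t h).trans (le_max_left _ _))
  · have : deriv Real.smoothTransition t = 0 := by
      rcases le_total t 0 with h0 | h0
      · exact deriv_step_of_nonpos h0
      · exact deriv_step_of_one_le (by by_contra h1; exact h ⟨h0, by linarith⟩)
    rw [this]; positivity

lemma exists_lipschitz_step : ∃ C : NNReal, LipschitzWith C Real.smoothTransition := by
  obtain ⟨M, hM, h⟩ := exists_deriv_step_le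
  refine ⟨M.toNNReal, lipschitzWith_of_nnnorm_deriv_le (contDiff_step.differentiable (by simp))
    fun t => ?_⟩
  rw [← NNReal.coe_le_coe, coe_nnnorm, Real.norm_of_nonneg (deriv_step_nonneg t),
    Real.coe_toNNReal _ hM.le]
  exact h t

/-! ### Gauge of a convex open set about an interior point -/

/-- The Minkowski gauge of `A` about the point `a`. -/
def gaugeAt (A : Set (ℝ × ℝ)) (a z : ℝ × ℝ) : ℝ := gauge ((fun w => w + a) ⁻¹' A) (z - a)

section gaugeAt

variable {A : Set (ℝ × ℝ)} {a : ℝ × ℝ}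

lemma gaugeAt_aux (hA : Convex ℝ A) (hAo : IsOpen A) (ha : a ∈ A) :
    Convex ℝ ((fun w => w + a) ⁻¹' A) ∧ (fun w => w + a) ⁻¹' A ∈ 𝓝 (0 : ℝ × ℝ) :=
  ⟨hA.translate_preimage_left a, (hAo.preimage (continuous_add_const a)).mem_nhds (by simpa using ha)⟩

lemma exists_lipschitz_gaugeAt (hA : Convex ℝ A) (hAo : IsOpen A) (ha : a ∈ A) :
    ∃ L : NNReal, LipschitzWith L (gaugeAt A a) := by
  obtain ⟨h1, h2⟩ := gaugeAt_aux hA hAo ha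
  obtain ⟨L, hL⟩ := h1.lipschitz_gauge h2
  exact ⟨L, fun x y => by simpa [gaugeAt] using hL (x - a) (y - a)⟩

lemma gaugeAt_lt_one (hA : Convex ℝ A) (hAo : IsOpen A) (ha : a ∈ A) {z : ℝ × ℝ} :
    gaugeAt A a z < 1 ↔ z ∈ A := by
  obtain ⟨h1, h2⟩ := gaugeAt_aux hA hAo ha
  rw [gaugeAt, gauge_lt_one_iff_mem_interior h1 h2,
    (hAo.preimage (continuous_add_const a)).interior_eq]
  simp

lemma gaugeAt_le_one (hA : Convex ℝ A) (hAo : IsOpen A) (ha : a ∈ A) {z : ℝ × ℝ} :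
    gaugeAt A a z ≤ 1 ↔ z ∈ closure A := by
  obtain ⟨h1, h2⟩ := gaugeAt_aux hA hAo ha
  rw [gaugeAt, gauge_le_one_iff_mem_closure h1 h2]
  have := (Homeomorph.addRight a).preimage_closure A
  rw [Homeomorph.coe_addRight] at this
  rw [← this]
  simp

lemma gaugeAt_homog {t : ℝ} (ht : 0 ≤ t) (z : ℝ × ℝ) :
    gaugeAt A a (a + t • (z - a)) = t * gaugeAt A a z := by
  simp [gaugeAt, gauge_smul_of_nonneg ht]

lemma gaugeAt_add_le (hA : Convex ℝ A) (hAo : IsOpen A) (ha : a ∈ A) (x y : ℝ × ℝ) :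
    gaugeAt A a (x + y) ≤ gaugeAt A a x + gaugeAt A a (a + y) := by
  obtain ⟨h1, h2⟩ := gaugeAt_aux hA hAo ha
  have := gauge_add_le h1 (absorbent_nhds_zero h2) (x - a) y
  simpa [gaugeAt, sub_add_eq_add_sub] using this

/-- The derivative of the gauge along the ray direction is the gauge itself. -/
lemma fderiv_gaugeAt_self {z : ℝ × ℝ} {n : ℝ × ℝ →L[ℝ] ℝ} (hn : HasFDerivAt (gaugeAt A a) n z) :
    n (z - a) = gaugeAt A a z := by
  have h1 : HasDerivAt (fun t : ℝ => gaugeAt A a (z + t • (z - a))) (n (z - a)) 0 :=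
    hn.hasLineDerivAt (z - a)
  have h2 : HasDerivAt (fun t : ℝ => (1 + t) * gaugeAt A a z) (gaugeAt A a z) 0 := by
    simpa using ((hasDerivAt_id (0 : ℝ)).const_add 1).mul_const (gaugeAt A a z)
  have h3 : HasDerivAt (fun t : ℝ => (1 + t) * gaugeAt A a z) (n (z - a)) 0 := by
    refine h1.congr_of_eventuallyEq ?_
    filter_upwards [Ioi_mem_nhds (show (-1 : ℝ) < 0 by norm_num)] with t ht
    have ht : -1 < t := ht
    rw [← gaugeAt_homog (by linarith)]
    congr 1
    module
  exact h3.unique h2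

/-- The gradient inequality for the gauge. -/
lemma fderiv_gaugeAt_le (hA : Convex ℝ A) (hAo : IsOpen A) (ha : a ∈ A) {z : ℝ × ℝ}
    {n : ℝ × ℝ →L[ℝ] ℝ} (hn : HasFDerivAt (gaugeAt A a) n z) (v : ℝ × ℝ) :
    n v ≤ gaugeAt A a (a + v) := by
  have h1 : HasDerivAt (fun t : ℝ => gaugeAt A a (z + t • v)) (n v) 0 := hn.hasLineDerivAt v
  have h2 := h1.tendsto_slope_zero_right
  refine le_of_tendsto h2 ?_
  filter_upwards [self_mem_nhdsWithin] with t (ht : 0 < t)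
  have h3 := gaugeAt_add_le hA hAo ha z (t • v)
  have h4 := gaugeAt_homog (A := A) (a := a) ht.le (a + v)
  simp only [add_sub_cancel_left] at h4
  rw [h4] at h3
  simp only [zero_add, zero_smul, add_zero, smul_eq_mul]
  rw [inv_mul_le_iff₀ ht]
  linarith

/-- The derivative of the gauge is constant along rays. -/
lemma hasFDerivAt_gaugeAt_ray {z : ℝ × ℝ} {n : ℝ × ℝ →L[ℝ] ℝ}
    (hn : HasFDerivAt (gaugeAt A a) n z) {t : ℝ} (ht : 0 < t) :
    HasFDerivAt (gaugeAt A a) n (a + t • (z - a)) := by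
  have h1 : HasFDerivAt (fun w : ℝ × ℝ => a + t⁻¹ • (w - a))
      (t⁻¹ • ContinuousLinearMap.id ℝ (ℝ × ℝ)) (a + t • (z - a)) :=
    (((hasFDerivAt_id _).sub_const a).const_smul t⁻¹).const_add a
  have h2 : a + t⁻¹ • ((a + t • (z - a)) - a) = z := by
    simp [smul_smul, inv_mul_cancel₀ ht.ne']
  have h3 : HasFDerivAt (gaugeAt A a) n (a + t⁻¹ • ((a + t • (z - a)) - a)) := by rwa [h2]
  have h4 := (h3.comp (a + t • (z - a)) h1).const_mul t
  have e1 : gaugeAt A a = fun w => t * (gaugeAt A a ∘ fun w => a + t⁻¹ • (w - a)) w := by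
    ext w
    simp only [Function.comp]
    rw [gaugeAt_homog (by positivity)]
    field_simp
  have e2 : n = t • n ∘SL (t⁻¹ • ContinuousLinearMap.id ℝ (ℝ × ℝ)) := by
    ext <;> simp <;> field_simp
  rw [e1, e2]
  exact h4

lemma abs_fderiv_gaugeAt_le {L : NNReal} (hL : LipschitzWith L (gaugeAt A a)) {z : ℝ × ℝ}
    {n : ℝ × ℝ →L[ℝ] ℝ} (hn : HasFDerivAt (gaugeAt A a) n z) (v : ℝ × ℝ) :
    |n v| ≤ L * ‖v‖ := by
  have h := hn.le_of_lipschitz hL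
  exact (n.le_opNorm v).trans (by gcongr)

end gaugeAt

/-! ### Outward normals -/

lemma clm_prod_apply (G : ℝ × ℝ →L[ℝ] ℝ) (v : ℝ × ℝ) :
    G v = G (1, 0) * v.1 + G (0, 1) * v.2 := by
  have : v = v.1 • ((1, 0) : ℝ × ℝ) + v.2 • ((0, 1) : ℝ × ℝ) := by ext <;> simp
  conv_lhs => rw [this]
  rw [map_add, map_smul, map_smul]
  simp only [smul_eq_mul]; ring

lemma norm_le_sqrt (v : ℝ × ℝ) : ‖v‖ ≤ Real.sqrt (v.1 ^ 2 + v.2 ^ 2) := by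
  rw [Prod.norm_def]
  refine max_le ?_ ?_ <;> rw [Real.norm_eq_abs] <;> apply Real.abs_le_sqrt <;>
    nlinarith [sq_nonneg v.1, sq_nonneg v.2]

/-- A boundary point at which `Ω` is locally a sublevel set of a function with nonzero
derivative has an outward normal, proportional to the gradient. -/
lemma exists_isOutwardNormalAt {Ω : Set (ℝ × ℝ)} {q : ℝ × ℝ} {J : ℝ × ℝ → ℝ}
    {G : ℝ × ℝ →L[ℝ] ℝ} (hJ : HasFDerivAt J G q) (hG : G ≠ 0)
    (h1 : ∀ᶠ x in 𝓝[frontier Ω] q, J x = J q) (h2 : ∀ᶠ x in 𝓝[Ω] q, J x ≤ J q) :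
    ∃ ν : ℝ × ℝ, ∃ r : ℝ, 0 < r ∧ (∀ v, G v = r * (ν.1 * v.1 + ν.2 * v.2)) ∧
      IsOutwardNormalAt Ω q ν := by
  set a := G (1, 0) with ha
  set b := G (0, 1) with hb
  have hGv : ∀ v, G v = a * v.1 + b * v.2 := clm_prod_apply G
  have hab : 0 < a ^ 2 + b ^ 2 := by
    by_contra h
    have ha0 : a = 0 := by nlinarith [sq_nonneg a, sq_nonneg b]
    have hb0 : b = 0 := by nlinarith [sq_nonneg a, sq_nonneg b]
    exact hG (by ext <;> simp [hGv, ha0, hb0])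
  set r := Real.sqrt (a ^ 2 + b ^ 2) with hr
  have hr0 : 0 < r := Real.sqrt_pos.2 hab
  have hr2 : r ^ 2 = a ^ 2 + b ^ 2 := Real.sq_sqrt hab.le
  have hGr : ∀ v, G v = r * (a / r * v.1 + b / r * v.2) := fun v => by
    rw [hGv]; field_simp
  refine ⟨(a / r, b / r), r, hr0, hGr, ?_, ?_, ?_⟩
  · simp only []
    field_simp
    linarith
  · rw [Metric.tendsto_nhds]
    intro ε hε
    have ho := hJ.isLittleO.def (show 0 < r * (ε / 2) by positivity)
    filter_upwards [mem_nhdsWithin_of_mem_nhds ho,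
      nhdsWithin_mono q (s := frontier Ω \ {q}) sdiff_subset h1, self_mem_nhdsWithin] with x hx1 hx2 hx3
    rw [hx2, sub_self, zero_sub, norm_neg, Real.norm_eq_abs, hGr, abs_mul, abs_of_pos hr0,
      mul_assoc, mul_le_mul_iff_right₀ hr0] at hx1
    have hn := norm_le_sqrt (x - q)
    simp only [Prod.fst_sub, Prod.snd_sub] at hx1 hn
    have hpos : 0 < Real.sqrt ((x.1 - q.1) ^ 2 + (x.2 - q.2) ^ 2) := by
      refine lt_of_lt_of_le (norm_pos_iff.2 (sub_ne_zero.2 ?_)) hn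
      exact fun h => hx3.2 h
    rw [dist_zero_right, Real.norm_eq_abs, abs_div, abs_abs, abs_of_pos hpos, div_lt_iff₀ hpos]
    calc _ = |a / r * (x.1 - q.1) + b / r * (x.2 - q.2)| := by ring_nf
      _ ≤ ε / 2 * ‖x - q‖ := hx1
      _ ≤ ε / 2 * Real.sqrt ((x.1 - q.1) ^ 2 + (x.2 - q.2) ^ 2) := by gcongr
      _ < _ := by nlinarith
  · have hd : HasDerivAt (fun t : ℝ => J (q + t • (a / r, b / r))) (G (a / r, b / r)) 0 :=
      hJ.hasLineDerivAt _
    have hGn : 0 < G (a / r, b / r) := by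
      rw [hGv]
      have : a * (a / r) + b * (b / r) = r := by field_simp; linarith
      simpa [this] using hr0
    have hs := hd.tendsto_slope_zero_right.eventually (lt_mem_nhds hGn)
    have hc : Tendsto (fun t : ℝ => q + t • ((a / r, b / r) : ℝ × ℝ)) (𝓝[>] 0) (𝓝 q) := by
      have : Continuous fun t : ℝ => q + t • ((a / r, b / r) : ℝ × ℝ) := by fun_prop
      exact (this.tendsto' 0 q (by simp)).mono_left nhdsWithin_le_nhds
    filter_upwards [hs, hc.eventually (eventually_nhdsWithin_iff.1 h2), self_mem_nhdsWithin]
      with t ht1 ht2 (ht3 : 0 < t) hmem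
    have h3 := ht2 hmem
    simp only [zero_add, zero_smul, add_zero, smul_eq_mul] at ht1
    have : 0 < J (q + t • (a / r, b / r)) - J q := (mul_pos_iff_of_pos_left (inv_pos.2 ht3)).1 ht1
    linarith

/-! ### Derivatives of the parabola map and of the distance -/

/-- The derivative of `parab`. -/
def parabD (x : ℝ × ℝ) : ℝ × ℝ →L[ℝ] ℝ × ℝ :=
  (ContinuousLinearMap.fst ℝ ℝ ℝ).prod
    ((2 * x.1) • ContinuousLinearMap.fst ℝ ℝ ℝ + (2 * x.2) • ContinuousLinearMap.snd ℝ ℝ ℝ)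

@[simp] lemma parabD_apply (x v : ℝ × ℝ) :
    parabD x v = (v.1, 2 * x.1 * v.1 + 2 * x.2 * v.2) := by simp [parabD]

lemma hasFDerivAt_parab (x : ℝ × ℝ) : HasFDerivAt parab (parabD x) x := by
  have h1 : HasFDerivAt (fun p : ℝ × ℝ => p.1) (ContinuousLinearMap.fst ℝ ℝ ℝ) x := hasFDerivAt_fst
  have h2 : HasFDerivAt (fun p : ℝ × ℝ => p.2) (ContinuousLinearMap.snd ℝ ℝ ℝ) x := hasFDerivAt_snd
  have h := h1.prodMk ((h1.pow 2).add (h2.pow 2))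
  refine h.congr_fderiv ?_
  ext <;> simp

lemma contDiff_parab : ContDiff ℝ (⊤ : ℕ∞) parab := by unfold parab; fun_prop

lemma contDiffAt_parabInv {z : ℝ × ℝ} (hz : z.1 ^ 2 < z.2) : ContDiffAt ℝ (⊤ : ℕ∞) parabInv z := by
  unfold parabInv
  refine contDiffAt_fst.prodMk (ContDiffAt.sqrt ?_ (by linarith))
  fun_prop

/-- The derivative of `coshDist o`. -/
def coshDistD (o p : ℝ × ℝ) : ℝ × ℝ →L[ℝ] ℝ :=
  ((p.1 - o.1) / (p.2 * o.2)) • ContinuousLinearMap.fst ℝ ℝ ℝ +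
    ((p.2 ^ 2 - (p.1 - o.1) ^ 2 - o.2 ^ 2) / (2 * p.2 ^ 2 * o.2)) • ContinuousLinearMap.snd ℝ ℝ ℝ

@[simp] lemma coshDistD_apply (o p v : ℝ × ℝ) : coshDistD o p v =
    (p.1 - o.1) / (p.2 * o.2) * v.1 +
      (p.2 ^ 2 - (p.1 - o.1) ^ 2 - o.2 ^ 2) / (2 * p.2 ^ 2 * o.2) * v.2 := by simp [coshDistD]

lemma hasFDerivAt_coshDist {o p : ℝ × ℝ} (ho : o ∈ H2) (hp : p ∈ H2) :
    HasFDerivAt (coshDist o) (coshDistD o p) p := by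
  have ho' : o.2 ≠ 0 := ne_of_gt ho
  have hp' : p.2 ≠ 0 := ne_of_gt hp
  have h1 : HasFDerivAt (fun p : ℝ × ℝ => p.1) (ContinuousLinearMap.fst ℝ ℝ ℝ) p := hasFDerivAt_fst
  have h2 : HasFDerivAt (fun p : ℝ × ℝ => p.2) (ContinuousLinearMap.snd ℝ ℝ ℝ) p := hasFDerivAt_snd
  have h := ((((h1.sub_const o.1).pow 2).add (h2.pow 2)).add_const (o.2 ^ 2)).mul
    ((hasDerivAt_inv (x := 2 * p.2 * o.2) (by positivity)).comp_hasFDerivAt p ((h2.const_mul 2).mul_const o.2))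
  have e : coshDist o = fun p => ((p.1 - o.1) ^ 2 + p.2 ^ 2 + o.2 ^ 2) * (2 * p.2 * o.2)⁻¹ := by
    ext p; simp [coshDist, div_eq_mul_inv]
  rw [e]
  refine h.congr_fderiv ?_
  ext
  · simp; field_simp
  · simp; field_simp; ring

/-- The gradient of the distance paired with a covector pulled back from the parabola model. -/
lemma covector_coshDist {o q : ℝ × ℝ} (ho : o ∈ H2) (hq : q ∈ H2) (n : ℝ × ℝ →L[ℝ] ℝ) :
    coshDistD o q (n (parabD q (1, 0)), n (parabD q (0, 1))) =
      n (parab q - parab o) / (q.2 * o.2) := by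
  have ho' : o.2 ≠ 0 := ne_of_gt ho
  have hq' : q.2 ≠ 0 := ne_of_gt hq
  rw [clm_prod_apply n (parabD q (1, 0)), clm_prod_apply n (parabD q (0, 1)),
    clm_prod_apply n (parab q - parab o)]
  simp [parab]
  field_simp
  ring

/-! ### The defining function of a geodesically convex domain -/

/-- The gauge of `Ω` about `o`, computed in the parabola model. -/
def hypGauge (Ω : Set (ℝ × ℝ)) (o p : ℝ × ℝ) : ℝ := gaugeAt (klein Ω) (parab o) (parab p)

section hypGauge

variable {Ω : Set (ℝ × ℝ)} {o : ℝ × ℝ}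

lemma hypGauge_lt_one (hΩ : Ω ⊆ H2) (hopen : IsOpen Ω) (hconv : GeodesicallyConvex Ω)
    (ho : o ∈ Ω) {p : ℝ × ℝ} (hp : p ∈ H2) : hypGauge Ω o p < 1 ↔ p ∈ Ω := by
  rw [hypGauge, gaugeAt_lt_one (convex_klein hΩ hconv) (isOpen_klein hopen)
    ((parab_mem_klein (hΩ ho)).2 ho), parab_mem_klein hp]

lemma hypGauge_le_one (hΩ : Ω ⊆ H2) (hopen : IsOpen Ω) (hconv : GeodesicallyConvex Ω)
    (ho : o ∈ Ω) {p : ℝ × ℝ} (hp : p ∈ H2) : hypGauge Ω o p ≤ 1 ↔ p ∈ closure Ω := by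
  rw [hypGauge, gaugeAt_le_one (convex_klein hΩ hconv) (isOpen_klein hopen)
    ((parab_mem_klein (hΩ ho)).2 ho), parab_mem_closure_klein hΩ hp]

lemma hypGauge_eq_one (hΩ : Ω ⊆ H2) (hopen : IsOpen Ω) (hconv : GeodesicallyConvex Ω)
    (ho : o ∈ Ω) {p : ℝ × ℝ} (hp : p ∈ H2) : hypGauge Ω o p = 1 ↔ p ∈ frontier Ω := by
  rw [hopen.frontier_eq, Set.mem_sdiff, ← hypGauge_le_one hΩ hopen hconv ho hp,
    ← hypGauge_lt_one hΩ hopen hconv ho hp, not_lt]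
  exact ⟨fun h => ⟨h.le, h.ge⟩, fun h => le_antisymm h.1 h.2⟩

lemma continuous_hypGauge (hΩ : Ω ⊆ H2) (hopen : IsOpen Ω) (hconv : GeodesicallyConvex Ω)
    (ho : o ∈ Ω) : Continuous (hypGauge Ω o) := by
  obtain ⟨L, hL⟩ := exists_lipschitz_gaugeAt (convex_klein hΩ hconv) (isOpen_klein hopen)
    ((parab_mem_klein (hΩ ho)).2 ho)
  exact hL.continuous.comp continuous_parab

/-- At boundary points where the gauge is differentiable, its gradient is an outward normal, along
which the distance to any point of `Ω` is nondecreasing. -/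
lemma exists_normal_of_hasFDerivAt_gauge (hΩ : Ω ⊆ H2) (hopen : IsOpen Ω)
    (hconv : GeodesicallyConvex Ω) (ho : o ∈ Ω) {q : ℝ × ℝ} (hq : q ∈ frontier Ω ∩ H2)
    {n : ℝ × ℝ →L[ℝ] ℝ} (hn : HasFDerivAt (gaugeAt (klein Ω) (parab o)) n (parab q)) :
    ∃ ν : ℝ × ℝ, ∃ r : ℝ, 0 < r ∧ (∀ v, n (parabD q v) = r * (ν.1 * v.1 + ν.2 * v.2)) ∧
      IsOutwardNormalAt Ω q ν ∧ ∀ q₀ ∈ Ω, 0 ≤ coshDistD q₀ q ν := by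
  have hK := convex_klein hΩ hconv
  have hKo := isOpen_klein hopen
  have hKa := (parab_mem_klein (hΩ ho)).2 ho
  have hJ : HasFDerivAt (hypGauge Ω o) (n.comp (parabD q)) q := hn.comp q (hasFDerivAt_parab q)
  have hJq : hypGauge Ω o q = 1 := (hypGauge_eq_one hΩ hopen hconv ho hq.2).2 hq.1
  have hself := fderiv_gaugeAt_self hn
  have hpos : ∀ q₀ ∈ Ω, 0 < n (parab q - parab q₀) := by
    intro q₀ hq₀
    have h1 := fderiv_gaugeAt_le hK hKo hKa hn (parab q₀ - parab o)
    have h2 := (hypGauge_lt_one hΩ hopen hconv ho (hΩ hq₀)).2 hq₀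
    rw [add_sub_cancel] at h1
    have h3 : n (parab q - parab q₀) = n (parab q - parab o) - n (parab q₀ - parab o) := by
      rw [← map_sub]; congr 1; abel
    rw [h3, hself]
    unfold hypGauge at h2 hJq
    linarith
  have hGne : n.comp (parabD q) ≠ 0 := by
    intro h0
    have h1 := hpos o ho
    have hq2 : q.2 ≠ 0 := ne_of_gt hq.2
    have h2 : parab q - parab o = parabD q ((parab q - parab o).1,
        ((parab q - parab o).2 - 2 * q.1 * (parab q - parab o).1) / (2 * q.2)) := by
      ext
      · simp
      · simp only [parabD_apply]; field_simp; ring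
    rw [h2] at h1
    have := DFunLike.congr_fun h0 ((parab q - parab o).1,
        ((parab q - parab o).2 - 2 * q.1 * (parab q - parab o).1) / (2 * q.2))
    simp only [ContinuousLinearMap.comp_apply, zero_apply] at this
    linarith
  have hH : ∀ᶠ x in 𝓝 q, x ∈ H2 := isOpen_H2.mem_nhds hq.2
  obtain ⟨ν, r, hr, hν, hout⟩ := exists_isOutwardNormalAt (Ω := Ω) hJ hGne
    (by
      filter_upwards [mem_nhdsWithin_of_mem_nhds hH, self_mem_nhdsWithin] with x hx1 hx2
      rw [hJq, hypGauge_eq_one hΩ hopen hconv ho hx1]; exact hx2)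
    (by
      filter_upwards [self_mem_nhdsWithin] with x hx
      rw [hJq]; exact ((hypGauge_lt_one hΩ hopen hconv ho (hΩ hx)).2 hx).le)
  refine ⟨ν, r, hr, hν, hout, fun q₀ hq₀ => ?_⟩
  have h1 := covector_coshDist (hΩ hq₀) hq.2 n
  have h2 : (n (parabD q (1, 0)), n (parabD q (0, 1))) = r • ν := by
    have e1 := hν (1, 0)
    have e2 := hν (0, 1)
    simp only [ContinuousLinearMap.comp_apply] at e1 e2
    rw [e1, e2]; ext <;> simp
  rw [h2, map_smul, smul_eq_mul] at h1
  have h3 : 0 < r * coshDistD q₀ q ν := by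
    rw [h1]; exact div_pos (hpos q₀ hq₀) (mul_pos hq.2 (hΩ hq₀))
  exact ((mul_pos_iff_of_pos_left hr).1 h3).le

/-- Near the boundary portion away from `D`, the flux of the field `(K₁, K₂)` through level sets of
the gauge is almost nonnegative. -/
lemma exists_flux_lower_bound (hΩ : Ω ⊆ H2) (hopen : IsOpen Ω)
    (hconv : GeodesicallyConvex Ω) (ho : o ∈ Ω) {D T : Set (ℝ × ℝ)} (hD : IsClosed D)
    (hT : IsCompact T) (hTH : T ⊆ H2) (hTD : Disjoint T D) {K₁ K₂ : ℝ × ℝ → ℝ}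
    (hK₁ : ContinuousOn K₁ (closure Ω ∩ H2)) (hK₂ : ContinuousOn K₂ (closure Ω ∩ H2))
    (hKν : ∀ q ∈ (frontier Ω ∩ H2) \ D, ∀ ν : ℝ × ℝ, IsOutwardNormalAt Ω q ν →
      (∀ q₀ ∈ Ω, 0 ≤ coshDistD q₀ q ν) → 0 ≤ K₁ q * ν.1 + K₂ q * ν.2)
    {ε : ℝ} (hε : 0 < ε) :
    ∃ δ > 0, ∀ x ∈ T ∩ Ω, 1 - δ ≤ hypGauge Ω o x → ∀ n : ℝ × ℝ →L[ℝ] ℝ,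
      HasFDerivAt (gaugeAt (klein Ω) (parab o)) n (parab x) →
      -ε ≤ n (parabD x (K₁ x, K₂ x)) := by
  by_contra! hcon
  choose x hxT hxJ n hn hnx using fun k : ℕ => hcon (1 / ((k : ℝ) + 1)) (by positivity)
  obtain ⟨x₀, hx₀T, φ, hφ, hlim⟩ := hT.tendsto_subseq fun k => (hxT k).1
  obtain ⟨L, hL⟩ := exists_lipschitz_gaugeAt (convex_klein hΩ hconv) (isOpen_klein hopen)
    ((parab_mem_klein (hΩ ho)).2 ho)
  have hJc := continuous_hypGauge hΩ hopen hconv ho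
  have hx₀H := hTH hx₀T
  have hJlim : Tendsto (fun k => hypGauge Ω o (x (φ k))) atTop (𝓝 1) := by
    have h1 : Tendsto (fun k : ℕ => 1 - 1 / ((φ k : ℝ) + 1)) atTop (𝓝 1) := by
      have := (tendsto_one_div_add_atTop_nhds_zero_nat (𝕜 := ℝ)).comp hφ.tendsto_atTop
      simpa using this.const_sub 1
    refine tendsto_of_tendsto_of_tendsto_of_le_of_le h1 tendsto_const_nhds
      (fun k => hxJ (φ k)) (fun k => ?_)
    exact ((hypGauge_lt_one hΩ hopen hconv ho (hΩ (hxT (φ k)).2)).2 (hxT (φ k)).2).le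
  have hJ₀ : hypGauge Ω o x₀ = 1 := tendsto_nhds_unique ((hJc.tendsto x₀).comp hlim) hJlim
  have hx₀F : x₀ ∈ frontier Ω := (hypGauge_eq_one hΩ hopen hconv ho hx₀H).1 hJ₀
  have hx₀C : x₀ ∈ closure Ω ∩ H2 := ⟨hx₀F.1, hx₀H⟩
  set z : ℕ → ℝ × ℝ := fun k => parab o + (hypGauge Ω o (x (φ k)))⁻¹ • (parab (x (φ k)) - parab o)
    with hz
  set y : ℕ → ℝ × ℝ := fun k => parabInv (z k) with hy
  have hzlim : Tendsto z atTop (𝓝 (parab x₀)) := by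
    have h1 := (hJlim.inv₀ one_ne_zero).smul
      (((continuous_parab.tendsto x₀).comp hlim).sub_const (parab o))
    have h2 := h1.const_add (parab o)
    simpa using h2
  have hylim : Tendsto y atTop (𝓝 x₀) := by
    have := (continuous_parabInv.tendsto _).comp hzlim
    rwa [parabInv_parab hx₀H] at this
  have hzab : ∀ᶠ k in atTop, (z k).1 ^ 2 < (z k).2 :=
    hzlim.eventually (isOpen_aboveParabola.mem_nhds (parab_mem hx₀H))
  have hJpos : ∀ᶠ k in atTop, 0 < hypGauge Ω o (x (φ k)) :=
    hJlim.eventually (lt_mem_nhds one_pos)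
  have hyF : ∀ᶠ k in atTop, y k ∈ frontier Ω ∩ H2 ∧ parab (y k) = z k := by
    filter_upwards [hzab, hJpos] with k h1 h2
    have h3 : y k ∈ H2 := parabInv_mem h1
    have h4 : parab (y k) = z k := parab_parabInv h1
    refine ⟨⟨(hypGauge_eq_one hΩ hopen hconv ho h3).1 ?_, h3⟩, h4⟩
    rw [hypGauge, h4, hz]
    simp only []
    rw [gaugeAt_homog (by positivity)]
    exact inv_mul_cancel₀ h2.ne'
  have hyD : ∀ᶠ k in atTop, y k ∉ D :=
    hylim.eventually (hD.isOpen_compl.mem_nhds (disjoint_left.1 hTD hx₀T))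
  have hpos : ∀ᶠ k in atTop, 0 ≤ n (φ k) (parabD (y k) (K₁ (y k), K₂ (y k))) := by
    filter_upwards [hyF, hyD, hJpos] with k ⟨h1, h2⟩ h3 h4
    have h5 := hasFDerivAt_gaugeAt_ray (hn (φ k)) (inv_pos.2 h4)
    have h6 : HasFDerivAt (gaugeAt (klein Ω) (parab o)) (n (φ k)) (parab (y k)) := by
      rw [h2]; exact h5
    obtain ⟨ν, r, hr, hν, hout, hc⟩ := exists_normal_of_hasFDerivAt_gauge hΩ hopen hconv ho h1 h6
    rw [hν]
    have := hKν (y k) ⟨h1, h3⟩ ν hout hc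
    refine mul_nonneg hr.le ?_
    simp only []
    linarith
  have hV : ∀ w : ℕ → ℝ × ℝ, Tendsto w atTop (𝓝 x₀) → (∀ᶠ k in atTop, w k ∈ closure Ω ∩ H2) →
      Tendsto (fun k => parabD (w k) (K₁ (w k), K₂ (w k))) atTop
        (𝓝 (parabD x₀ (K₁ x₀, K₂ x₀))) := by
    intro w hw hwC
    have hw' : Tendsto w atTop (𝓝[closure Ω ∩ H2] x₀) := tendsto_nhdsWithin_iff.2 ⟨hw, hwC⟩
    have h1 := (hK₁ x₀ hx₀C).tendsto.comp hw'
    have h2 := (hK₂ x₀ hx₀C).tendsto.comp hw'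
    have h3 := (continuous_fst.tendsto x₀).comp hw
    have h4 := (continuous_snd.tendsto x₀).comp hw
    simp only [parabD_apply]
    exact h1.prodMk_nhds (((h3.const_mul 2).mul h1).add ((h4.const_mul 2).mul h2))
  have hVx := hV (fun k => x (φ k)) hlim (Eventually.of_forall fun k =>
    ⟨subset_closure (hxT (φ k)).2, hΩ (hxT (φ k)).2⟩)
  have hVy := hV y hylim (hyF.mono fun k hk => ⟨hk.1.1.1, hk.1.2⟩)
  have hdiff := (hVy.sub hVx).norm.const_mul (L : ℝ)
  rw [sub_self, norm_zero, mul_zero] at hdiff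
  obtain ⟨k, h1, h2⟩ := (hpos.and (hdiff.eventually (gt_mem_nhds hε))).exists
  have h3 := abs_fderiv_gaugeAt_le hL (hn (φ k))
    (parabD (y k) (K₁ (y k), K₂ (y k)) - parabD (x (φ k)) (K₁ (x (φ k)), K₂ (x (φ k))))
  rw [map_sub] at h3
  have h4 := hnx (φ k)
  have := (abs_le.1 h3).2
  linarith

end hypGauge

/-! ### A Green inequality on geodesically convex domains -/

/-- The radial field in the parabola model, pulled back to the half-plane. -/
def radialField (o p : ℝ × ℝ) : ℝ × ℝ :=
  (p.1 - o.1, (p.2 ^ 2 - (p.1 - o.1) ^ 2 - o.2 ^ 2) / (2 * p.2))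

lemma parabD_radialField (o : ℝ × ℝ) {p : ℝ × ℝ} (hp : p ∈ H2) :
    parabD p (radialField o p) = parab p - parab o := by
  have : p.2 ≠ 0 := ne_of_gt hp
  ext
  · simp [radialField, parab]
  · simp only [parabD_apply, radialField, parab, Prod.snd_sub]; field_simp; ring

lemma contDiffOn_radialField_fst (o : ℝ × ℝ) :
    ContDiffOn ℝ 1 (fun p => (radialField o p).1) H2 := by
  unfold radialField; fun_prop

lemma contDiffOn_radialField_snd (o : ℝ × ℝ) :
    ContDiffOn ℝ 1 (fun p => (radialField o p).2) H2 := by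
  unfold radialField
  refine ContDiffOn.div (by fun_prop) (by fun_prop) fun p hp => ?_
  have : (0 : ℝ) < p.2 := hp
  positivity

/-- The gauge cutoff integral inequality: pairing the gauge cutoff with the divergence of an
almost outward pointing compactly supported field gives a nonnegative number. -/
lemma cutoff_divergence_nonneg {Ω : Set (ℝ × ℝ)} (hΩ : Ω ⊆ H2) (hopen : IsOpen Ω)
    (hconv : GeodesicallyConvex Ω) {o : ℝ × ℝ} (ho : o ∈ Ω) {T : Set (ℝ × ℝ)}
    (hT : IsCompact T) (hTH : T ⊆ H2) {F₁ F₂ : ℝ × ℝ → ℝ} (hF₁ : ContDiffOn ℝ 1 F₁ Ω)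
    (hF₂ : ContDiffOn ℝ 1 F₂ Ω) (hF₁0 : ∀ x ∈ Ω, x ∉ T → F₁ x = 0)
    (hF₂0 : ∀ x ∈ Ω, x ∉ T → F₂ x = 0) {δ₀ : ℝ} (hδ₀ : 0 < δ₀)
    (hflux : ∀ x ∈ T ∩ Ω, 1 - δ₀ ≤ hypGauge Ω o x → ∀ n : ℝ × ℝ →L[ℝ] ℝ,
      HasFDerivAt (gaugeAt (klein Ω) (parab o)) n (parab x) → 0 ≤ n (parabD x (F₁ x, F₂ x)))
    (hint : IntegrableOn (fun x => pdx F₁ x + pdy F₂ x) Ω) :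
    0 ≤ ∫ x in Ω, (pdx F₁ x + pdy F₂ x) := by
  obtain ⟨L, hL⟩ := exists_lipschitz_gaugeAt (convex_klein hΩ hconv) (isOpen_klein hopen)
    ((parab_mem_klein (hΩ ho)).2 ho)
  obtain ⟨θ, hθ, hθc, -, hθ1, -⟩ := exists_bump hT isOpen_univ (subset_univ T)
  have hPs : ContDiff ℝ 1 (fun x => θ x • parab x) :=
    (hθ.smul contDiff_parab).of_le (by exact_mod_cast le_top)
  obtain ⟨B, hB⟩ := hPs.lipschitzWith_of_hasCompactSupport hθc.smul_right (by simp)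
  set J : ℝ × ℝ → ℝ := fun x => gaugeAt (klein Ω) (parab o) (θ x • parab x) with hJdef
  have hJL : LipschitzWith (L * B) J := hL.comp hB
  have hJc : Continuous J := hJL.continuous
  have hJeq : ∀ x ∈ T, J =ᶠ[𝓝 x] hypGauge Ω o := fun x hx => by
    filter_upwards [(eventually_nhdsSet_iff_forall.1 hθ1) x hx] with y hy
    simp [hJdef, hypGauge, hy]
  obtain ⟨Cs, hCs⟩ := exists_lipschitz_step
  have hmain : ∀ δ : ℝ, 0 < δ → 2 * δ ≤ δ₀ →
      0 ≤ ∫ x in Ω, Real.smoothTransition ((1 - δ - J x) / δ) * (pdx F₁ x + pdy F₂ x) := by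
    intro δ hδ hδδ
    set f : ℝ × ℝ → ℝ := fun x => Real.smoothTransition ((1 - δ - J x) / δ) with hf
    obtain ⟨Cf, hfL⟩ : ∃ C : NNReal, LipschitzWith C f := by
      have h1 : LipschitzWith (Real.toNNReal (1 / δ)) fun t : ℝ => (1 - δ - t) / δ := by
        refine LipschitzWith.of_dist_le_mul fun s t => ?_
        rw [Real.coe_toNNReal _ (by positivity), Real.dist_eq, Real.dist_eq, ← sub_div, abs_div,
          abs_of_pos hδ, show 1 - δ - s - (1 - δ - t) = -(s - t) by ring, abs_neg]
        apply le_of_eq; ring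
      exact ⟨_, hCs.comp (h1.comp hJL)⟩
    have hS : IsClosed {x | J x ≤ 1 - δ} := isClosed_le hJc continuous_const
    have hfS : ∀ x, x ∉ {x | J x ≤ 1 - δ} → f x = 0 := by
      intro x hx
      have hx : 1 - δ < J x := not_le.1 hx
      exact Real.smoothTransition.zero_of_nonpos (div_nonpos_of_nonpos_of_nonneg (by linarith) hδ.le)
    have hTS : IsCompact (T ∩ {x | J x ≤ 1 - δ}) := hT.inter_right hS
    have hTSΩ : T ∩ {x | J x ≤ 1 - δ} ⊆ Ω := by
      rintro x ⟨hxT, hxJ⟩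
      have hxJ : J x ≤ 1 - δ := hxJ
      rw [(hJeq x hxT).self_of_nhds] at hxJ
      exact (hypGauge_lt_one hΩ hopen hconv ho (hTH hxT)).1 (by linarith)
    obtain ⟨a1, a2, a3⟩ := integral_lipschitz_mul_fderiv hopen hF₁ hT.isClosed hS hTS hTSΩ hF₁0
      hfL hfS (1, 0)
    obtain ⟨b1, b2, b3⟩ := integral_lipschitz_mul_fderiv hopen hF₂ hT.isClosed hS hTS hTSΩ hF₂0
      hfL hfS (0, 1)
    have e1 : ∫ x in Ω, f x * (pdx F₁ x + pdy F₂ x) =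
        - ∫ x in Ω, (lineDeriv ℝ f x (1, 0) * F₁ x + lineDeriv ℝ f x (0, 1) * F₂ x) := by
      rw [integral_add a2 b2, neg_add, ← a3, ← b3, ← integral_add a1 b1]
      congr 1
      ext x
      simp only [pdx, pdy]; ring
    rw [e1, ← integral_neg]
    refine integral_nonneg_of_ae ?_
    rw [EventuallyLE, ae_restrict_iff' hopen.measurableSet]
    filter_upwards [hJL.ae_differentiableAt] with x hxd hxΩ
    simp only [Pi.zero_apply]
    by_cases hxT : x ∈ T
    swap
    · simp [hF₁0 x hxΩ hxT, hF₂0 x hxΩ hxT]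
    have hxH := hTH hxT
    have hxJ : DifferentiableAt ℝ (hypGauge Ω o) x := (hJeq x hxT).differentiableAt_iff.1 hxd
    have hgd : DifferentiableAt ℝ (gaugeAt (klein Ω) (parab o)) (parab x) := by
      have h1 : DifferentiableAt ℝ (hypGauge Ω o) (parabInv (parab x)) := by
        rwa [parabInv_parab hxH]
      have h2 := h1.comp (parab x) ((contDiffAt_parabInv (parab_mem hxH)).differentiableAt (by simp))
      refine h2.congr_of_eventuallyEq ?_
      filter_upwards [isOpen_aboveParabola.mem_nhds (parab_mem hxH)] with z hz
      simp only [Function.comp, hypGauge]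
      rw [parab_parabInv hz]
    set n := fderiv ℝ (gaugeAt (klein Ω) (parab o)) (parab x) with hn
    have hJx : HasFDerivAt J (n.comp (parabD x)) x :=
      (HasFDerivAt.comp x hgd.hasFDerivAt (hasFDerivAt_parab x)).congr_of_eventuallyEq (hJeq x hxT)
    set s := (1 - δ - J x) / δ with hs
    have hfx : HasFDerivAt f (deriv Real.smoothTransition s • ((1 / δ) • (-(n.comp (parabD x))))) x := by
      have h1 : HasFDerivAt (fun y => (1 - δ - J y) / δ) ((1 / δ) • (-(n.comp (parabD x)))) x := by
        refine ((hJx.const_sub (1 - δ)).const_mul (1 / δ)).congr_of_eventuallyEq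
          (Eventually.of_forall fun y => ?_)
        simp only []; ring
      exact (hasDerivAt_step ((1 - δ - J x) / δ)).comp_hasFDerivAt x h1
    have hld : ∀ v, lineDeriv ℝ f x v = -(deriv Real.smoothTransition s * (1 / δ)) * n (parabD x v) := by
      intro v
      rw [(hfx.hasLineDerivAt v).lineDeriv]
      simp; ring
    have hsum : n (parabD x (1, 0)) * F₁ x + n (parabD x (0, 1)) * F₂ x =
        n (parabD x (F₁ x, F₂ x)) := by
      have := clm_prod_apply (n.comp (parabD x)) (F₁ x, F₂ x)
      simp only [ContinuousLinearMap.comp_apply] at this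
      exact this.symm
    rw [hld, hld, show -(-(deriv Real.smoothTransition s * (1 / δ)) * n (parabD x (1, 0)) * F₁ x +
      -(deriv Real.smoothTransition s * (1 / δ)) * n (parabD x (0, 1)) * F₂ x) =
      deriv Real.smoothTransition s * (1 / δ) * (n (parabD x (1, 0)) * F₁ x +
        n (parabD x (0, 1)) * F₂ x) by ring, hsum]
    by_cases hJs : 1 - δ₀ ≤ J x
    · rw [(hJeq x hxT).self_of_nhds] at hJs
      exact mul_nonneg (mul_nonneg (deriv_step_nonneg _) (by positivity))
        (hflux x ⟨hxT, hxΩ⟩ hJs n hgd.hasFDerivAt)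
    · rw [deriv_step_of_one_le]
      · simp
      · rw [hs, le_div_iff₀ hδ]; linarith
  have hlim : Tendsto (fun k : ℕ => ∫ x in Ω,
      Real.smoothTransition ((1 - δ₀ / (k + 2) - J x) / (δ₀ / (k + 2))) * (pdx F₁ x + pdy F₂ x)) atTop
      (𝓝 (∫ x in Ω, (pdx F₁ x + pdy F₂ x))) := by
    refine tendsto_integral_of_dominated_convergence (fun x => ‖pdx F₁ x + pdy F₂ x‖) ?_ hint.norm ?_ ?_
    · intro k
      refine AEStronglyMeasurable.mul ?_ hint.1
      exact (contDiff_step.continuous.comp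
        ((continuous_const.sub hJc).div_const _)).aestronglyMeasurable
    · intro k
      refine Eventually.of_forall fun x => ?_
      rw [norm_mul, Real.norm_of_nonneg (Real.smoothTransition.nonneg _)]
      exact mul_le_of_le_one_left (norm_nonneg _) (Real.smoothTransition.le_one _)
    · rw [ae_restrict_iff' hopen.measurableSet]
      refine Eventually.of_forall fun x hxΩ => ?_
      by_cases hxT : x ∈ T
      · refine tendsto_const_nhds.congr' ?_
        have hJ1 : J x < 1 := by
          rw [(hJeq x hxT).self_of_nhds]
          exact (hypGauge_lt_one hΩ hopen hconv ho (hΩ hxΩ)).2 hxΩ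
        have ht : Tendsto (fun k : ℕ => 2 * (δ₀ / ((k : ℝ) + 2))) atTop (𝓝 0) := by
          have h1 : Tendsto (fun k : ℕ => (k : ℝ) + 2) atTop atTop :=
            tendsto_atTop_add_const_right _ _ tendsto_natCast_atTop_atTop
          simpa using (h1.const_div_atTop δ₀).const_mul 2
        filter_upwards [ht.eventually (gt_mem_nhds (sub_pos.2 hJ1))] with k hk
        rw [Real.smoothTransition.one_of_one_le, one_mul]
        rw [le_div_iff₀ (by positivity)]
        linarith
      · have h0 : ∀ F : ℝ × ℝ → ℝ, (∀ x ∈ Ω, x ∉ T → F x = 0) → fderiv ℝ F x = 0 := by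
          intro F hF
          rw [Filter.EventuallyEq.fderiv_eq (f₁ := F) (f := fun _ => 0)]
          · simp
          · filter_upwards [hopen.mem_nhds hxΩ, hT.isClosed.isOpen_compl.mem_nhds hxT] with y h1 h2
            exact hF y h1 h2
        simp [pdx, pdy, h0 F₁ hF₁0, h0 F₂ hF₂0]
  refine ge_of_tendsto hlim (Eventually.of_forall fun k => hmain _ (by positivity) ?_)
  rw [← mul_div_assoc, div_le_iff₀ (by positivity)]
  nlinarith [(Nat.cast_nonneg k : (0 : ℝ) ≤ k)]

/-- **Green inequality**: a field with nonnegative outward flux through the boundary away from `D`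
has nonnegative total weighted divergence, for weights supported away from `D`. -/
lemma green_nonneg {Ω : Set (ℝ × ℝ)} (hΩ : Ω ⊆ H2) (hne : Ω.Nonempty) (hopen : IsOpen Ω)
    (hconv : GeodesicallyConvex Ω) {D T : Set (ℝ × ℝ)} (hD : IsClosed D)
    (hT : IsCompact T) (hTH : T ⊆ H2) (hTD : Disjoint T D) {K₁ K₂ η : ℝ × ℝ → ℝ}
    (hK₁ : ContinuousOn K₁ (closure Ω ∩ H2)) (hK₂ : ContinuousOn K₂ (closure Ω ∩ H2))
    (hK₁' : ContDiffOn ℝ 1 K₁ Ω) (hK₂' : ContDiffOn ℝ 1 K₂ Ω)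
    (hKν : ∀ q ∈ (frontier Ω ∩ H2) \ D, ∀ ν : ℝ × ℝ, IsOutwardNormalAt Ω q ν →
      (∀ q₀ ∈ Ω, 0 ≤ coshDistD q₀ q ν) → 0 ≤ K₁ q * ν.1 + K₂ q * ν.2)
    (hη : ContDiffOn ℝ 1 η Ω) {M : ℝ} (hη0 : ∀ x ∈ Ω, 0 ≤ η x) (hηM : ∀ x ∈ Ω, η x ≤ M)
    (hηT : ∀ x ∈ Ω, x ∉ T → η x = 0)
    (hint : IntegrableOn (fun x => pdx (fun y => η y * K₁ y) x + pdy (fun y => η y * K₂ y) x) Ω) :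
    0 ≤ ∫ x in Ω, (pdx (fun y => η y * K₁ y) x + pdy (fun y => η y * K₂ y) x) := by
  obtain ⟨o, ho⟩ := hne
  obtain ⟨ψ, hψ, hψc, hψH, hψ1, hψ01⟩ := exists_bump hT isOpen_H2 hTH
  have hψ1' : ContDiff ℝ 1 ψ := hψ.of_le (by exact_mod_cast le_top)
  have hX₁ : ContDiff ℝ 1 (fun x => ψ x * (radialField o x).1) :=
    contDiff_mul_of_tsupport_subset (n := 1) isOpen_H2 (contDiffOn_radialField_fst o) hψ1' hψH
  have hX₂ : ContDiff ℝ 1 (fun x => ψ x * (radialField o x).2) :=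
    contDiff_mul_of_tsupport_subset (n := 1) isOpen_H2 (contDiffOn_radialField_snd o) hψ1' hψH
  have hintX : IntegrableOn (fun x => pdx (fun x => ψ x * (radialField o x).1) x +
      pdy (fun x => ψ x * (radialField o x).2) x) Ω := by
    refine (Integrable.add ?_ ?_).integrableOn
    · exact ((hX₁.continuous_fderiv (by simp)).clm_apply continuous_const).integrable_of_hasCompactSupport
        (hψc.mul_right.fderiv_apply (𝕜 := ℝ) (1, 0))
    · exact ((hX₂.continuous_fderiv (by simp)).clm_apply continuous_const).integrable_of_hasCompactSupport
        (hψc.mul_right.fderiv_apply (𝕜 := ℝ) (0, 1))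
  set I := ∫ x in Ω, (pdx (fun y => η y * K₁ y) x + pdy (fun y => η y * K₂ y) x)
  set I' := ∫ x in Ω, (pdx (fun x => ψ x * (radialField o x).1) x +
      pdy (fun x => ψ x * (radialField o x).2) x)
  have hTψ : T ⊆ tsupport ψ := fun x hx => subset_tsupport ψ (by
    simp [((eventually_nhdsSet_iff_forall.1 hψ1) x hx).self_of_nhds])
  have key : ∀ ε : ℝ, 0 < ε → 0 ≤ I + ε * I' := by
    intro ε hε
    obtain ⟨δ, hδ, hfl⟩ := exists_flux_lower_bound hΩ hopen hconv ho hD hT hTH hTD hK₁ hK₂ hKν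
      (show 0 < ε / (2 * (|M| + 1)) by positivity)
    have d1 : ∀ x ∈ Ω, pdx (fun y => η y * K₁ y + ε * (ψ y * (radialField o y).1)) x =
        pdx (fun y => η y * K₁ y) x + ε * pdx (fun x => ψ x * (radialField o x).1) x := by
      intro x hx
      have hx' := hopen.mem_nhds hx
      have g1 := ((hη.mul hK₁').contDiffAt hx').differentiableAt (by simp)
      have g2 := hX₁.differentiable (by simp) x
      have := (g1.hasFDerivAt.add (g2.hasFDerivAt.const_mul ε)).fderiv
      simp only [pdx]
      erw [this]
      simp
    have d2 : ∀ x ∈ Ω, pdy (fun y => η y * K₂ y + ε * (ψ y * (radialField o y).2)) x =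
        pdy (fun y => η y * K₂ y) x + ε * pdy (fun x => ψ x * (radialField o x).2) x := by
      intro x hx
      have hx' := hopen.mem_nhds hx
      have g1 := ((hη.mul hK₂').contDiffAt hx').differentiableAt (by simp)
      have g2 := hX₂.differentiable (by simp) x
      have := (g1.hasFDerivAt.add (g2.hasFDerivAt.const_mul ε)).fderiv
      simp only [pdy]
      erw [this]
      simp
    have deq : ∀ x ∈ Ω, (pdx (fun y => η y * K₁ y) x + pdy (fun y => η y * K₂ y) x) +
        ε * (pdx (fun x => ψ x * (radialField o x).1) x +
          pdy (fun x => ψ x * (radialField o x).2) x) =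
        pdx (fun y => η y * K₁ y + ε * (ψ y * (radialField o y).1)) x +
        pdy (fun y => η y * K₂ y + ε * (ψ y * (radialField o y).2)) x := by
      intro x hx
      rw [d1 x hx, d2 x hx]; ring
    have e : I + ε * I' = ∫ x in Ω,
        (pdx (fun y => η y * K₁ y + ε * (ψ y * (radialField o y).1)) x +
        pdy (fun y => η y * K₂ y + ε * (ψ y * (radialField o y).2)) x) := by
      rw [← setIntegral_congr_fun hopen.measurableSet deq, integral_add hint (hintX.const_mul ε),
        integral_const_mul]
    rw [e]
    refine cutoff_divergence_nonneg hΩ hopen hconv ho hψc hψH ?_ ?_ ?_ ?_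
      (lt_min hδ (show (0 : ℝ) < 1 / 2 by norm_num)) ?_ ?_
    · exact (hη.mul hK₁').add (contDiffOn_const.mul hX₁.contDiffOn)
    · exact (hη.mul hK₂').add (contDiffOn_const.mul hX₂.contDiffOn)
    · intro x hx hxψ
      simp [hηT x hx fun h => hxψ (hTψ h), image_eq_zero_of_notMem_tsupport hxψ]
    · intro x hx hxψ
      simp [hηT x hx fun h => hxψ (hTψ h), image_eq_zero_of_notMem_tsupport hxψ]
    · rintro x ⟨hxψ, hxΩ⟩ hxJ n hn
      have hxJ1 : 1 - δ ≤ hypGauge Ω o x := by linarith [min_le_left δ (1 / 2 : ℝ)]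
      have hxJ2 : 1 / 2 ≤ hypGauge Ω o x := by linarith [min_le_right δ (1 / 2 : ℝ)]
      have hsplit : n (parabD x (η x * K₁ x + ε * (ψ x * (radialField o x).1),
          η x * K₂ x + ε * (ψ x * (radialField o x).2))) =
          η x * n (parabD x (K₁ x, K₂ x)) + ε * ψ x * hypGauge Ω o x := by
        have h1 : ((η x * K₁ x + ε * (ψ x * (radialField o x).1),
          η x * K₂ x + ε * (ψ x * (radialField o x).2)) : ℝ × ℝ) =
          η x • (K₁ x, K₂ x) + (ε * ψ x) • radialField o x := by
          ext <;> simp [mul_assoc]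
        rw [h1, map_add, map_add, map_smul, map_smul, map_smul, map_smul,
          parabD_radialField o (hψH hxψ), fderiv_gaugeAt_self hn]
        simp [hypGauge]
      rw [hsplit]
      by_cases hxT : x ∈ T
      · have h1 := hfl x ⟨hxT, hxΩ⟩ hxJ1 n hn
        have h2 : ψ x = 1 := ((eventually_nhdsSet_iff_forall.1 hψ1) x hxT).self_of_nhds
        have h3 := hη0 x hxΩ
        have h4 : η x ≤ |M| + 1 := by linarith [hηM x hxΩ, le_abs_self M]
        have h5 : η x * (ε / (2 * (|M| + 1))) ≤ ε / 2 := by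
          calc _ ≤ (|M| + 1) * (ε / (2 * (|M| + 1))) := by gcongr
            _ = ε / 2 := by field_simp
        rw [h2]
        nlinarith [mul_le_mul_of_nonneg_left h1 h3]
      · rw [hηT x hxΩ hxT, zero_mul, zero_add]
        exact mul_nonneg (mul_nonneg hε.le (hψ01 x).1) (by linarith)
    · exact (hint.add (hintX.const_mul ε)).congr_fun deq hopen.measurableSet
  by_contra! hneg
  have h1 := key (-I / (2 * (|I'| + 1))) (by have := abs_nonneg I'; apply div_pos <;> linarith)
  have h2 : -I / (2 * (|I'| + 1)) * I' ≤ -I / 2 := by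
    have h3 : I' ≤ |I'| + 1 := by linarith [le_abs_self I']
    have h4 : 0 ≤ -I / (2 * (|I'| + 1)) := by
      have := abs_nonneg I'; apply div_nonneg <;> linarith
    calc _ ≤ -I / (2 * (|I'| + 1)) * (|I'| + 1) := by gcongr
      _ = -I / 2 := by have := abs_nonneg I'; field_simp
  linarith

/-! ### Calculus of partial derivatives -/

section pd

variable {f g : ℝ × ℝ → ℝ} {x : ℝ × ℝ}

lemma fderiv_eq_pd (v : ℝ × ℝ) : fderiv ℝ f x v = pdx f x * v.1 + pdy f x * v.2 :=
  clm_prod_apply _ v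

lemma HasFDerivAt.pdx_eq {f' : ℝ × ℝ →L[ℝ] ℝ} (h : HasFDerivAt f f' x) : pdx f x = f' (1, 0) := by
  rw [pdx, h.fderiv]

lemma HasFDerivAt.pdy_eq {f' : ℝ × ℝ →L[ℝ] ℝ} (h : HasFDerivAt f f' x) : pdy f x = f' (0, 1) := by
  rw [pdy, h.fderiv]

lemma Filter.EventuallyEq.pdx_eq (h : f =ᶠ[𝓝 x] g) : pdx f x = pdx g x := by
  rw [pdx, pdx, h.fderiv_eq]

lemma Filter.EventuallyEq.pdy_eq (h : f =ᶠ[𝓝 x] g) : pdy f x = pdy g x := by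
  rw [pdy, pdy, h.fderiv_eq]

lemma pdx_mul (hf : DifferentiableAt ℝ f x) (hg : DifferentiableAt ℝ g x) :
    pdx (fun y => f y * g y) x = pdx f x * g x + f x * pdx g x := by
  rw [(hf.hasFDerivAt.fun_mul hg.hasFDerivAt).pdx_eq]
  simp [pdx]; ring

lemma pdy_mul (hf : DifferentiableAt ℝ f x) (hg : DifferentiableAt ℝ g x) :
    pdy (fun y => f y * g y) x = pdy f x * g x + f x * pdy g x := by
  rw [(hf.hasFDerivAt.fun_mul hg.hasFDerivAt).pdy_eq]
  simp [pdy]; ring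

lemma pdx_add (hf : DifferentiableAt ℝ f x) (hg : DifferentiableAt ℝ g x) :
    pdx (fun y => f y + g y) x = pdx f x + pdx g x := by
  rw [(hf.hasFDerivAt.fun_add hg.hasFDerivAt).pdx_eq]
  simp [pdx]

lemma pdy_add (hf : DifferentiableAt ℝ f x) (hg : DifferentiableAt ℝ g x) :
    pdy (fun y => f y + g y) x = pdy f x + pdy g x := by
  rw [(hf.hasFDerivAt.fun_add hg.hasFDerivAt).pdy_eq]
  simp [pdy]

lemma pdx_sub (hf : DifferentiableAt ℝ f x) (hg : DifferentiableAt ℝ g x) :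
    pdx (fun y => f y - g y) x = pdx f x - pdx g x := by
  rw [(hf.hasFDerivAt.fun_sub hg.hasFDerivAt).pdx_eq]
  simp [pdx]

lemma pdy_sub (hf : DifferentiableAt ℝ f x) (hg : DifferentiableAt ℝ g x) :
    pdy (fun y => f y - g y) x = pdy f x - pdy g x := by
  rw [(hf.hasFDerivAt.fun_sub hg.hasFDerivAt).pdy_eq]
  simp [pdy]

lemma pdx_const_mul (c : ℝ) (hf : DifferentiableAt ℝ f x) :
    pdx (fun y => c * f y) x = c * pdx f x := by
  rw [(hf.hasFDerivAt.const_mul c).pdx_eq]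
  simp [pdx]

lemma pdy_const_mul (c : ℝ) (hf : DifferentiableAt ℝ f x) :
    pdy (fun y => c * f y) x = c * pdy f x := by
  rw [(hf.hasFDerivAt.const_mul c).pdy_eq]
  simp [pdy]

lemma pdx_neg : pdx (fun y => -f y) x = -pdx f x := by
  simp [pdx, fderiv_fun_neg]

lemma pdy_neg : pdy (fun y => -f y) x = -pdy f x := by
  simp [pdy, fderiv_fun_neg]

lemma pdx_comp {φ : ℝ → ℝ} {φ' : ℝ} (hφ : HasDerivAt φ φ' (f x)) (hf : DifferentiableAt ℝ f x) :
    pdx (fun y => φ (f y)) x = φ' * pdx f x := by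
  have h : HasFDerivAt (fun y => φ (f y)) (φ' • fderiv ℝ f x) x :=
    hφ.comp_hasFDerivAt x hf.hasFDerivAt
  rw [h.pdx_eq]
  simp [pdx]

lemma pdy_comp {φ : ℝ → ℝ} {φ' : ℝ} (hφ : HasDerivAt φ φ' (f x)) (hf : DifferentiableAt ℝ f x) :
    pdy (fun y => φ (f y)) x = φ' * pdy f x := by
  have h : HasFDerivAt (fun y => φ (f y)) (φ' • fderiv ℝ f x) x :=
    hφ.comp_hasFDerivAt x hf.hasFDerivAt
  rw [h.pdy_eq]
  simp [pdy]

lemma contDiffOn_pdx {Ω : Set (ℝ × ℝ)} (hΩ : IsOpen Ω) {m n : WithTop ℕ∞}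
    (hf : ContDiffOn ℝ n f Ω) (hmn : m + 1 ≤ n) : ContDiffOn ℝ m (pdx f) Ω :=
  (hf.fderiv_of_isOpen hΩ hmn).clm_apply contDiffOn_const

lemma contDiffOn_pdy {Ω : Set (ℝ × ℝ)} (hΩ : IsOpen Ω) {m n : WithTop ℕ∞}
    (hf : ContDiffOn ℝ n f Ω) (hmn : m + 1 ≤ n) : ContDiffOn ℝ m (pdy f) Ω :=
  (hf.fderiv_of_isOpen hΩ hmn).clm_apply contDiffOn_const

end pd

/-! ### Differentiability up to the boundary -/

lemma uniqueDiffOn_closure {Ω : Set (ℝ × ℝ)} (hΩ : Ω ⊆ H2) (hne : Ω.Nonempty) (hopen : IsOpen Ω)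
    (hconv : GeodesicallyConvex Ω) : UniqueDiffOn ℝ (closure Ω ∩ H2) := by
  have e : closure Ω ∩ H2 = parabInv '' (closure (klein Ω) ∩ {z | z.1 ^ 2 < z.2}) := by
    ext p
    constructor
    · rintro ⟨h1, h2⟩
      exact ⟨parab p, ⟨(parab_mem_closure_klein hΩ h2).2 h1, parab_mem h2⟩, parabInv_parab h2⟩
    · rintro ⟨z, ⟨h1, h2⟩, rfl⟩
      have h3 := parabInv_mem h2
      refine ⟨(parab_mem_closure_klein hΩ h3).1 ?_, h3⟩
      rwa [parab_parabInv h2]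
  obtain ⟨o, ho⟩ := hne
  have hu : UniqueDiffOn ℝ (closure (klein Ω) ∩ {z : ℝ × ℝ | z.1 ^ 2 < z.2}) := by
    refine uniqueDiffOn_convex ((convex_klein hΩ hconv).closure.inter convex_aboveParabola) ?_
    refine ⟨parab o, mem_interior.2 ⟨klein Ω, fun z hz => ⟨subset_closure hz, hz.1⟩,
      isOpen_klein hopen, (parab_mem_klein (hΩ ho)).2 ho⟩⟩
  rw [e]
  refine hu.image (f' := fun z => fderiv ℝ parabInv z) (fun z hz => ?_) (fun z hz => ?_)
  · exact ((contDiffAt_parabInv hz.2).differentiableAt (by simp)).hasFDerivAt.hasFDerivWithinAt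
  · refine Function.Surjective.denseRange fun v => ⟨parabD (parabInv z) v, ?_⟩
    have h1 := ((contDiffAt_parabInv hz.2).differentiableAt (by simp)).hasFDerivAt
    rw [← parab_parabInv hz.2] at h1
    have h2 := h1.comp (parabInv z) (hasFDerivAt_parab (parabInv z))
    have h3 : HasFDerivAt (parabInv ∘ parab) (ContinuousLinearMap.id ℝ (ℝ × ℝ)) (parabInv z) := by
      refine (hasFDerivAt_id _).congr_of_eventuallyEq ?_
      filter_upwards [isOpen_H2.mem_nhds (parabInv_mem hz.2)] with y hy
      exact parabInv_parab hy
    have h4 := DFunLike.congr_fun (h2.unique h3) v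
    simpa only [parab_parabInv hz.2, ContinuousLinearMap.comp_apply,
      ContinuousLinearMap.id_apply] using h4

/-! ### Cutoff functions -/

lemma isCompact_coshDist_le {o : ℝ × ℝ} (ho : o ∈ H2) {E : ℝ} (hE : 0 < E) :
    IsCompact {x | x ∈ H2 ∧ coshDist o x ≤ E} := by
  have ho' : (0 : ℝ) < o.2 := ho
  have e : {x | x ∈ H2 ∧ coshDist o x ≤ E} =
      {x : ℝ × ℝ | (x.1 - o.1) ^ 2 + x.2 ^ 2 + o.2 ^ 2 ≤ E * (2 * x.2 * o.2)} := by
    ext x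
    simp only [mem_ofPred_eq]
    constructor
    · rintro ⟨h1, h2⟩
      have h1' : (0 : ℝ) < x.2 := h1
      rwa [coshDist, div_le_iff₀ (by positivity)] at h2
    · intro h
      have h1 : (0 : ℝ) < x.2 := by
        by_contra hx
        push Not at hx
        nlinarith [sq_nonneg (x.1 - o.1), sq_nonneg x.2, mul_pos ho' ho',
          mul_nonneg (mul_nonneg hE.le ho'.le) (neg_nonneg.2 hx)]
      exact ⟨h1, by rwa [coshDist, div_le_iff₀ (by positivity)]⟩
  rw [e]
  refine Metric.isCompact_of_isClosed_isBounded (isClosed_le (by fun_prop) (by fun_prop)) ?_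
  refine (isCompact_Icc (a := ((o.1 - 2 * E * o.2, 0) : ℝ × ℝ))
    (b := (o.1 + 2 * E * o.2, 2 * E * o.2))).isBounded.subset fun x hx => ?_
  simp only [mem_ofPred_eq] at hx
  have hEo : 0 < E * o.2 := mul_pos hE ho'
  have h1 : 0 ≤ x.2 := by
    by_contra hx'
    push Not at hx'
    nlinarith [sq_nonneg (x.1 - o.1), sq_nonneg x.2, mul_pos ho' ho']
  have h2 : x.2 ≤ 2 * E * o.2 := by
    by_contra hx'
    push Not at hx'
    nlinarith [sq_nonneg (x.1 - o.1), mul_pos ho' ho']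
  have h3 : |x.1 - o.1| ≤ 2 * E * o.2 := by
    refine abs_le_of_sq_le_sq ?_ (by nlinarith)
    nlinarith [sq_nonneg x.2, mul_pos ho' ho', sq_nonneg (x.2 - E * o.2)]
  have := abs_le.1 h3
  exact ⟨⟨by simp only []; linarith, h1⟩, ⟨by simp only []; linarith, h2⟩⟩

/-- The logarithmic cutoff at scale `n` about `o`. -/
def cutoff (o : ℝ × ℝ) (n : ℕ) (x : ℝ × ℝ) : ℝ :=
  Real.smoothTransition (2 - Real.log (coshDist o x) / (n + 1))

/-- The compact set supporting the cutoff. -/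
def cutoffSupp (o : ℝ × ℝ) (n : ℕ) : Set (ℝ × ℝ) :=
  {x | x ∈ H2 ∧ coshDist o x ≤ Real.exp (2 * (n + 1))}

section cutoff

variable {o : ℝ × ℝ} {n : ℕ}

lemma isCompact_cutoffSupp (ho : o ∈ H2) : IsCompact (cutoffSupp o n) :=
  isCompact_coshDist_le ho (Real.exp_pos _)

lemma contDiffOn_coshDist (ho : o ∈ H2) : ContDiffOn ℝ (⊤ : ℕ∞) (coshDist o) H2 := by
  unfold coshDist
  refine ContDiffOn.div (by fun_prop) (by fun_prop) fun p hp => ?_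
  have h1 : (0 : ℝ) < p.2 := hp
  have h2 : (0 : ℝ) < o.2 := ho
  positivity

lemma cutoff_nonneg (x : ℝ × ℝ) : 0 ≤ cutoff o n x := Real.smoothTransition.nonneg _

lemma cutoff_le_one (x : ℝ × ℝ) : cutoff o n x ≤ 1 := Real.smoothTransition.le_one _

lemma cutoff_eq_zero (ho : o ∈ H2) {x : ℝ × ℝ} (hx : x ∈ H2) (h : x ∉ cutoffSupp o n) :
    cutoff o n x = 0 := by
  have h1 : Real.exp (2 * (n + 1)) < coshDist o x := by
    by_contra h2; exact h ⟨hx, not_lt.1 h2⟩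
  refine Real.smoothTransition.zero_of_nonpos ?_
  rw [sub_nonpos, le_div_iff₀ (by positivity)]
  exact (Real.lt_log_iff_exp_lt (by linarith [one_le_coshDist ho hx])).2 h1 |>.le

lemma contDiffOn_cutoff (ho : o ∈ H2) : ContDiffOn ℝ (⊤ : ℕ∞) (cutoff o n) H2 := by
  refine contDiff_step.comp_contDiffOn (contDiffOn_const.sub (ContDiffOn.div_const ?_ _))
  exact (contDiffOn_coshDist ho).log fun x hx => by linarith [one_le_coshDist ho hx]

lemma tendsto_cutoff (x : ℝ × ℝ) : Tendsto (fun n => cutoff o n x) atTop (𝓝 1) := by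
  refine tendsto_const_nhds.congr' ?_
  filter_upwards [eventually_ge_atTop ⌈Real.log (coshDist o x)⌉₊] with n hn
  have h1 : Real.log (coshDist o x) ≤ n := (Nat.le_ceil _).trans (by exact_mod_cast hn)
  refine (Real.smoothTransition.one_of_one_le ?_).symm
  have : Real.log (coshDist o x) / (n + 1) ≤ 1 := by
    rw [div_le_one (by positivity)]; linarith
  linarith

lemma sq_coshDistD (ho : o ∈ H2) {x : ℝ × ℝ} (hx : x ∈ H2) :
    x.2 ^ 2 * (coshDistD o x (1, 0) ^ 2 + coshDistD o x (0, 1) ^ 2) = coshDist o x ^ 2 - 1 := by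
  have h1 : x.2 ≠ 0 := ne_of_gt hx
  have h2 : o.2 ≠ 0 := ne_of_gt ho
  simp [coshDist]
  field_simp
  ring

lemma exists_gradSq_cutoff_le (ho : o ∈ H2) : ∃ M : ℝ, 0 < M ∧ ∀ n : ℕ, ∀ x ∈ H2,
    gradSq (cutoff o n) x ≤ (M / (n + 1)) ^ 2 / x.2 ^ 2 := by
  obtain ⟨M, hM, hMb⟩ := exists_deriv_step_le
  refine ⟨M, hM, fun n x hx => ?_⟩
  have hC := one_le_coshDist ho hx
  have hx2 : (0 : ℝ) < x.2 := hx
  set C := coshDist o x with hCdef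
  set d := deriv Real.smoothTransition (2 - Real.log C / (n + 1)) with hd
  have h1 : HasFDerivAt (cutoff o n) (d • -((1 / ((n : ℝ) + 1)) • (C⁻¹ • coshDistD o x))) x := by
    have h2 : HasFDerivAt (fun x => 2 - Real.log (coshDist o x) / (n + 1))
        (-((1 / ((n : ℝ) + 1)) • (C⁻¹ • coshDistD o x))) x := by
      have := (((hasFDerivAt_coshDist ho hx).log (by linarith)).const_mul (1 / ((n : ℝ) + 1))).const_sub 2
      refine this.congr_of_eventuallyEq (Eventually.of_forall fun y => ?_)
      simp only []; ring
    exact (hasDerivAt_step (2 - Real.log (coshDist o x) / (n + 1))).comp_hasFDerivAt x h2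
  have hs := sq_coshDistD ho hx
  rw [gradSq, h1.pdx_eq, h1.pdy_eq, le_div_iff₀ (by positivity)]
  have e : ((d • -((1 / ((n : ℝ) + 1)) • (C⁻¹ • coshDistD o x))) (1, 0) ^ 2 +
      (d • -((1 / ((n : ℝ) + 1)) • (C⁻¹ • coshDistD o x))) (0, 1) ^ 2) * x.2 ^ 2 =
      (d / (n + 1)) ^ 2 * ((C ^ 2 - 1) / C ^ 2) := by
    rw [← hs]
    simp only [smul_apply, neg_apply, smul_eq_mul]
    field_simp
  rw [e]
  have hd0 : 0 ≤ d := deriv_step_nonneg _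
  have hdM : d ≤ M := hMb _
  have h3 : (C ^ 2 - 1) / C ^ 2 ≤ 1 := by
    rw [div_le_one (by positivity)]; linarith
  calc _ ≤ (d / (n + 1)) ^ 2 * 1 := by gcongr
    _ ≤ _ := by rw [mul_one]; gcongr

end cutoff

/-! ### A smooth convex approximation of the positive part -/

/-- A smooth convex approximation of `max t 0`. -/
def ramp (t : ℝ) : ℝ := ∫ s in (0 : ℝ)..t, Real.smoothTransition (s - 1)

section ramp

lemma hasDerivAt_ramp (t : ℝ) : HasDerivAt ramp (Real.smoothTransition (t - 1)) t := by
  have hc : Continuous fun s : ℝ => Real.smoothTransition (s - 1) :=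
    contDiff_step.continuous.comp (continuous_id.sub continuous_const)
  exact intervalIntegral.integral_hasDerivAt_right (hc.intervalIntegrable _ _)
    (hc.stronglyMeasurableAtFilter _ _) hc.continuousAt

lemma contDiff_ramp : ContDiff ℝ (⊤ : ℕ∞) ramp := by
  rw [contDiff_infty_iff_deriv]
  refine ⟨fun t => (hasDerivAt_ramp t).differentiableAt, ?_⟩
  have : deriv ramp = fun t => Real.smoothTransition (t - 1) :=
    funext fun t => (hasDerivAt_ramp t).deriv
  rw [this]
  exact contDiff_step.comp (contDiff_id.sub contDiff_const)

lemma ramp_mono : Monotone ramp :=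
  monotone_of_hasDerivAt_nonneg hasDerivAt_ramp fun _ => Real.smoothTransition.nonneg _

lemma ramp_of_le_one {t : ℝ} (ht : t ≤ 1) : ramp t = 0 := by
  unfold ramp
  rw [intervalIntegral.integral_congr (g := fun _ => (0 : ℝ))]
  · simp
  · intro s hs
    refine Real.smoothTransition.zero_of_nonpos ?_
    have := hs.2
    have : s ≤ 1 := this.trans (max_le zero_le_one ht)
    linarith

lemma ramp_nonneg (t : ℝ) : 0 ≤ ramp t := by
  rcases le_total t 1 with h | h
  · exact (ramp_of_le_one h).ge
  · rw [← ramp_of_le_one (le_refl 1)]; exact ramp_mono h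

lemma ramp_le_max (t : ℝ) : ramp t ≤ max t 0 := by
  rcases le_total t 1 with h | h
  · rw [ramp_of_le_one h]; exact le_max_right _ _
  · have h1 : Monotone fun t => t - ramp t :=
      monotone_of_hasDerivAt_nonneg (fun t => (hasDerivAt_id t).sub (hasDerivAt_ramp t))
        fun t => by simpa using Real.smoothTransition.le_one _
    have h2 := h1 (show (0 : ℝ) ≤ t by linarith)
    simp only [ramp_of_le_one (zero_le_one)] at h2
    exact le_max_of_le_left (by linarith)

lemma ramp_le_abs (t : ℝ) : ramp t ≤ |t| :=
  (ramp_le_max t).trans (max_le (le_abs_self t) (abs_nonneg t))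

lemma sub_two_le_ramp (t : ℝ) : t - 2 ≤ ramp t := by
  rcases le_total t 2 with h | h
  · linarith [ramp_nonneg t]
  · have h1 : MonotoneOn (fun t => ramp t - t) (Ici 2) := by
      refine monotoneOn_of_deriv_nonneg (convex_Ici 2) ?_ ?_ ?_
      · exact (contDiff_ramp.continuous.sub continuous_id).continuousOn
      · exact fun t _ => ((hasDerivAt_ramp t).sub (hasDerivAt_id t)).differentiableAt.differentiableWithinAt
      · intro t ht
        rw [interior_Ici] at ht
        have := ((hasDerivAt_ramp t).sub (hasDerivAt_id t)).deriv
        rw [show (fun t => ramp t - t) = ramp - id from rfl, this,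
          Real.smoothTransition.one_of_one_le (by simp at ht; linarith)]
        simp
    have h2 := h1 (show (2 : ℝ) ∈ Ici 2 by simp) h h
    simp only at h2
    linarith [ramp_nonneg 2]

lemma mul_deriv_sub_ramp_le (t : ℝ) : t * Real.smoothTransition (t - 1) - ramp t ≤ 2 := by
  rcases le_total t 0 with h | h
  · rw [Real.smoothTransition.zero_of_nonpos (by linarith)]
    linarith [ramp_nonneg t]
  · nlinarith [Real.smoothTransition.le_one (t - 1), sub_two_le_ramp t]

lemma exists_ramp_mul_deriv_le : ∃ M : ℝ, 0 < M ∧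
    ∀ t, ramp t * deriv Real.smoothTransition (t - 1) ≤ M := by
  obtain ⟨M, hM, h⟩ := exists_deriv_step_le
  refine ⟨2 * M, by positivity, fun t => ?_⟩
  rcases le_total t 2 with h2 | h2
  · refine mul_le_mul ((ramp_le_max t).trans (max_le h2 zero_le_two)) (h _)
      (deriv_step_nonneg _) zero_le_two
  · rw [deriv_step_of_one_le (by linarith)]; simp; positivity

lemma tendsto_ramp (a : ℝ) :
    Tendsto (fun n : ℕ => (1 / ((n : ℝ) + 1)) * ramp (a * (n + 1))) atTop (𝓝 (max a 0)) := by
  have h0 : Tendsto (fun n : ℕ => 1 / ((n : ℝ) + 1)) atTop (𝓝 0) :=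
    tendsto_one_div_add_atTop_nhds_zero_nat
  have hl : Tendsto (fun n : ℕ => max (a - 2 * (1 / ((n : ℝ) + 1))) 0) atTop (𝓝 (max a 0)) := by
    have := ((tendsto_const_nhds (x := a)).sub (h0.const_mul 2)).max
      (tendsto_const_nhds (x := (0 : ℝ)))
    simpa using this
  refine tendsto_of_tendsto_of_tendsto_of_le_of_le hl tendsto_const_nhds (fun n => ?_) fun n => ?_
  · have hn : (0 : ℝ) < n + 1 := by positivity
    refine max_le ?_ (mul_nonneg (by positivity) (ramp_nonneg _))
    have := mul_le_mul_of_nonneg_left (sub_two_le_ramp (a * (n + 1)))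
      (show 0 ≤ 1 / ((n : ℝ) + 1) by positivity)
    refine le_trans (le_of_eq ?_) this
    field_simp
  · have hn : (0 : ℝ) < n + 1 := by positivity
    have := mul_le_mul_of_nonneg_left (ramp_le_max (a * (n + 1)))
      (show 0 ≤ 1 / ((n : ℝ) + 1) by positivity)
    refine this.trans (le_of_eq ?_)
    rw [mul_max_of_nonneg _ _ (by positivity)]
    congr 1
    · field_simp
    · simp

end ramp

/-! ### Mixed eigenfunctions -/

/-- `u` is a mixed Dirichlet-Neumann eigenfunction on `Ω` (possibly zero) for an eigenvalue `lam`
below the mixed spectrum. -/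
structure MixedEigen (Ω D : Set (ℝ × ℝ)) (lam : ℝ) (u : ℝ × ℝ → ℝ) : Prop where
  subH : Ω ⊆ H2
  ne : Ω.Nonempty
  isOpen : IsOpen Ω
  conn : IsConnected Ω
  conv : GeodesicallyConvex Ω
  area : IntegrableOn (fun p : ℝ × ℝ => 1 / p.2 ^ 2) Ω volume
  subD : D ⊆ frontier Ω ∩ H2
  neD : D.Nonempty
  closedD : IsClosed D
  connD : IsConnected D
  pos : 0 < lam
  smooth : ContDiffOn ℝ (⊤ : ℕ∞) u Ω
  c1 : ContDiffOn ℝ 1 u (closure Ω ∩ H2)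
  l2 : IntegrableOn (fun p : ℝ × ℝ => u p ^ 2 / p.2 ^ 2) Ω volume
  h1 : IntegrableOn (gradSq u) Ω volume
  eigen : ∀ p ∈ Ω, -hypLap u p = lam * u p
  dirichlet : ∀ q ∈ D, u q = 0
  neumann : ∀ q ∈ (frontier Ω ∩ H2) \ D, ∀ ν : ℝ × ℝ, IsOutwardNormalAt Ω q ν →
      fderivWithin ℝ u (closure Ω ∩ H2) q ν = 0
  least : ∀ w : ℝ × ℝ → ℝ, ContDiffOn ℝ (⊤ : ℕ∞) w Ω →
      (∃ V : Set (ℝ × ℝ), IsOpen V ∧ D ⊆ V ∧ ∀ x ∈ V ∩ closure Ω, w x = 0) →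
      IntegrableOn (fun p : ℝ × ℝ => w p ^ 2 / p.2 ^ 2) Ω volume →
      IntegrableOn (gradSq w) Ω volume →
      lam * ∫ p in Ω, w p ^ 2 / p.2 ^ 2 ≤ ∫ p in Ω, gradSq w p

namespace MixedEigen

variable {Ω D : Set (ℝ × ℝ)} {lam : ℝ} {u : ℝ × ℝ → ℝ}

lemma neg (h : MixedEigen Ω D lam u) : MixedEigen Ω D lam (fun p => -u p) := by
  have ex : pdx (fun p => -u p) = fun p => -pdx u p := funext fun x => pdx_neg
  have ey : pdy (fun p => -u p) = fun p => -pdy u p := funext fun x => pdy_neg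
  refine { h with smooth := h.smooth.neg, c1 := h.c1.neg, l2 := ?_, h1 := ?_, eigen := ?_,
                  dirichlet := ?_, neumann := ?_ }
  · simpa using h.l2
  · have : gradSq (fun p => -u p) = gradSq u := by
      funext p; simp [gradSq, ex, ey]
    rw [this]; exact h.h1
  · intro p hp
    have := h.eigen p hp
    simp only [hypLap, ex, ey, pdx_neg, pdy_neg] at this ⊢
    linarith
  · intro q hq; simp [h.dirichlet q hq]
  · intro q hq ν hν
    have := h.neumann q hq ν hν
    rw [fderivWithin_fun_neg]
    · simpa using this
    · exact uniqueDiffOn_closure h.subH h.ne h.isOpen h.conv q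
        ⟨frontier_subset_closure hq.1.1, hq.1.2⟩

lemma contAt (h : MixedEigen Ω D lam u) {x : ℝ × ℝ} (hx : x ∈ Ω) : Ω ∈ 𝓝 x := h.isOpen.mem_nhds hx

lemma diffAt (h : MixedEigen Ω D lam u) {x : ℝ × ℝ} (hx : x ∈ Ω) : DifferentiableAt ℝ u x :=
  (h.smooth.contDiffAt (h.contAt hx)).differentiableAt (by simp)

lemma closure_mem_nhds (h : MixedEigen Ω D lam u) {x : ℝ × ℝ} (hx : x ∈ Ω) :
    closure Ω ∩ H2 ∈ 𝓝 x :=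
  mem_of_superset (h.contAt hx) fun _ hy => ⟨subset_closure hy, h.subH hy⟩

lemma fderivWithin_eq (h : MixedEigen Ω D lam u) {x : ℝ × ℝ} (hx : x ∈ Ω) :
    fderivWithin ℝ u (closure Ω ∩ H2) x = fderiv ℝ u x :=
  fderivWithin_of_mem_nhds (h.closure_mem_nhds hx)

lemma uniqueDiff (h : MixedEigen Ω D lam u) : UniqueDiffOn ℝ (closure Ω ∩ H2) :=
  uniqueDiffOn_closure h.subH h.ne h.isOpen h.conv

lemma continuousOn_bd (h : MixedEigen Ω D lam u) (v : ℝ × ℝ) :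
    ContinuousOn (fun q => fderivWithin ℝ u (closure Ω ∩ H2) q v) (closure Ω ∩ H2) :=
  (h.c1.continuousOn_fderivWithin h.uniqueDiff le_rfl).clm_apply continuousOn_const

lemma disjointD (h : MixedEigen Ω D lam u) : Disjoint Ω D := by
  rw [Set.disjoint_left]
  intro x hx hxD
  have := (h.subD hxD).1
  rw [h.isOpen.frontier_eq] at this
  exact this.2 hx

lemma laplace (h : MixedEigen Ω D lam u) {x : ℝ × ℝ} (hx : x ∈ Ω) :
    pdx (pdx u) x + pdy (pdy u) x = -(lam * u x / x.2 ^ 2) := by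
  have h1 := h.eigen x hx
  have h2 : x.2 ≠ 0 := ne_of_gt (h.subH hx)
  unfold hypLap at h1
  field_simp
  linarith

lemma exists_small_near (h : MixedEigen Ω D lam u) {ε : ℝ} (hε : 0 < ε) :
    ∃ V : Set (ℝ × ℝ), IsOpen V ∧ D ⊆ V ∧ V ⊆ H2 ∧ ∀ x ∈ V ∩ closure Ω, |u x| < ε := by
  have h1 : ContinuousOn (fun x => |u x|) (closure Ω ∩ H2) := h.c1.continuousOn.abs
  obtain ⟨V, hV, hV2⟩ := (continuousOn_iff'.1 h1) (Iio ε) isOpen_Iio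
  refine ⟨V ∩ H2, hV.inter isOpen_H2, fun q hq => ?_, inter_subset_right, ?_⟩
  · have hqc : q ∈ closure Ω ∩ H2 := ⟨frontier_subset_closure (h.subD hq).1, (h.subD hq).2⟩
    have : q ∈ (fun x => |u x|) ⁻¹' Iio ε ∩ (closure Ω ∩ H2) :=
      ⟨by simp [h.dirichlet q hq, hε], hqc⟩
    rw [hV2] at this
    exact ⟨this.1, hqc.2⟩
  · rintro x ⟨⟨hx1, hx2⟩, hx3⟩
    have : x ∈ V ∩ (closure Ω ∩ H2) := ⟨hx1, hx3, hx2⟩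
    rw [← hV2] at this
    exact this.1

/-- Green's identity against the eigenfunction, for test functions vanishing near `D`. -/
lemma green (h : MixedEigen Ω D lam u) {T : Set (ℝ × ℝ)} (hT : IsCompact T) (hTH : T ⊆ H2)
    (hTD : Disjoint T D) {ζ : ℝ × ℝ → ℝ} (hζ : ContDiffOn ℝ 1 ζ Ω) {M : ℝ}
    (hζ0 : ∀ x ∈ Ω, 0 ≤ ζ x) (hζM : ∀ x ∈ Ω, ζ x ≤ M) (hζT : ∀ x ∈ Ω, x ∉ T → ζ x = 0)
    (hint : IntegrableOn (fun x => pdx ζ x * pdx u x + pdy ζ x * pdy u x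
      - ζ x * (lam * u x / x.2 ^ 2)) Ω) :
    ∫ x in Ω, (pdx ζ x * pdx u x + pdy ζ x * pdy u x - ζ x * (lam * u x / x.2 ^ 2)) = 0 := by
  set S := closure Ω ∩ H2 with hS
  have key : ∀ c : ℝ, ∀ x ∈ Ω,
      pdx (fun y => ζ y * (c * fderivWithin ℝ u S y (1, 0))) x +
      pdy (fun y => ζ y * (c * fderivWithin ℝ u S y (0, 1))) x =
      c * (pdx ζ x * pdx u x + pdy ζ x * pdy u x - ζ x * (lam * u x / x.2 ^ 2)) := by
    intro c x hx
    have hζd : DifferentiableAt ℝ ζ x :=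
      (hζ.contDiffAt (h.contAt hx)).differentiableAt (by simp)
    have hdx : DifferentiableAt ℝ (pdx u) x :=
      ((contDiffOn_pdx (m := 1) h.isOpen h.smooth (by norm_cast)).contDiffAt
        (h.contAt hx)).differentiableAt (by simp)
    have hdy : DifferentiableAt ℝ (pdy u) x :=
      ((contDiffOn_pdy (m := 1) h.isOpen h.smooth (by norm_cast)).contDiffAt
        (h.contAt hx)).differentiableAt (by simp)
    have e1 : (fun y => ζ y * (c * fderivWithin ℝ u S y (1, 0))) =ᶠ[𝓝 x]
        fun y => ζ y * (c * pdx u y) := by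
      filter_upwards [h.contAt hx] with y hy
      rw [h.fderivWithin_eq hy, pdx]
    have e2 : (fun y => ζ y * (c * fderivWithin ℝ u S y (0, 1))) =ᶠ[𝓝 x]
        fun y => ζ y * (c * pdy u y) := by
      filter_upwards [h.contAt hx] with y hy
      rw [h.fderivWithin_eq hy, pdy]
    rw [e1.pdx_eq, e2.pdy_eq, pdx_mul hζd (hdx.const_mul c), pdy_mul hζd (hdy.const_mul c),
      pdx_const_mul c hdx, pdy_const_mul c hdy]
    linear_combination c * ζ x * h.laplace hx
  have main : ∀ c : ℝ, 0 ≤ c * ∫ x in Ω, (pdx ζ x * pdx u x + pdy ζ x * pdy u x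
      - ζ x * (lam * u x / x.2 ^ 2)) := by
    intro c
    rw [← integral_const_mul, ← setIntegral_congr_fun h.isOpen.measurableSet (key c)]
    refine green_nonneg h.subH h.ne h.isOpen h.conv h.closedD hT hTH hTD
      (K₁ := fun y => c * fderivWithin ℝ u S y (1, 0))
      (K₂ := fun y => c * fderivWithin ℝ u S y (0, 1))
      ((h.continuousOn_bd _).const_mul c) ((h.continuousOn_bd _).const_mul c) ?_ ?_ ?_ hζ hζ0 hζM
      hζT ?_
    · refine contDiffOn_const.mul ?_
      refine (contDiffOn_pdx (m := 1) h.isOpen h.smooth (by norm_cast)).congr fun y hy => ?_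
      rw [h.fderivWithin_eq hy, pdx]
    · refine contDiffOn_const.mul ?_
      refine (contDiffOn_pdy (m := 1) h.isOpen h.smooth (by norm_cast)).congr fun y hy => ?_
      rw [h.fderivWithin_eq hy, pdy]
    · intro q hq ν hν _
      have := h.neumann q hq ν hν
      rw [clm_prod_apply] at this
      have e : c * fderivWithin ℝ u S q (1, 0) * ν.1 + c * fderivWithin ℝ u S q (0, 1) * ν.2 =
        c * (fderivWithin ℝ u S q (1, 0) * ν.1 + fderivWithin ℝ u S q (0, 1) * ν.2) := by ring
      rw [e, this, mul_zero]
    · exact (integrableOn_congr_fun (key c) h.isOpen.measurableSet).2 (hint.const_mul c)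
  have h1 := main 1
  have h2 := main (-1)
  linarith

end MixedEigen

/-! ### Nonnegative test functions built from the positive part -/

lemma integrableOn_of_abs_le {Ω : Set (ℝ × ℝ)} (hopen : IsOpen Ω) {f g : ℝ × ℝ → ℝ}
    (hf : ContinuousOn f Ω) (hg : IntegrableOn g Ω) (hfg : ∀ x ∈ Ω, |f x| ≤ g x) :
    IntegrableOn f Ω :=
  Integrable.mono' hg (hf.aestronglyMeasurable hopen.measurableSet)
    ((ae_restrict_iff' hopen.measurableSet).2 (Eventually.of_forall hfg))

namespace MixedEigen

variable {Ω D : Set (ℝ × ℝ)} {lam : ℝ} {u : ℝ × ℝ → ℝ}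

/-- A smooth approximation of the positive part of `u`, vanishing near `D`. -/
def test (u : ℝ × ℝ → ℝ) (o : ℝ × ℝ) (n : ℕ) (x : ℝ × ℝ) : ℝ :=
  1 / ((n : ℝ) + 1) * ramp (u x * (n + 1)) * cutoff o n x

section test

variable {o : ℝ × ℝ}

lemma scaled_ramp_le (a : ℝ) (n : ℕ) : 1 / ((n : ℝ) + 1) * ramp (a * (n + 1)) ≤ |a| := by
  have hn : (0 : ℝ) < n + 1 := by positivity
  have := ramp_le_abs (a * (n + 1))
  rw [abs_mul, abs_of_pos hn] at this
  rw [div_mul_eq_mul_div, div_le_iff₀ hn]; linarith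

lemma test_nonneg (n : ℕ) (x : ℝ × ℝ) : 0 ≤ test u o n x :=
  mul_nonneg (mul_nonneg (by positivity) (ramp_nonneg _)) (cutoff_nonneg _)

lemma test_le (n : ℕ) (x : ℝ × ℝ) : test u o n x ≤ |u x| := by
  have h1 := scaled_ramp_le (u x) n
  have h2 : 0 ≤ 1 / ((n : ℝ) + 1) * ramp (u x * (n + 1)) :=
    mul_nonneg (by positivity) (ramp_nonneg _)
  exact (mul_le_of_le_one_right h2 (cutoff_le_one x)).trans h1

lemma tendsto_test (x : ℝ × ℝ) : Tendsto (fun n => test u o n x) atTop (𝓝 (max (u x) 0)) := by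
  simpa [test] using (tendsto_ramp (u x)).mul (tendsto_cutoff (o := o) x)

lemma contDiffOn_test (h : MixedEigen Ω D lam u) (ho : o ∈ Ω) (n : ℕ) :
    ContDiffOn ℝ (⊤ : ℕ∞) (test u o n) Ω :=
  (contDiffOn_const.mul (contDiff_ramp.comp_contDiffOn (h.smooth.mul contDiffOn_const))).mul
    ((contDiffOn_cutoff (h.subH ho)).mono h.subH)

lemma test_eq_zero (n : ℕ) {x : ℝ × ℝ} (hx : |u x| < 1 / ((n : ℝ) + 1)) : test u o n x = 0 := by
  have hn : (0 : ℝ) < n + 1 := by positivity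
  have : u x * (n + 1) ≤ 1 := by
    rw [lt_div_iff₀ hn] at hx
    nlinarith [le_abs_self (u x)]
  simp [test, ramp_of_le_one this]

lemma integrableOn_abs (h : MixedEigen Ω D lam u) :
    IntegrableOn (fun x => |u x| / x.2 ^ 2) Ω := by
  refine integrableOn_of_abs_le h.isOpen ?_ (h.area.add h.l2) fun x hx => ?_
  · exact h.smooth.continuousOn.abs.div (by fun_prop) fun x hx =>
      pow_ne_zero 2 (ne_of_gt (h.subH hx))
  · have : (0 : ℝ) < x.2 := h.subH hx
    simp only [Pi.add_apply]
    rw [abs_of_nonneg (by positivity), ← add_div]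
    gcongr
    nlinarith [sq_nonneg (|u x| - 1), sq_abs (u x)]

/-- Pointwise comparison of the energy density of the test functions. -/
lemma exists_test_density (h : MixedEigen Ω D lam u) (ho : o ∈ Ω) :
    ∃ M : ℝ, 0 < M ∧ ∀ n : ℕ, ∃ I : ℝ × ℝ → ℝ, IntegrableOn I Ω ∧ ∫ x in Ω, I x = 0 ∧
      IntegrableOn (gradSq (test u o n)) Ω ∧
      ∀ x ∈ Ω, gradSq (test u o n) x - lam * (test u o n x ^ 2 / x.2 ^ 2) ≤
        I x + (2 * lam / (n + 1) * (|u x| / x.2 ^ 2) + (M / (n + 1)) ^ 2 * (u x ^ 2 / x.2 ^ 2)) := by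
  obtain ⟨M, hM, hχ⟩ := exists_gradSq_cutoff_le (h.subH ho)
  obtain ⟨M₁, hM₁, hGG⟩ := exists_ramp_mul_deriv_le
  refine ⟨M, hM, fun n => ?_⟩
  have hn : (0 : ℝ) < n + 1 := by positivity
  set N : ℝ := (n : ℝ) + 1 with hN
  set χ := cutoff o n with hχdef
  set G : ℝ × ℝ → ℝ := fun x => 1 / N * ramp (u x * N) with hG
  set S : ℝ × ℝ → ℝ := fun x => Real.smoothTransition (u x * N - 1) with hS
  set R : ℝ × ℝ → ℝ := fun x => G x * (N * deriv Real.smoothTransition (u x * N - 1)) with hR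
  set ζ : ℝ × ℝ → ℝ := fun x => (G x * S x) * (χ x * χ x) with hζ
  have hχC : ContDiffOn ℝ (⊤ : ℕ∞) χ Ω := (contDiffOn_cutoff (h.subH ho)).mono h.subH
  have hGC : ContDiffOn ℝ (⊤ : ℕ∞) G Ω :=
    contDiffOn_const.mul (contDiff_ramp.comp_contDiffOn (h.smooth.mul contDiffOn_const))
  have hSC : ContDiffOn ℝ (⊤ : ℕ∞) S Ω :=
    contDiff_step.comp_contDiffOn ((h.smooth.mul contDiffOn_const).sub contDiffOn_const)
  have hζC : ContDiffOn ℝ (⊤ : ℕ∞) ζ Ω := (hGC.mul hSC).mul (hχC.mul hχC)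
  have hwC : ContDiffOn ℝ (⊤ : ℕ∞) (test u o n) Ω := contDiffOn_test h ho n
  have hd : ∀ {f : ℝ × ℝ → ℝ}, ContDiffOn ℝ (⊤ : ℕ∞) f Ω → ∀ x ∈ Ω, DifferentiableAt ℝ f x :=
    fun hf x hx => (hf.contDiffAt (h.contAt hx)).differentiableAt (by simp)
  have hcx : ∀ {f : ℝ × ℝ → ℝ}, ContDiffOn ℝ (⊤ : ℕ∞) f Ω → ContinuousOn (pdx f) Ω :=
    fun hf => (contDiffOn_pdx (m := 0) h.isOpen hf (by simp)).continuousOn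
  have hcy : ∀ {f : ℝ × ℝ → ℝ}, ContDiffOn ℝ (⊤ : ℕ∞) f Ω → ContinuousOn (pdy f) Ω :=
    fun hf => (contDiffOn_pdy (m := 0) h.isOpen hf (by simp)).continuousOn
  have dG : ∀ t : ℝ, HasDerivAt (fun t => 1 / N * ramp (t * N))
      (Real.smoothTransition (t * N - 1)) t := fun t => by
    have h1 := ((hasDerivAt_ramp (t * N)).comp t ((hasDerivAt_id t).mul_const N)).const_mul (1 / N)
    refine h1.congr_deriv ?_
    field_simp
  have dS : ∀ t : ℝ, HasDerivAt (fun t => Real.smoothTransition (t * N - 1))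
      (N * deriv Real.smoothTransition (t * N - 1)) t := fun t => by
    have h1 := (hasDerivAt_step (t * N - 1)).comp t (((hasDerivAt_id t).mul_const N).sub_const 1)
    refine h1.congr_deriv ?_
    ring
  have Gx : ∀ x ∈ Ω, pdx G x = S x * pdx u x := fun x hx =>
    pdx_comp (f := u) (φ := fun t => 1 / N * ramp (t * N)) (dG (u x)) (h.diffAt hx)
  have Sx : ∀ x ∈ Ω, pdx S x = N * deriv Real.smoothTransition (u x * N - 1) * pdx u x :=
    fun x hx => pdx_comp (f := u) (φ := fun t => Real.smoothTransition (t * N - 1)) (dS (u x))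
      (h.diffAt hx)
  have Gy : ∀ x ∈ Ω, pdy G x = S x * pdy u x := fun x hx =>
    pdy_comp (f := u) (φ := fun t => 1 / N * ramp (t * N)) (dG (u x)) (h.diffAt hx)
  have Sy : ∀ x ∈ Ω, pdy S x = N * deriv Real.smoothTransition (u x * N - 1) * pdy u x :=
    fun x hx => pdy_comp (f := u) (φ := fun t => Real.smoothTransition (t * N - 1)) (dS (u x))
      (h.diffAt hx)
  have G0 : ∀ x, 0 ≤ G x := fun x => mul_nonneg (by positivity) (ramp_nonneg _)
  have Gu : ∀ x, G x ≤ |u x| := fun x => scaled_ramp_le (u x) n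
  have S0 : ∀ x, 0 ≤ S x := fun x => Real.smoothTransition.nonneg _
  have S1 : ∀ x, S x ≤ 1 := fun x => Real.smoothTransition.le_one _
  have R0 : ∀ x, 0 ≤ R x := fun x => mul_nonneg (G0 x) (mul_nonneg hn.le (deriv_step_nonneg _))
  have R1 : ∀ x, R x ≤ M₁ := fun x => by
    refine le_trans (le_of_eq ?_) (hGG (u x * N))
    simp only [hR, hG]; field_simp
  have χ0 : ∀ x, 0 ≤ χ x := fun x => cutoff_nonneg x
  have χ1 : ∀ x, χ x ≤ 1 := fun x => cutoff_le_one x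
  have SG : ∀ x, u x * S x - G x ≤ 2 / N := fun x => by
    have := mul_deriv_sub_ramp_le (u x * N)
    rw [le_div_iff₀ hn]
    refine le_trans (le_of_eq ?_) this
    simp only [hS, hG]; field_simp
  have ζx : ∀ x ∈ Ω, pdx ζ x = (S x ^ 2 + R x) * pdx u x * χ x ^ 2
      + 2 * (G x * S x) * χ x * pdx χ x := fun x hx => by
    have e1 := Gx x hx
    have e2 := Sx x hx
    rw [hζ, pdx_mul ((hd hGC x hx).fun_mul (hd hSC x hx)) ((hd hχC x hx).fun_mul (hd hχC x hx)),
      pdx_mul (hd hGC x hx) (hd hSC x hx), pdx_mul (hd hχC x hx) (hd hχC x hx), e1, e2]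
    simp only [hR]
    ring
  have ζy : ∀ x ∈ Ω, pdy ζ x = (S x ^ 2 + R x) * pdy u x * χ x ^ 2
      + 2 * (G x * S x) * χ x * pdy χ x := fun x hx => by
    have e1 := Gy x hx
    have e2 := Sy x hx
    rw [hζ, pdy_mul ((hd hGC x hx).fun_mul (hd hSC x hx)) ((hd hχC x hx).fun_mul (hd hχC x hx)),
      pdy_mul (hd hGC x hx) (hd hSC x hx), pdy_mul (hd hχC x hx) (hd hχC x hx), e1, e2]
    simp only [hR]
    ring
  have wx : ∀ x ∈ Ω, pdx (test u o n) x = S x * pdx u x * χ x + G x * pdx χ x := fun x hx => by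
    have e1 := Gx x hx
    rw [show test u o n = fun x => G x * χ x from rfl, pdx_mul (hd hGC x hx) (hd hχC x hx), e1]
  have wy : ∀ x ∈ Ω, pdy (test u o n) x = S x * pdy u x * χ x + G x * pdy χ x := fun x hx => by
    have e1 := Gy x hx
    rw [show test u o n = fun x => G x * χ x from rfl, pdy_mul (hd hGC x hx) (hd hχC x hx), e1]
  have hG2 : ∀ x, G x ^ 2 ≤ u x ^ 2 := fun x => by
    rw [← sq_abs (u x)]; exact pow_le_pow_left₀ (G0 x) (Gu x) 2
  have hcut : ∀ x ∈ Ω, G x ^ 2 * gradSq χ x ≤ (M / N) ^ 2 * (u x ^ 2 / x.2 ^ 2) := fun x hx => by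
    have h1 := hχ n x (h.subH hx)
    have h2 : 0 ≤ gradSq χ x := by unfold gradSq; positivity
    calc G x ^ 2 * gradSq χ x ≤ u x ^ 2 * ((M / N) ^ 2 / x.2 ^ 2) :=
          mul_le_mul (hG2 x) h1 h2 (sq_nonneg _)
      _ = _ := by ring
  have χS : ∀ x, χ x ^ 2 ≤ 1 := fun x => pow_le_one₀ (χ0 x) (χ1 x)
  have SS : ∀ x, S x ^ 2 ≤ 1 := fun x => pow_le_one₀ (S0 x) (S1 x)
  refine ⟨fun x => pdx ζ x * pdx u x + pdy ζ x * pdy u x - ζ x * (lam * u x / x.2 ^ 2), ?_⟩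
  have hI : IntegrableOn (fun x => pdx ζ x * pdx u x + pdy ζ x * pdy u x
      - ζ x * (lam * u x / x.2 ^ 2)) Ω := by
    refine integrableOn_of_abs_le h.isOpen ?_ (((h.h1.const_mul (M₁ + 2)).add
      (h.l2.const_mul ((M / N) ^ 2))).add (h.l2.const_mul lam)) fun x hx => ?_
    · refine (((hcx hζC).mul (hcx h.smooth)).add ((hcy hζC).mul (hcy h.smooth))).sub
        (hζC.continuousOn.mul ((continuousOn_const.mul h.smooth.continuousOn).div (by fun_prop)
          fun x hx => pow_ne_zero 2 (ne_of_gt (h.subH hx))))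
    · have hy : (0 : ℝ) < x.2 := h.subH hx
      simp only [Pi.add_apply]
      have c1 := hcut x hx
      have e : pdx ζ x * pdx u x + pdy ζ x * pdy u x =
          (S x ^ 2 + R x) * χ x ^ 2 * gradSq u x
          + 2 * (S x * χ x) * (G x * pdx χ x * pdx u x + G x * pdy χ x * pdy u x) := by
        rw [ζx x hx, ζy x hx, gradSq]; ring
      have g0 : 0 ≤ gradSq u x := by unfold gradSq; positivity
      have b1 : |(S x ^ 2 + R x) * χ x ^ 2 * gradSq u x| ≤ (M₁ + 1) * gradSq u x := by
        rw [abs_of_nonneg (mul_nonneg (mul_nonneg (add_nonneg (sq_nonneg _) (R0 x))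
          (sq_nonneg _)) g0)]
        refine mul_le_mul_of_nonneg_right ?_ g0
        calc (S x ^ 2 + R x) * χ x ^ 2 ≤ (1 + M₁) * 1 :=
              mul_le_mul (add_le_add (SS x) (R1 x)) (χS x) (sq_nonneg _) (by positivity)
          _ = _ := by ring
      have b2 : |2 * (S x * χ x) * (G x * pdx χ x * pdx u x + G x * pdy χ x * pdy u x)| ≤
          gradSq u x + G x ^ 2 * gradSq χ x := by
        have k1 : 0 ≤ S x * χ x := mul_nonneg (S0 x) (χ0 x)
        have k2 : S x * χ x ≤ 1 := mul_le_one₀ (S1 x) (χ0 x) (χ1 x)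
        have k3 : |G x * pdx χ x * pdx u x + G x * pdy χ x * pdy u x| ≤
            (gradSq u x + G x ^ 2 * gradSq χ x) / 2 := by
          unfold gradSq
          rw [abs_le]
          constructor <;> nlinarith [sq_nonneg (G x * pdx χ x + pdx u x),
            sq_nonneg (G x * pdx χ x - pdx u x), sq_nonneg (G x * pdy χ x + pdy u x),
            sq_nonneg (G x * pdy χ x - pdy u x)]
        rw [abs_mul, abs_of_nonneg (by positivity)]
        nlinarith [abs_nonneg (G x * pdx χ x * pdx u x + G x * pdy χ x * pdy u x)]
      have b3 : |ζ x * (lam * u x / x.2 ^ 2)| ≤ lam * (u x ^ 2 / x.2 ^ 2) := by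
        have k0 : 0 ≤ ζ x := mul_nonneg (mul_nonneg (G0 x) (S0 x)) (mul_nonneg (χ0 x) (χ0 x))
        have k1 : ζ x ≤ |u x| := by
          calc ζ x ≤ |u x| * 1 := mul_le_mul ((mul_le_of_le_one_right (G0 x) (S1 x)).trans (Gu x))
                (mul_le_one₀ (χ1 x) (χ0 x) (χ1 x)) (mul_nonneg (χ0 x) (χ0 x)) (abs_nonneg _)
            _ = _ := mul_one _
        rw [abs_mul, abs_of_nonneg k0, abs_div, abs_mul, abs_of_pos h.pos,
          abs_of_pos (show 0 < x.2 ^ 2 by positivity), ← sq_abs (u x)]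
        have : 0 ≤ lam * |u x| / x.2 ^ 2 := by have := h.pos; positivity
        calc ζ x * (lam * |u x| / x.2 ^ 2) ≤ |u x| * (lam * |u x| / x.2 ^ 2) :=
              mul_le_mul_of_nonneg_right k1 this
          _ = _ := by ring
      rw [e]
      refine (abs_sub _ _).trans ?_
      have := abs_add_le ((S x ^ 2 + R x) * χ x ^ 2 * gradSq u x)
        (2 * (S x * χ x) * (G x * pdx χ x * pdx u x + G x * pdy χ x * pdy u x))
      linarith
  refine ⟨hI, ?_, ?_, ?_⟩
  · obtain ⟨V, hV, hDV, -, hVu⟩ := h.exists_small_near (show 0 < 1 / N by positivity)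
    obtain ⟨B, hB⟩ := ((isCompact_cutoffSupp (n := n) (h.subH ho)).inter_right
      isClosed_closure (t := closure Ω)).exists_bound_of_continuousOn
      (h.c1.continuousOn.mono fun x hx => ⟨hx.2, hx.1.1⟩)
    refine h.green (T := cutoffSupp o n \ V) (M := B)
      ((isCompact_cutoffSupp (h.subH ho)).diff hV) (fun x hx => hx.1.1) ?_ (hζC.of_le (by simp))
      (fun x hx => mul_nonneg (mul_nonneg (G0 x) (S0 x)) (mul_nonneg (χ0 x) (χ0 x))) ?_ ?_ hI
    · exact Set.disjoint_left.2 fun x hx hxD => hx.2 (hDV hxD)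
    · intro x hx
      have k1 : ζ x ≤ |u x| := by
        calc ζ x ≤ |u x| * 1 := mul_le_mul ((mul_le_of_le_one_right (G0 x) (S1 x)).trans (Gu x))
              (mul_le_one₀ (χ1 x) (χ0 x) (χ1 x)) (mul_nonneg (χ0 x) (χ0 x)) (abs_nonneg _)
          _ = _ := mul_one _
      by_cases h1 : x ∈ cutoffSupp o n
      · exact k1.trans (hB x ⟨h1, subset_closure hx⟩)
      · have h2 : χ x = 0 := cutoff_eq_zero (h.subH ho) (h.subH hx) h1
        have h3 := (norm_nonneg _).trans (hB o ⟨⟨h.subH ho, ?_⟩, subset_closure ho⟩)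
        · simpa [hζ, h2] using h3
        · have : coshDist o o = 1 := by
            have : o.2 ≠ 0 := ne_of_gt (h.subH ho)
            simp [coshDist]; field_simp; ring
          rw [this]; exact Real.one_le_exp (by positivity)
    · intro x hx hxT
      by_cases h1 : x ∈ cutoffSupp o n
      · have hxV : x ∈ V := by
          by_contra h2; exact hxT ⟨h1, h2⟩
        have h3 := hVu x ⟨hxV, subset_closure hx⟩
        have h4 : u x * N ≤ 1 := by
          rw [lt_div_iff₀ hn] at h3
          nlinarith [le_abs_self (u x)]
        simp [hζ, hG, ramp_of_le_one h4]
      · have : χ x = 0 := cutoff_eq_zero (h.subH ho) (h.subH hx) h1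
        simp [hζ, this]
  · refine integrableOn_of_abs_le h.isOpen (((hcx hwC).pow 2).add ((hcy hwC).pow 2))
      ((h.h1.const_mul 2).add (h.l2.const_mul (2 * (M / N) ^ 2))) fun x hx => ?_
    have c1 := hcut x hx
    have g0 : 0 ≤ gradSq u x := by unfold gradSq; positivity
    simp only [Pi.add_apply]
    rw [abs_of_nonneg (by unfold gradSq; positivity), gradSq, wx x hx, wy x hx]
    have k2 : (S x * χ x) ^ 2 ≤ 1 := by
      rw [mul_pow]; exact mul_le_one₀ (SS x) (sq_nonneg _) (χS x)
    have k3 : (S x * χ x) ^ 2 * gradSq u x ≤ gradSq u x := mul_le_of_le_one_left g0 k2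
    unfold gradSq at *
    nlinarith [sq_nonneg (S x * pdx u x * χ x - G x * pdx χ x),
      sq_nonneg (S x * pdy u x * χ x - G x * pdy χ x)]
  · intro x hx
    have hy : (0 : ℝ) < x.2 := h.subH hx
    have c1 := hcut x hx
    have g0 : 0 ≤ gradSq u x := by unfold gradSq; positivity
    have e : gradSq (test u o n) x - lam * (test u o n x ^ 2 / x.2 ^ 2) =
        (pdx ζ x * pdx u x + pdy ζ x * pdy u x - ζ x * (lam * u x / x.2 ^ 2))
        + lam / x.2 ^ 2 * (G x * χ x ^ 2 * (u x * S x - G x)) + G x ^ 2 * gradSq χ x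
        - R x * χ x ^ 2 * gradSq u x := by
      rw [gradSq, wx x hx, wy x hx, ζx x hx, ζy x hx,
        show test u o n x = G x * χ x from rfl]
      simp only [hζ, gradSq]
      ring
    have k1 : G x * χ x ^ 2 * (u x * S x - G x) ≤ |u x| * (2 / N) := by
      have k0 : 0 ≤ G x * χ x ^ 2 := mul_nonneg (G0 x) (sq_nonneg _)
      calc G x * χ x ^ 2 * (u x * S x - G x) ≤ G x * χ x ^ 2 * (2 / N) :=
            mul_le_mul_of_nonneg_left (SG x) k0
        _ ≤ _ := mul_le_mul_of_nonneg_right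
            ((mul_le_of_le_one_right (G0 x) (χS x)).trans (Gu x)) (by positivity)
    have k2 : lam / x.2 ^ 2 * (G x * χ x ^ 2 * (u x * S x - G x)) ≤
        2 * lam / N * (|u x| / x.2 ^ 2) := by
      have := h.pos
      calc _ ≤ lam / x.2 ^ 2 * (|u x| * (2 / N)) := mul_le_mul_of_nonneg_left k1 (by positivity)
        _ = _ := by ring
    have k3 : 0 ≤ R x * χ x ^ 2 * gradSq u x :=
      mul_nonneg (mul_nonneg (R0 x) (sq_nonneg _)) g0
    rw [e]
    linarith

end test

end MixedEigen

/-! ### The positive part is a weak solution -/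

lemma integrableOn_of_compact_support {Ω T : Set (ℝ × ℝ)} {f : ℝ × ℝ → ℝ}
    (hopen : IsOpen Ω) (hf : ContinuousOn f Ω) (hT : IsCompact T) (hTΩ : T ⊆ Ω)
    (hfT : ∀ x ∈ Ω, x ∉ T → f x = 0) : IntegrableOn f Ω :=
  ((hf.mono hTΩ).integrableOn_compact hT).of_forall_sdiff_eq_zero hopen.measurableSet
    fun x hx => hfT x hx.1 hx.2

lemma eq_zero_of_quadratic_nonneg {B Q : ℝ} (h : ∀ t : ℝ, 0 ≤ 2 * t * B + t ^ 2 * Q) : B = 0 := by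
  have hQ : 0 < |Q| + 1 := by positivity
  have h1 := h (-B / (|Q| + 1))
  have h2 : 2 * (-B / (|Q| + 1)) * B + (-B / (|Q| + 1)) ^ 2 * Q =
      (-2 * (|Q| + 1) + Q) * (B / (|Q| + 1)) ^ 2 := by
    field_simp
  rw [h2] at h1
  have h3 : -2 * (|Q| + 1) + Q < 0 := by linarith [le_abs_self Q, abs_nonneg Q]
  have h4 : (B / (|Q| + 1)) ^ 2 ≤ 0 := by nlinarith [sq_nonneg (B / (|Q| + 1))]
  have h5 : B / (|Q| + 1) = 0 := by
    have := le_antisymm h4 (sq_nonneg _)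
    exact pow_eq_zero_iff (two_ne_zero) |>.1 this
  rcases div_eq_zero_iff.1 h5 with h6 | h6
  · exact h6
  · linarith

namespace MixedEigen

variable {Ω D : Set (ℝ × ℝ)} {lam : ℝ} {u : ℝ × ℝ → ℝ}

lemma weak_posPart (h : MixedEigen Ω D lam u) {ψ : ℝ × ℝ → ℝ} (hψ : ContDiff ℝ (⊤ : ℕ∞) ψ)
    (hψc : HasCompactSupport ψ) (hψΩ : tsupport ψ ⊆ Ω) :
    ∫ x in Ω, max (u x) 0 * (pdx (pdx ψ) x + pdy (pdy ψ) x + lam * ψ x / x.2 ^ 2) = 0 := by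
  obtain ⟨o, ho⟩ := h.ne
  obtain ⟨M, hM, hden⟩ := exists_test_density h ho
  set w := test u o with hw
  set L : ℝ × ℝ → ℝ := fun x => pdx (pdx ψ) x + pdy (pdy ψ) x + lam * ψ x / x.2 ^ 2 with hL
  have hψΩC : ContDiffOn ℝ (⊤ : ℕ∞) ψ Ω := hψ.contDiffOn
  have hpx : ContDiffOn ℝ (⊤ : ℕ∞) (pdx ψ) Ω := contDiffOn_pdx h.isOpen hψΩC (by simp)
  have hpy : ContDiffOn ℝ (⊤ : ℕ∞) (pdy ψ) Ω := contDiffOn_pdy h.isOpen hψΩC (by simp)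
  have hpxx : ContDiffOn ℝ (⊤ : ℕ∞) (pdx (pdx ψ)) Ω := contDiffOn_pdx h.isOpen hpx (by simp)
  have hpyy : ContDiffOn ℝ (⊤ : ℕ∞) (pdy (pdy ψ)) Ω := contDiffOn_pdy h.isOpen hpy (by simp)
  have hd : ∀ {f : ℝ × ℝ → ℝ}, ContDiffOn ℝ (⊤ : ℕ∞) f Ω → ∀ x ∈ Ω, DifferentiableAt ℝ f x :=
    fun hf x hx => (hf.contDiffAt (h.contAt hx)).differentiableAt (by simp)
  have hcx : ∀ {f : ℝ × ℝ → ℝ}, ContDiffOn ℝ (⊤ : ℕ∞) f Ω → ContinuousOn (pdx f) Ω :=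
    fun hf => (contDiffOn_pdx (m := 0) h.isOpen hf (by simp)).continuousOn
  have hcy : ∀ {f : ℝ × ℝ → ℝ}, ContDiffOn ℝ (⊤ : ℕ∞) f Ω → ContinuousOn (pdy f) Ω :=
    fun hf => (contDiffOn_pdy (m := 0) h.isOpen hf (by simp)).continuousOn
  have hy2 : ∀ x ∈ Ω, x.2 ^ 2 ≠ 0 := fun x hx => pow_ne_zero 2 (ne_of_gt (h.subH hx))
  have hyc : ContinuousOn (fun x : ℝ × ℝ => x.2 ^ 2) Ω := by fun_prop
  have hLc : ContinuousOn L Ω := (hpxx.continuousOn.add hpyy.continuousOn).add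
    ((continuousOn_const.mul hψΩC.continuousOn).div hyc hy2)
  -- everything vanishes off the support of `ψ`
  have z0 : ∀ x, x ∉ tsupport ψ → ψ =ᶠ[𝓝 x] fun _ => 0 := fun x hx =>
    notMem_tsupport_iff_eventuallyEq.1 hx
  have zψ : ∀ x, x ∉ tsupport ψ → ψ x = 0 := fun x hx => (z0 x hx).eq_of_nhds
  have zx' : ∀ x, x ∉ tsupport ψ → pdx ψ =ᶠ[𝓝 x] fun _ => 0 := fun x hx => by
    filter_upwards [(z0 x hx).eventuallyEq_nhds] with y hy
    rw [hy.pdx_eq]; simp [pdx]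
  have zy' : ∀ x, x ∉ tsupport ψ → pdy ψ =ᶠ[𝓝 x] fun _ => 0 := fun x hx => by
    filter_upwards [(z0 x hx).eventuallyEq_nhds] with y hy
    rw [hy.pdy_eq]; simp [pdy]
  have zx : ∀ x, x ∉ tsupport ψ → pdx ψ x = 0 := fun x hx => (zx' x hx).eq_of_nhds
  have zy : ∀ x, x ∉ tsupport ψ → pdy ψ x = 0 := fun x hx => (zy' x hx).eq_of_nhds
  have zxx : ∀ x, x ∉ tsupport ψ → pdx (pdx ψ) x = 0 := fun x hx => by
    rw [(zx' x hx).pdx_eq]; simp [pdx]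
  have zyy : ∀ x, x ∉ tsupport ψ → pdy (pdy ψ) x = 0 := fun x hx => by
    rw [(zy' x hx).pdy_eq]; simp [pdy]
  have zL : ∀ x, x ∉ tsupport ψ → L x = 0 := fun x hx => by
    simp [hL, zxx x hx, zyy x hx, zψ x hx]
  have hcs : ∀ {f : ℝ × ℝ → ℝ}, ContinuousOn f Ω → (∀ x, x ∉ tsupport ψ → f x = 0) →
      IntegrableOn f Ω := fun hf h0 =>
    integrableOn_of_compact_support h.isOpen hf hψc hψΩ fun x _ hx => h0 x hx
  have hwC : ∀ n, ContDiffOn ℝ (⊤ : ℕ∞) (w n) Ω := fun n => contDiffOn_test h ho n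
  set Q : ℝ := ∫ x in Ω, (gradSq ψ x - lam * (ψ x ^ 2 / x.2 ^ 2)) with hQ
  have iψ : IntegrableOn (fun x => gradSq ψ x - lam * (ψ x ^ 2 / x.2 ^ 2)) Ω :=
    hcs ((((hcx hψΩC).pow 2).add ((hcy hψΩC).pow 2)).sub
      (continuousOn_const.mul ((hψΩC.continuousOn.pow 2).div hyc hy2)))
      fun x hx => by simp [gradSq, zx x hx, zy x hx, zψ x hx]
  have iψ2 : IntegrableOn (fun x => ψ x ^ 2 / x.2 ^ 2) Ω :=
    hcs ((hψΩC.continuousOn.pow 2).div hyc hy2) fun x hx => by simp [zψ x hx]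
  have iψg : IntegrableOn (gradSq ψ) Ω :=
    hcs (((hcx hψΩC).pow 2).add ((hcy hψΩC).pow 2)) fun x hx => by simp [gradSq, zx x hx, zy x hx]
  -- the first variation
  have hfirst : ∀ n, IntegrableOn (fun x => pdx (w n) x * pdx ψ x + pdy (w n) x * pdy ψ x
        - lam * (w n x * ψ x / x.2 ^ 2)) Ω ∧
      ∫ x in Ω, (pdx (w n) x * pdx ψ x + pdy (w n) x * pdy ψ x - lam * (w n x * ψ x / x.2 ^ 2)) =
      -∫ x in Ω, w n x * L x := by
    intro n
    have i1 : IntegrableOn (fun x => pdx (w n) x * pdx ψ x + pdy (w n) x * pdy ψ x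
        - lam * (w n x * ψ x / x.2 ^ 2)) Ω :=
      hcs ((((hcx (hwC n)).mul (hcx hψΩC)).add ((hcy (hwC n)).mul (hcy hψΩC))).sub
        (continuousOn_const.mul (((hwC n).continuousOn.mul hψΩC.continuousOn).div hyc hy2)))
        fun x hx => by simp [zx x hx, zy x hx, zψ x hx]
    have i2 : IntegrableOn (fun x => w n x * L x) Ω :=
      hcs ((hwC n).continuousOn.mul hLc) fun x hx => by simp [zL x hx]
    obtain ⟨a1, a2⟩ := integral_fderiv_eq_zero h.isOpen (F := fun x => w n x * pdx ψ x)
      (((hwC n).mul hpx).of_le (by simp)) hψc hψΩ (fun x _ hx => by simp [zx x hx]) (1, 0)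
    obtain ⟨b1, b2⟩ := integral_fderiv_eq_zero h.isOpen (F := fun x => w n x * pdy ψ x)
      (((hwC n).mul hpy).of_le (by simp)) hψc hψΩ (fun x _ hx => by simp [zy x hx]) (0, 1)
    refine ⟨i1, ?_⟩
    have e : ∀ x ∈ Ω, pdx (w n) x * pdx ψ x + pdy (w n) x * pdy ψ x
        - lam * (w n x * ψ x / x.2 ^ 2) =
        (pdx (fun x => w n x * pdx ψ x) x + pdy (fun x => w n x * pdy ψ x) x) - w n x * L x := by
      intro x hx
      rw [pdx_mul (hd (hwC n) x hx) (hd hpx x hx), pdy_mul (hd (hwC n) x hx) (hd hpy x hx)]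
      simp only [hL]
      ring
    have a1' : IntegrableOn (fun x => pdx (fun x => w n x * pdx ψ x) x) Ω := a1
    have b1' : IntegrableOn (fun x => pdy (fun x => w n x * pdy ψ x) x) Ω := b1
    have a2' : ∫ x in Ω, pdx (fun x => w n x * pdx ψ x) x = 0 := a2
    have b2' : ∫ x in Ω, pdy (fun x => w n x * pdy ψ x) x = 0 := b2
    have ab : IntegrableOn (fun x => pdx (fun x => w n x * pdx ψ x) x +
      pdy (fun x => w n x * pdy ψ x) x) Ω := a1'.add b1'
    rw [setIntegral_congr_fun h.isOpen.measurableSet e, integral_sub ab i2,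
      integral_add a1' b1', a2', b2']
    ring
  set δ : ℕ → ℝ := fun n => 2 * lam / (n + 1) * (∫ x in Ω, |u x| / x.2 ^ 2) +
    (M / (n + 1)) ^ 2 * ∫ x in Ω, u x ^ 2 / x.2 ^ 2 with hδ
  have hineq : ∀ n : ℕ, ∀ t : ℝ, 0 ≤ δ n + 2 * t * (-∫ x in Ω, w n x * L x) + t ^ 2 * Q := by
    intro n t
    obtain ⟨I, hI, hI0, hwg, hdens⟩ := hden n
    obtain ⟨f1, f2⟩ := hfirst n
    have hn : (0 : ℝ) < n + 1 := by positivity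
    have hwl : IntegrableOn (fun x => w n x ^ 2 / x.2 ^ 2) Ω := by
      refine integrableOn_of_abs_le h.isOpen (((hwC n).continuousOn.pow 2).div hyc hy2) h.l2
        fun x hx => ?_
      have : (0 : ℝ) < x.2 := h.subH hx
      rw [abs_of_nonneg (by positivity), ← sq_abs (u x)]
      gcongr
      · exact test_nonneg n x
      · exact test_le n x
    have hQw : ∫ x in Ω, (gradSq (w n) x - lam * (w n x ^ 2 / x.2 ^ 2)) ≤ δ n := by
      have r1 : IntegrableOn (fun x => 2 * lam / (n + 1) * (|u x| / x.2 ^ 2)) Ω :=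
        h.integrableOn_abs.const_mul _
      have r2 : IntegrableOn (fun x => (M / (n + 1)) ^ 2 * (u x ^ 2 / x.2 ^ 2)) Ω :=
        h.l2.const_mul _
      have := setIntegral_mono_on (hwg.sub (hwl.const_mul lam)) (hI.add (r1.add r2))
        h.isOpen.measurableSet hdens
      refine this.trans (le_of_eq ?_)
      rw [integral_add' hI (r1.add r2), hI0, integral_add' r1 r2, integral_const_mul,
        integral_const_mul, zero_add]
    have hvd : ∀ x ∈ Ω, gradSq (fun x => w n x + t * ψ x) x = gradSq (w n) x
        + 2 * t * (pdx (w n) x * pdx ψ x + pdy (w n) x * pdy ψ x) + t ^ 2 * gradSq ψ x := by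
      intro x hx
      have d1 := hd (hwC n) x hx
      have d2 := hd hψΩC x hx
      simp only [gradSq]
      rw [pdx_add d1 (d2.const_mul t), pdy_add d1 (d2.const_mul t), pdx_const_mul t d2,
        pdy_const_mul t d2]
      ring
    have hv2 : IntegrableOn (fun x => (w n x + t * ψ x) ^ 2 / x.2 ^ 2) Ω := by
      have : IntegrableOn (fun x => w n x * ψ x / x.2 ^ 2) Ω :=
        hcs (((hwC n).continuousOn.mul hψΩC.continuousOn).div hyc hy2) fun x hx => by
          simp [zψ x hx]
      refine ((hwl.add (this.const_mul (2 * t))).add (iψ2.const_mul (t ^ 2))).congr_fun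
        (fun x hx => ?_) h.isOpen.measurableSet
      simp only [Pi.add_apply]; ring
    have hvg : IntegrableOn (gradSq (fun x => w n x + t * ψ x)) Ω := by
      have : IntegrableOn (fun x => pdx (w n) x * pdx ψ x + pdy (w n) x * pdy ψ x) Ω :=
        hcs (((hcx (hwC n)).mul (hcx hψΩC)).add ((hcy (hwC n)).mul (hcy hψΩC))) fun x hx => by
          simp [zx x hx, zy x hx]
      refine ((hwg.add (this.const_mul (2 * t))).add (iψg.const_mul (t ^ 2))).congr_fun
        (fun x hx => ?_) h.isOpen.measurableSet
      simp only [Pi.add_apply]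
      rw [hvd x hx]
    have hv := h.least (fun x => w n x + t * ψ x) ((hwC n).add (contDiffOn_const.mul hψΩC)) ?_
      hv2 hvg
    swap
    · obtain ⟨V, hV, hDV, -, hVu⟩ := h.exists_small_near (show 0 < 1 / ((n : ℝ) + 1) by positivity)
      refine ⟨V ∩ (tsupport ψ)ᶜ, hV.inter (isClosed_tsupport ψ).isOpen_compl, fun q hq =>
        ⟨hDV hq, fun hq2 => Set.disjoint_left.1 h.disjointD (hψΩ hq2) hq⟩, ?_⟩
      rintro x ⟨⟨hx1, hx2⟩, hx3⟩
      simp only [zψ x hx2, mul_zero, add_zero]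
      exact test_eq_zero n (hVu x ⟨hx1, hx3⟩)
    have hexp : ∀ x ∈ Ω, gradSq (fun x => w n x + t * ψ x) x
        - lam * ((w n x + t * ψ x) ^ 2 / x.2 ^ 2) =
        ((gradSq (w n) x - lam * (w n x ^ 2 / x.2 ^ 2))
        + 2 * t * (pdx (w n) x * pdx ψ x + pdy (w n) x * pdy ψ x - lam * (w n x * ψ x / x.2 ^ 2)))
        + t ^ 2 * (gradSq ψ x - lam * (ψ x ^ 2 / x.2 ^ 2)) := by
      intro x hx
      rw [hvd x hx]; ring
    have j1 : IntegrableOn (fun x => gradSq (w n) x - lam * (w n x ^ 2 / x.2 ^ 2)) Ω :=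
      hwg.sub (hwl.const_mul lam)
    have j2 := Integrable.const_mul f1 (2 * t)
    have j12 : IntegrableOn (fun x => (gradSq (w n) x - lam * (w n x ^ 2 / x.2 ^ 2))
        + 2 * t * (pdx (w n) x * pdx ψ x + pdy (w n) x * pdy ψ x
          - lam * (w n x * ψ x / x.2 ^ 2))) Ω := j1.add j2
    have j3 := Integrable.const_mul iψ (t ^ 2)
    have hsum : ∫ x in Ω, (gradSq (fun x => w n x + t * ψ x) x
        - lam * ((w n x + t * ψ x) ^ 2 / x.2 ^ 2)) =
        (∫ x in Ω, (gradSq (w n) x - lam * (w n x ^ 2 / x.2 ^ 2))) +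
        2 * t * (-∫ x in Ω, w n x * L x) + t ^ 2 * Q := by
      rw [setIntegral_congr_fun h.isOpen.measurableSet hexp, integral_add j12 j3,
        integral_add j1 j2, integral_const_mul, integral_const_mul, f2]
    have hdiff : ∫ x in Ω, (gradSq (fun x => w n x + t * ψ x) x
        - lam * ((w n x + t * ψ x) ^ 2 / x.2 ^ 2)) =
        (∫ x in Ω, gradSq (fun x => w n x + t * ψ x) x) -
        lam * ∫ x in Ω, (w n x + t * ψ x) ^ 2 / x.2 ^ 2 := by
      rw [integral_sub hvg (hv2.const_mul lam), integral_const_mul]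
    linarith
  have hδ0 : Tendsto δ atTop (𝓝 0) := by
    have h0 : Tendsto (fun n : ℕ => 1 / ((n : ℝ) + 1)) atTop (𝓝 0) :=
      tendsto_one_div_add_atTop_nhds_zero_nat
    have h1 := ((h0.const_mul (2 * lam)).mul_const (∫ x in Ω, |u x| / x.2 ^ 2)).add
      (((h0.const_mul M).pow 2).mul_const (∫ x in Ω, u x ^ 2 / x.2 ^ 2))
    simp only [mul_zero, zero_mul, zero_pow two_ne_zero, add_zero] at h1
    refine h1.congr fun n => ?_
    simp only [hδ]; ring
  have hlim : Tendsto (fun n => ∫ x in Ω, w n x * L x) atTop (𝓝 (∫ x in Ω, max (u x) 0 * L x)) := by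
    refine tendsto_integral_of_dominated_convergence (fun x => |u x * L x|) (fun n => ?_) ?_ ?_ ?_
    · exact ((hwC n).continuousOn.mul hLc).aestronglyMeasurable h.isOpen.measurableSet
    · exact hcs (h.smooth.continuousOn.mul hLc).abs fun x hx => by simp [zL x hx]
    · refine fun n => Eventually.of_forall fun x => ?_
      rw [Real.norm_eq_abs, abs_mul, abs_mul, abs_of_nonneg (test_nonneg n x)]
      exact mul_le_mul_of_nonneg_right (test_le n x) (abs_nonneg _)
    · exact Eventually.of_forall fun x => (tendsto_test x).mul_const _
  have hfin : ∀ t : ℝ, 0 ≤ 2 * t * (-∫ x in Ω, max (u x) 0 * L x) + t ^ 2 * Q := by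
    intro t
    have h1 : Tendsto (fun n => δ n + 2 * t * (-∫ x in Ω, w n x * L x) + t ^ 2 * Q) atTop
        (𝓝 (0 + 2 * t * (-∫ x in Ω, max (u x) 0 * L x) + t ^ 2 * Q)) :=
      (hδ0.add (hlim.neg.const_mul (2 * t))).add_const _
    have := ge_of_tendsto' h1 fun n => hineq n t
    linarith
  have := eq_zero_of_quadratic_nonneg hfin
  linarith

end MixedEigen

/-! ### The strong minimum principle and positivity -/

section radial

/-- The squared Euclidean distance in the plane. -/
def sqDist (p x : ℝ × ℝ) : ℝ := (x.1 - p.1) ^ 2 + (x.2 - p.2) ^ 2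

lemma sqDist_nonneg (p x : ℝ × ℝ) : 0 ≤ sqDist p x := by unfold sqDist; positivity

lemma continuous_sqDist (p : ℝ × ℝ) : Continuous (sqDist p) := by unfold sqDist; fun_prop

lemma contDiff_sqDist (p : ℝ × ℝ) {n : WithTop ℕ∞} : ContDiff ℝ n (sqDist p) := by
  unfold sqDist; fun_prop

lemma sqDist_self (p : ℝ × ℝ) : sqDist p p = 0 := by simp [sqDist]

lemma sqDist_eq_zero {p x : ℝ × ℝ} (h : sqDist p x = 0) : x = p := by
  unfold sqDist at h
  have h1 : (x.1 - p.1) ^ 2 = 0 := by nlinarith [sq_nonneg (x.1 - p.1), sq_nonneg (x.2 - p.2)]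
  have h2 : (x.2 - p.2) ^ 2 = 0 := by nlinarith [sq_nonneg (x.1 - p.1), sq_nonneg (x.2 - p.2)]
  rw [pow_eq_zero_iff two_ne_zero, sub_eq_zero] at h1 h2
  exact Prod.ext h1 h2

lemma sqDist_le_subset_closedBall (p : ℝ × ℝ) {r : ℝ} (hr : 0 ≤ r) :
    {x | sqDist p x ≤ r ^ 2} ⊆ Metric.closedBall p r := by
  intro x hx
  simp only [mem_ofPred_eq, sqDist] at hx
  rw [Metric.mem_closedBall, Prod.dist_eq, Real.dist_eq, Real.dist_eq]
  refine max_le (abs_le_of_sq_le_sq (by nlinarith [sq_nonneg (x.2 - p.2)]) hr)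
    (abs_le_of_sq_le_sq (by nlinarith [sq_nonneg (x.1 - p.1)]) hr)

lemma isCompact_sqDist_le (p : ℝ × ℝ) {r : ℝ} (hr : 0 ≤ r) :
    IsCompact {x | sqDist p x ≤ r ^ 2} :=
  (isCompact_closedBall p r).of_isClosed_subset
    (isClosed_le (continuous_sqDist p) continuous_const) (sqDist_le_subset_closedBall p hr)

lemma volume_sqDist_le (p : ℝ × ℝ) {r : ℝ} (hr : 0 ≤ r) :
    volume.real {x | sqDist p x ≤ r ^ 2} ≤ 4 * r ^ 2 := by
  have h1 : volume (Metric.closedBall p r) = ENNReal.ofReal (4 * r ^ 2) := by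
    rw [← closedBall_prod_same, Measure.volume_eq_prod, Measure.prod_prod, Real.volume_closedBall,
      Real.volume_closedBall, ← ENNReal.ofReal_mul (by positivity)]
    congr 1; ring
  have h2 := measure_mono (μ := volume) (sqDist_le_subset_closedBall p hr)
  rw [h1] at h2
  exact ENNReal.toReal_le_of_le_ofReal (by positivity) h2

lemma hasFDerivAt_sqDist (p x : ℝ × ℝ) :
    HasFDerivAt (sqDist p) ((2 * (x.1 - p.1)) • ContinuousLinearMap.fst ℝ ℝ ℝ +
      (2 * (x.2 - p.2)) • ContinuousLinearMap.snd ℝ ℝ ℝ) x := by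
  have a := (hasFDerivAt_fst (𝕜 := ℝ) (p := x)).sub_const p.1
  have b := (hasFDerivAt_snd (𝕜 := ℝ) (p := x)).sub_const p.2
  have e : sqDist p = fun x => (x.1 - p.1) * (x.1 - p.1) + (x.2 - p.2) * (x.2 - p.2) := by
    funext x; simp only [sqDist]; ring
  rw [e]
  refine ((a.fun_mul a).fun_add (b.fun_mul b)).congr_fderiv ?_
  rw [two_mul, two_mul, add_smul, add_smul]

lemma pdx_sqDist (p x : ℝ × ℝ) : pdx (sqDist p) x = 2 * (x.1 - p.1) := by
  rw [(hasFDerivAt_sqDist p x).pdx_eq]; simp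

lemma pdy_sqDist (p x : ℝ × ℝ) : pdy (sqDist p) x = 2 * (x.2 - p.2) := by
  rw [(hasFDerivAt_sqDist p x).pdy_eq]; simp

/-- A radial test function with prescribed Laplacian. -/
lemma exists_radial_test {m : ℝ → ℝ} (hm : ContDiff ℝ (⊤ : ℕ∞) m) {ε r : ℝ} (hε : 0 < ε)
    (hm0 : ∀ s, 0 ≤ m s) (hmε : ∀ s ≤ ε, m s = 0) (hmR : ∀ s, r ^ 2 ≤ s → m s = 0)
    (p : ℝ × ℝ) :
    ∃ ψ : ℝ × ℝ → ℝ, ContDiff ℝ (⊤ : ℕ∞) ψ ∧ tsupport ψ ⊆ {x | sqDist p x ≤ r ^ 2} ∧ (∀ x, 0 ≤ ψ x) ∧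
      ∀ x, pdx (pdx ψ) x + pdy (pdy ψ) x = -4 * deriv m (sqDist p x) := by
  set k : ℝ → ℝ := fun s => m s / s with hk
  have hkC : ContDiff ℝ (⊤ : ℕ∞) k := by
    rw [contDiff_iff_contDiffAt]
    intro s
    rcases lt_or_ge s ε with h | h
    · have : k =ᶠ[𝓝 s] fun _ => 0 := by
        filter_upwards [Iio_mem_nhds h] with t ht
        simp [hk, hmε t (le_of_lt ht)]
      exact contDiffAt_const.congr_of_eventuallyEq this
    · exact hm.contDiffAt.div contDiffAt_id (by simp; linarith)
  have hks : ∀ s, s * k s = m s := fun s => by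
    rcases eq_or_ne s 0 with h | h
    · rw [h, hmε 0 hε.le, zero_mul]
    · simp only [hk]; field_simp
  have hk0 : ∀ s, 0 ≤ k s := fun s => by
    rcases le_total s 0 with h | h
    · simp [hk, hmε s (h.trans hε.le)]
    · exact div_nonneg (hm0 s) h
  have hkR : ∀ s, r ^ 2 ≤ s → k s = 0 := fun s h => by simp [hk, hmR s h]
  set Φ : ℝ → ℝ := fun s => ∫ t in s..r ^ 2, k t with hΦ
  have hΦd : ∀ s, HasDerivAt Φ (-k s) s := fun s =>
    intervalIntegral.integral_hasDerivAt_left (hkC.continuous.intervalIntegrable _ _)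
      (hkC.continuous.stronglyMeasurableAtFilter _ _) hkC.continuous.continuousAt
  have hΦC : ContDiff ℝ (⊤ : ℕ∞) Φ := by
    rw [contDiff_infty_iff_deriv]
    refine ⟨fun s => (hΦd s).differentiableAt, ?_⟩
    rw [show deriv Φ = fun s => -k s from funext fun s => (hΦd s).deriv]
    exact hkC.neg
  have hΦR : ∀ s, r ^ 2 ≤ s → Φ s = 0 := fun s h => by
    simp only [hΦ]
    rw [intervalIntegral.integral_congr (g := fun _ => (0 : ℝ))]
    · simp
    · intro t ht
      rw [uIcc_of_ge h] at ht
      exact hkR t ht.1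
  have hΦ0 : ∀ s, 0 ≤ Φ s := fun s => by
    rcases le_total s (r ^ 2) with h | h
    · exact intervalIntegral.integral_nonneg h fun t _ => hk0 t
    · exact (hΦR s h).ge
  refine ⟨fun x => Φ (sqDist p x), hΦC.comp (contDiff_sqDist p), ?_, fun x => hΦ0 _, fun x => ?_⟩
  · refine closure_minimal (fun x hx => ?_) (isClosed_le (continuous_sqDist p) continuous_const)
    by_contra h
    exact hx (hΦR _ (not_le.1 h).le)
  · have hsd : ∀ x, DifferentiableAt ℝ (sqDist p) x := fun x =>
      (contDiff_sqDist p (n := 1)).differentiable (by simp) x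
    have ex : pdx (fun x => Φ (sqDist p x)) = fun x => (-k (sqDist p x)) * (2 * (x.1 - p.1)) :=
      funext fun x => by rw [pdx_comp (hΦd _) (hsd x), pdx_sqDist]
    have ey : pdy (fun x => Φ (sqDist p x)) = fun x => (-k (sqDist p x)) * (2 * (x.2 - p.2)) :=
      funext fun x => by rw [pdy_comp (hΦd _) (hsd x), pdy_sqDist]
    have hkd : ∀ s, HasDerivAt (fun s => -k s) (-deriv k s) s := fun s =>
      ((hkC.differentiable (by simp)) s).hasDerivAt.neg
    have hkdd : DifferentiableAt ℝ (fun x => -k (sqDist p x)) x :=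
      (hkd _).differentiableAt.comp x (hsd x)
    have hm' : deriv m (sqDist p x) = k (sqDist p x) + sqDist p x * deriv k (sqDist p x) := by
      have h1 : HasDerivAt (fun s => s * k s) (1 * k (sqDist p x) + sqDist p x * deriv k (sqDist p x))
          (sqDist p x) := (hasDerivAt_id _).mul ((hkC.differentiable (by simp)) _).hasDerivAt
      rw [show (fun s => s * k s) = m from funext hks] at h1
      rw [h1.deriv, one_mul]
    have f1 : HasFDerivAt (fun x : ℝ × ℝ => 2 * (x.1 - p.1))
        ((2 : ℝ) • ContinuousLinearMap.fst ℝ ℝ ℝ) x :=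
      ((hasFDerivAt_fst (𝕜 := ℝ) (p := x)).sub_const p.1).const_mul 2
    have f2 : HasFDerivAt (fun x : ℝ × ℝ => 2 * (x.2 - p.2))
        ((2 : ℝ) • ContinuousLinearMap.snd ℝ ℝ ℝ) x :=
      ((hasFDerivAt_snd (𝕜 := ℝ) (p := x)).sub_const p.2).const_mul 2
    rw [ex, ey, pdx_mul hkdd f1.differentiableAt, pdy_mul hkdd f2.differentiableAt,
      pdx_comp (hkd _) (hsd x), pdy_comp (hkd _) (hsd x), pdx_sqDist, pdy_sqDist, hm',
      f1.pdx_eq, f2.pdy_eq]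
    simp [sqDist]
    ring

end radial

lemma eq_zero_of_setIntegral_nonpos {Ω : Set (ℝ × ℝ)} (hopen : IsOpen Ω) {f : ℝ × ℝ → ℝ}
    (hf : ContinuousOn f Ω) (hf0 : ∀ x ∈ Ω, 0 ≤ f x) (hi : IntegrableOn f Ω)
    (h : ∫ x in Ω, f x ≤ 0) : ∀ x ∈ Ω, f x = 0 := by
  have h0 : ∫ x in Ω, f x = 0 := le_antisymm h (setIntegral_nonneg hopen.measurableSet hf0)
  have hae : 0 ≤ᵐ[volume.restrict Ω] f :=
    (ae_restrict_iff' hopen.measurableSet).2 (Eventually.of_forall hf0)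
  have h1 := (integral_eq_zero_iff_of_nonneg_ae hae hi).1 h0
  have h2 := Measure.eqOn_open_of_ae_eq h1 hopen hf continuousOn_const
  exact fun x hx => h2 hx

namespace MixedEigen

variable {Ω D : Set (ℝ × ℝ)} {lam : ℝ} {u : ℝ × ℝ → ℝ}

lemma radial_nonneg (h : MixedEigen Ω D lam u) {m : ℝ → ℝ} (hm : ContDiff ℝ (⊤ : ℕ∞) m) {ε r : ℝ}
    (hε : 0 < ε) (hr : 0 ≤ r) (hm0 : ∀ s, 0 ≤ m s) (hmε : ∀ s ≤ ε, m s = 0)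
    (hmR : ∀ s, r ^ 2 ≤ s → m s = 0) {p : ℝ × ℝ} (hp : {x | sqDist p x ≤ r ^ 2} ⊆ Ω) :
    0 ≤ ∫ x in Ω, max (u x) 0 * deriv m (sqDist p x) := by
  obtain ⟨ψ, hψ, hts, hψ0, hlap⟩ := exists_radial_test hm hε hm0 hmε hmR p
  have hK := isCompact_sqDist_le p hr
  have hψc : HasCompactSupport ψ := hK.of_isClosed_subset (isClosed_tsupport ψ) hts
  have hw := h.weak_posPart hψ hψc (hts.trans hp)
  have hvc : ContinuousOn (fun x => max (u x) 0) Ω := h.smooth.continuousOn.sup continuousOn_const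
  have hmd : Continuous (deriv m) := hm.continuous_deriv (by simp)
  have hmd0 : ∀ s, r ^ 2 < s → deriv m s = 0 := fun s hs => by
    have : m =ᶠ[𝓝 s] fun _ => 0 := by
      filter_upwards [Ioi_mem_nhds hs] with t ht using hmR t (le_of_lt ht)
    rw [this.deriv_eq]; simp
  have i1 : IntegrableOn (fun x => max (u x) 0 * deriv m (sqDist p x)) Ω :=
    integrableOn_of_compact_support h.isOpen
      (hvc.mul (hmd.comp (continuous_sqDist p)).continuousOn) hK hp fun x _ hx => by
        rw [hmd0 _ (by simpa using hx), mul_zero]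
  have i2 : IntegrableOn (fun x => max (u x) 0 * (lam * ψ x / x.2 ^ 2)) Ω :=
    integrableOn_of_compact_support h.isOpen
      (hvc.mul ((continuousOn_const.mul hψ.continuous.continuousOn).div (by fun_prop)
        fun x hx => pow_ne_zero 2 (ne_of_gt (h.subH hx)))) hψc (hts.trans hp) fun x _ hx => by
        rw [image_eq_zero_of_notMem_tsupport hx]; simp
  have e : ∀ x ∈ Ω, max (u x) 0 * (pdx (pdx ψ) x + pdy (pdy ψ) x + lam * ψ x / x.2 ^ 2) =
      (-4) * (max (u x) 0 * deriv m (sqDist p x)) + max (u x) 0 * (lam * ψ x / x.2 ^ 2) := by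
    intro x _
    rw [hlap x]; ring
  rw [setIntegral_congr_fun h.isOpen.measurableSet e, integral_add (i1.const_mul _) i2,
    integral_const_mul] at hw
  have h2 : 0 ≤ ∫ x in Ω, max (u x) 0 * (lam * ψ x / x.2 ^ 2) := by
    refine setIntegral_nonneg h.isOpen.measurableSet fun x hx => ?_
    have := hψ0 x
    have := h.pos
    positivity
  linarith

lemma exists_ball_nonpos (h : MixedEigen Ω D lam u) {p : ℝ × ℝ} (hp : p ∈ Ω) (hup : u p ≤ 0) :
    ∃ r > 0, ∀ x, sqDist p x ≤ r ^ 2 → u x ≤ 0 := by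
  obtain ⟨r₀, hr₀, hball⟩ := Metric.nhds_basis_closedBall.mem_iff.1 (h.contAt hp)
  have hsub : {x | sqDist p x ≤ r₀ ^ 2} ⊆ Ω := (sqDist_le_subset_closedBall p hr₀.le).trans hball
  have hK := isCompact_sqDist_le p hr₀.le
  obtain ⟨t₀, ht₀, ht₀'⟩ := exists_deriv_eq_slope Real.smoothTransition (zero_lt_one)
    contDiff_step.continuous.continuousOn (contDiff_step.differentiable (by simp)).differentiableOn
  rw [Real.smoothTransition.zero_of_nonpos le_rfl, Real.smoothTransition.one_of_one_le le_rfl]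
    at ht₀'
  obtain ⟨M, hM, hMb⟩ := exists_deriv_step_le
  refine ⟨r₀ / 2, by positivity, fun x₁ hx₁ => ?_⟩
  rcases (sqDist_nonneg p x₁).eq_or_lt with h0 | hs
  · rwa [sqDist_eq_zero h0.symm]
  set s₁ := sqDist p x₁ with hs₁
  have hx₁Ω : x₁ ∈ Ω := hsub (by simp only [mem_ofPred_eq]; nlinarith)
  set c : ℝ → ℝ := fun s => Real.smoothTransition ((s₁ - s) / (s₁ / 2) + t₀) with hc
  set c' : ℝ → ℝ := fun s => deriv Real.smoothTransition ((s₁ - s) / (s₁ / 2) + t₀) * (-(1 / (s₁ / 2)))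
    with hc'
  have hcd : ∀ s, HasDerivAt c (c' s) s := fun s => by
    refine (hasDerivAt_step _).comp s ?_
    have := (((hasDerivAt_id s).const_sub s₁).div_const (s₁ / 2)).add_const t₀
    refine this.congr_deriv ?_
    ring
  have hcC : ContDiff ℝ (⊤ : ℕ∞) c := contDiff_step.comp (by fun_prop)
  have hc'0 : ∀ s, c' s ≤ 0 := fun s =>
    mul_nonpos_of_nonneg_of_nonpos (deriv_step_nonneg _) (by simp; positivity)
  have hone : ∀ s, s ≤ s₁ / 2 → 1 ≤ (s₁ - s) / (s₁ / 2) + t₀ := fun s h2 => by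
    have : 1 ≤ (s₁ - s) / (s₁ / 2) := by rw [le_div_iff₀ (by positivity)]; linarith
    linarith [ht₀.1]
  have hzero : ∀ s, 2 * s₁ ≤ s → (s₁ - s) / (s₁ / 2) + t₀ ≤ 0 := fun s h2 => by
    have : (s₁ - s) / (s₁ / 2) ≤ -2 := by rw [div_le_iff₀ (by positivity)]; linarith
    linarith [ht₀.2]
  have hvc : ContinuousOn (fun x => max (u x) 0) Ω := h.smooth.continuousOn.sup continuousOn_const
  have hc'c : Continuous c' := by
    have : c' = deriv c := funext fun s => (hcd s).deriv.symm
    rw [this]; exact hcC.continuous_deriv (by simp)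
  have fi : IntegrableOn (fun x => max (u x) 0 * c' (sqDist p x)) Ω := by
    refine integrableOn_of_compact_support h.isOpen
      (hvc.mul (hc'c.comp (continuous_sqDist p)).continuousOn) hK hsub fun x _ hx => ?_
    simp only [mem_ofPred_eq, not_le] at hx
    have : c' (sqDist p x) = 0 := by
      simp only [hc']
      rw [deriv_step_of_nonpos (hzero _ (by nlinarith)), zero_mul]
    rw [this, mul_zero]
  have hJ : ∀ σ > 0, -(8 * σ * M) ≤ ∫ x in Ω, max (u x) 0 * c' (sqDist p x) := by
    intro σ hσ
    have hv0 : ∀ᶠ x in 𝓝 p, max (u x) 0 < σ := by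
      refine (hvc.continuousAt (h.contAt hp)).eventually_lt continuousAt_const ?_
      simpa [max_eq_right hup] using hσ
    obtain ⟨ρ, hρ, hρball⟩ := Metric.nhds_basis_closedBall.mem_iff.1 hv0
    set r₂ := min ρ (min r₀ (Real.sqrt (s₁ / 2))) with hr₂
    have hr₂0 : 0 < r₂ := by positivity
    have hr₂ρ : r₂ ≤ ρ := min_le_left _ _
    have hr₂r : r₂ ≤ r₀ := (min_le_right _ _).trans (min_le_left _ _)
    have hr₂s : r₂ ^ 2 ≤ s₁ / 2 := by
      rw [← Real.sq_sqrt (show 0 ≤ s₁ / 2 by positivity)]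
      exact pow_le_pow_left₀ hr₂0.le ((min_le_right _ _).trans (min_le_right _ _)) 2
    set ε := r₂ ^ 2 / 2 with hε
    have hε0 : 0 < ε := by positivity
    set m : ℝ → ℝ := fun s => Real.smoothTransition (s / ε - 1) * c s with hm
    have hbd : ∀ s, HasDerivAt (fun s => Real.smoothTransition (s / ε - 1))
        (deriv Real.smoothTransition (s / ε - 1) * (1 / ε)) s := fun s =>
      (hasDerivAt_step _).comp s (((hasDerivAt_id s).div_const ε).sub_const 1)
    have hmd : ∀ s, deriv m s = deriv Real.smoothTransition (s / ε - 1) * (1 / ε) + c' s := by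
      intro s
      rw [((hbd s).fun_mul (hcd s)).deriv]
      rcases le_total s (2 * ε) with h2 | h2
      · have h3 : s ≤ s₁ / 2 := by rw [hε] at h2; linarith
        have e1 : c s = 1 := Real.smoothTransition.one_of_one_le (hone s h3)
        have e2 : c' s = 0 := by
          simp only [hc']; rw [deriv_step_of_one_le (hone s h3), zero_mul]
        rw [e1, e2]; ring
      · have h3 : 1 ≤ s / ε - 1 := by
          rw [le_sub_iff_add_le, le_div_iff₀ hε0]; linarith
        rw [deriv_step_of_one_le h3, Real.smoothTransition.one_of_one_le h3]; ring
    have hmC : ContDiff ℝ (⊤ : ℕ∞) m := (contDiff_step.comp (by fun_prop)).mul hcC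
    have key := h.radial_nonneg hmC hε0 hr₀.le
      (fun s => mul_nonneg (Real.smoothTransition.nonneg _) (Real.smoothTransition.nonneg _))
      (fun s hs => by
        have : s / ε - 1 ≤ 0 := by rw [sub_nonpos, div_le_one hε0]; exact hs
        simp [hm, Real.smoothTransition.zero_of_nonpos this])
      (fun s hs => by
        have : c s = 0 := Real.smoothTransition.zero_of_nonpos (hzero s (by nlinarith))
        simp [hm, this]) hsub
    set f : ℝ × ℝ → ℝ := fun x =>
      max (u x) 0 * (deriv Real.smoothTransition (sqDist p x / ε - 1) * (1 / ε)) with hf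
    have hBr : {x | sqDist p x ≤ r₂ ^ 2} ⊆ Ω := fun x hx => hsub (by
      simp only [mem_ofPred_eq] at hx ⊢; nlinarith)
    have hB := isCompact_sqDist_le p hr₂0.le
    have hstep : Continuous fun x => deriv Real.smoothTransition (sqDist p x / ε - 1) * (1 / ε) :=
      ((contDiff_step.continuous_deriv (by simp)).comp
        (((continuous_sqDist p).div_const _).sub continuous_const)).mul continuous_const
    have hf0 : ∀ x, x ∉ {x | sqDist p x ≤ r₂ ^ 2} → f x = 0 := fun x hx => by
      simp only [mem_ofPred_eq, not_le] at hx
      have h3 : 1 ≤ sqDist p x / ε - 1 := by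
        rw [le_sub_iff_add_le, le_div_iff₀ hε0, hε]; linarith
      simp [hf, deriv_step_of_one_le h3]
    have gi : IntegrableOn f Ω := integrableOn_of_compact_support h.isOpen
      (hvc.mul hstep.continuousOn) hB hBr fun x _ hx => hf0 x hx
    have hfle : ∫ x in Ω, f x ≤ 8 * σ * M := by
      have e1 : ∫ x in Ω, f x = ∫ x in {x | sqDist p x ≤ r₂ ^ 2}, f x :=
        setIntegral_eq_of_subset_of_forall_sdiff_eq_zero h.isOpen.measurableSet hBr
          fun x hx => hf0 x hx.2
      have hfin : volume {x | sqDist p x ≤ r₂ ^ 2} < ⊤ := hB.measure_lt_top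
      rw [e1]
      calc ∫ x in {x | sqDist p x ≤ r₂ ^ 2}, f x
          ≤ ∫ x in {x | sqDist p x ≤ r₂ ^ 2}, σ * (M * (1 / ε)) := by
            refine setIntegral_mono_on (gi.mono_set hBr) (integrableOn_const hfin.ne)
              hB.measurableSet fun x hx => ?_
            have hxv : max (u x) 0 < σ := hρball
              (Metric.closedBall_subset_closedBall hr₂ρ (sqDist_le_subset_closedBall p hr₂0.le hx))
            refine mul_le_mul hxv.le (mul_le_mul_of_nonneg_right (hMb _) (by positivity))
              (mul_nonneg (deriv_step_nonneg _) (by positivity)) hσ.le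
        _ = volume.real {x | sqDist p x ≤ r₂ ^ 2} * (σ * (M * (1 / ε))) := by
            rw [setIntegral_const, smul_eq_mul]
        _ ≤ (4 * r₂ ^ 2) * (σ * (M * (1 / ε))) :=
            mul_le_mul_of_nonneg_right (volume_sqDist_le p hr₂0.le) (by positivity)
        _ = 8 * σ * M := by rw [hε]; field_simp; ring
    have e : ∀ x ∈ Ω, max (u x) 0 * deriv m (sqDist p x) =
        f x + max (u x) 0 * c' (sqDist p x) := fun x _ => by
      rw [hmd]; simp only [hf]; ring
    rw [setIntegral_congr_fun h.isOpen.measurableSet e, integral_add gi fi] at key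
    linarith
  have hJ0 : 0 ≤ ∫ x in Ω, max (u x) 0 * c' (sqDist p x) := by
    by_contra hneg
    push Not at hneg
    set J := ∫ x in Ω, max (u x) 0 * c' (sqDist p x) with hJdef
    have := hJ (-J / (16 * M)) (div_pos (by linarith) (by positivity))
    have e : 8 * (-J / (16 * M)) * M = -J / 2 := by field_simp; ring
    rw [e] at this
    linarith
  have hfinal := eq_zero_of_setIntegral_nonpos h.isOpen
    (f := fun x => -(max (u x) 0 * c' (sqDist p x)))
    (hvc.mul (hc'c.comp (continuous_sqDist p)).continuousOn).neg
    (fun x _ => by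
      have := mul_nonpos_of_nonneg_of_nonpos (le_max_right (u x) 0) (hc'0 (sqDist p x))
      linarith) fi.neg (by rw [integral_neg]; linarith) x₁ hx₁Ω
  have hneg : c' s₁ < 0 := by
    simp only [hc', sub_self, zero_div, zero_add, ht₀']
    have : 0 < 1 / (s₁ / 2) := by positivity
    linarith
  rw [neg_eq_zero, mul_eq_zero] at hfinal
  rcases hfinal with h1 | h1
  · exact max_eq_right_iff.1 h1
  · exact absurd h1 hneg.ne

/-- Dichotomy: an eigenfunction that is positive somewhere is positive everywhere. -/
lemma pos_of_pos (h : MixedEigen Ω D lam u) {p : ℝ × ℝ} (hp : p ∈ Ω) (hup : 0 < u p) :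
    ∀ x ∈ Ω, 0 < u x := by
  have hpre := h.conn.isPreconnected
  have o1 : IsOpen (Ω ∩ {x | 0 < u x}) := h.smooth.continuousOn.isOpen_inter_preimage h.isOpen isOpen_Ioi
  have o2 : IsOpen (Ω ∩ {x | u x ≤ 0}) := by
    rw [isOpen_iff_mem_nhds]
    rintro x ⟨hx, hux⟩
    obtain ⟨r, hr, hball⟩ := h.exists_ball_nonpos hx hux
    refine inter_mem (h.contAt hx) ?_
    have : {y | sqDist x y < r ^ 2} ∈ 𝓝 x :=
      (isOpen_lt (continuous_sqDist x) continuous_const).mem_nhds (by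
        simp only [mem_ofPred_eq, sqDist_self]; positivity)
    exact mem_of_superset this fun y hy => hball y (le_of_lt hy)
  by_contra hcon
  push Not at hcon
  obtain ⟨q, hq, huq⟩ := hcon
  obtain ⟨z, -, ⟨-, hz1⟩, ⟨-, hz2⟩⟩ := hpre _ _ o1 o2
    (fun x hx => (lt_or_ge 0 (u x)).imp (fun h => ⟨hx, h⟩) fun h => ⟨hx, h⟩)
    ⟨p, hp, hp, hup⟩ ⟨q, hq, hq, huq⟩
  exact absurd (show 0 < u z from hz1) (not_lt.2 hz2)

end MixedEigen

/-! ### The spherical function with eigenvalue at most `1/4` -/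

lemma summable_succ_mul_mul_pow {r : ℝ} (hr0 : 0 ≤ r) (hr : r < 1) :
    Summable fun n : ℕ => ((n : ℝ) + 1) * ((n : ℝ) + 2) * r ^ n := by
  have hn : ‖r‖ < 1 := by rwa [Real.norm_of_nonneg hr0]
  have h2 := summable_pow_mul_geometric_of_norm_lt_one 2 hn
  have h1 := summable_pow_mul_geometric_of_norm_lt_one 1 hn
  have h0 := summable_geometric_of_norm_lt_one hn
  refine ((h2.add (h1.mul_left 3)).add (h0.mul_left 2)).congr fun n => ?_
  ring

lemma summable_mul_pow_of_le {a : ℕ → ℝ} (ha : ∀ n, |a n| ≤ n + 1) {w : ℝ} (hw : |w| < 1) :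
    Summable fun n => a n * w ^ n := by
  refine Summable.of_norm_bounded (summable_succ_mul_mul_pow (abs_nonneg w) hw) fun n => ?_
  rw [norm_mul, norm_pow, Real.norm_eq_abs, Real.norm_eq_abs]
  refine mul_le_mul_of_nonneg_right ((ha n).trans ?_) (by positivity)
  have : (0 : ℝ) ≤ n := n.cast_nonneg
  nlinarith

/-- Term by term differentiation of a real power series on the unit interval. -/
lemma hasDerivAt_tsum_mul_pow {a : ℕ → ℝ} (ha : ∀ n, |a n| ≤ (n : ℝ) + 1) {w : ℝ} (hw : |w| < 1) :
    HasDerivAt (fun x => ∑' n, a n * x ^ n) (∑' n : ℕ, ((n : ℝ) + 1) * a (n + 1) * w ^ n) w := by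
  obtain ⟨r, hwr, hr⟩ := exists_between hw
  have hr0 : 0 ≤ r := (abs_nonneg w).trans hwr.le
  have hs : Summable fun n : ℕ => (n : ℝ) * ((n : ℝ) + 1) * r ^ (n - 1) := by
    rw [← summable_nat_add_iff 1]
    refine (summable_succ_mul_mul_pow hr0 hr).congr fun n => ?_
    simp only [Nat.add_sub_cancel]; push_cast; ring
  have key := hasDerivAt_tsum_of_isPreconnected (𝕜 := ℝ) (F := ℝ)
    (g := fun n x => a n * x ^ n) (g' := fun n x => a n * ((n : ℝ) * x ^ (n - 1)))
    (t := Metric.ball 0 r) (y₀ := 0) (y := w) hs Metric.isOpen_ball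
    (convex_ball (0 : ℝ) r).isPreconnected
    (fun n y _ => (hasDerivAt_pow n y).const_mul (a n)) ?_ ?_ ?_ ?_
  · refine key.congr_deriv ?_
    have hsum : Summable fun n : ℕ => a n * ((n : ℝ) * w ^ (n - 1)) := by
      refine Summable.of_norm_bounded hs fun n => ?_
      rw [norm_mul, norm_mul, norm_pow, Real.norm_eq_abs, Real.norm_eq_abs, Real.norm_eq_abs,
        Nat.abs_cast]
      calc |a n| * (n * |w| ^ (n - 1)) ≤ ((n : ℝ) + 1) * (n * r ^ (n - 1)) := by
            gcongr; exact ha n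
        _ = _ := by ring
    rw [hsum.tsum_eq_zero_add]
    simp only [Nat.cast_zero, zero_mul, mul_zero, zero_add, Nat.add_sub_cancel]
    refine tsum_congr fun n => ?_
    push_cast; ring
  · intro n y hy
    rw [mem_ball_zero_iff, Real.norm_eq_abs] at hy
    rw [norm_mul, norm_mul, norm_pow, Real.norm_eq_abs, Real.norm_eq_abs, Real.norm_eq_abs,
      Nat.abs_cast]
    calc |a n| * (n * |y| ^ (n - 1)) ≤ ((n : ℝ) + 1) * (n * r ^ (n - 1)) := by
          gcongr; exact ha n
      _ = _ := by ring
  · exact Metric.mem_ball_self ((abs_nonneg w).trans_lt hwr)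
  · exact summable_mul_pow_of_le ha (by simp)
  · simpa using hwr

lemma mul_tsum_succ_mul_pow {a : ℕ → ℝ} (ha : ∀ n, |a n| ≤ 1) {w : ℝ} (hw : |w| < 1) :
    w * ∑' n : ℕ, ((n : ℝ) + 1) * a (n + 1) * w ^ n = ∑' n : ℕ, (n : ℝ) * a n * w ^ n := by
  have hs : Summable fun n : ℕ => (n : ℝ) * a n * w ^ n := by
    refine summable_mul_pow_of_le (a := fun n => (n : ℝ) * a n) (fun n => ?_) hw
    rw [abs_mul, Nat.abs_cast]
    nlinarith [ha n, (n.cast_nonneg : (0 : ℝ) ≤ n), abs_nonneg (a n)]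
  rw [hs.tsum_eq_zero_add, ← tsum_mul_left]
  simp only [Nat.cast_zero, zero_mul, zero_add]
  refine tsum_congr fun n => ?_
  push_cast; ring

/-- Squares of the Pochhammer quotients `(s)ₙ / n!`. -/
def hypCoeff (s : ℝ) : ℕ → ℝ
  | 0 => 1
  | n + 1 => hypCoeff s n * ((s + n) / (n + 1)) ^ 2

section hyp

variable {s : ℝ}

lemma hypCoeff_pos (hs : 0 < s) (n : ℕ) : 0 < hypCoeff s n := by
  induction n with
  | zero => exact one_pos
  | succ n ih => rw [hypCoeff]; positivity

lemma hypCoeff_le_one (hs : 0 < s) (hs1 : s ≤ 1) (n : ℕ) : hypCoeff s n ≤ 1 := by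
  induction n with
  | zero => exact le_rfl
  | succ n ih =>
    rw [hypCoeff]
    have h1 : (s + n) / (n + 1) ≤ 1 := by rw [div_le_one (by positivity)]; linarith
    have h0 : 0 ≤ (s + n) / (n + 1) := by positivity
    exact mul_le_one₀ ih (by positivity) (pow_le_one₀ h0 h1)

/-- The coefficients of the derivative of the spherical function. -/
def hypCoeffD (s : ℝ) (n : ℕ) : ℝ := hypCoeff s n * ((n + s) / (n + 1))

lemma hypCoeffD_pos (hs : 0 < s) (n : ℕ) : 0 < hypCoeffD s n := by
  have := hypCoeff_pos hs n
  rw [hypCoeffD]; positivity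

lemma hypCoeffD_le (hs : 0 < s) (hs1 : s ≤ 1) (n : ℕ) : hypCoeffD s n ≤ hypCoeff s n := by
  rw [hypCoeffD]
  refine mul_le_of_le_one_right (hypCoeff_pos hs n).le ?_
  rw [div_le_one (by positivity)]; linarith

lemma abs_hypCoeff_le (hs : 0 < s) (hs1 : s ≤ 1) (n : ℕ) : |hypCoeff s n| ≤ 1 := by
  rw [abs_of_pos (hypCoeff_pos hs n)]; exact hypCoeff_le_one hs hs1 n

lemma abs_hypCoeffD_le (hs : 0 < s) (hs1 : s ≤ 1) (n : ℕ) : |hypCoeffD s n| ≤ 1 := by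
  rw [abs_of_pos (hypCoeffD_pos hs n)]
  exact (hypCoeffD_le hs hs1 n).trans (hypCoeff_le_one hs hs1 n)

lemma succ_mul_hypCoeff_succ (n : ℕ) :
    ((n : ℝ) + 1) * hypCoeff s (n + 1) = (n + s) * hypCoeffD s n := by
  rw [hypCoeff, hypCoeffD]; field_simp; ring

lemma add_mul_hypCoeff (n : ℕ) :
    ((n : ℝ) + s) * hypCoeff s n = (n + 1) * hypCoeffD s n := by
  rw [hypCoeffD]; field_simp

lemma one_le_of_le_one {a : ℕ → ℝ} (ha : ∀ n, |a n| ≤ 1) (n : ℕ) : |a n| ≤ n + 1 :=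
  (ha n).trans (by linarith [(n.cast_nonneg : (0 : ℝ) ≤ n)])

lemma tsum_hypCoeff_succ (hs : 0 < s) (hs1 : s ≤ 1) {w : ℝ} (hw : |w| < 1) :
    ∑' n : ℕ, ((n : ℝ) + 1) * hypCoeff s (n + 1) * w ^ n =
      w * ∑' n : ℕ, ((n : ℝ) + 1) * hypCoeffD s (n + 1) * w ^ n
        + s * ∑' n, hypCoeffD s n * w ^ n := by
  have hE := abs_hypCoeffD_le hs hs1
  rw [mul_tsum_succ_mul_pow hE hw, ← tsum_mul_left, ← Summable.tsum_add]
  · refine tsum_congr fun n => ?_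
    rw [succ_mul_hypCoeff_succ]; ring
  · refine summable_mul_pow_of_le (a := fun n => (n : ℝ) * hypCoeffD s n) (fun n => ?_) hw
    rw [abs_mul, Nat.abs_cast]
    nlinarith [hE n, (n.cast_nonneg : (0 : ℝ) ≤ n), abs_nonneg (hypCoeffD s n)]
  · exact (summable_mul_pow_of_le (one_le_of_le_one hE) hw).mul_left s

lemma one_sub_mul_tsum_hypCoeff (hs : 0 < s) (hs1 : s ≤ 1) {w : ℝ} (hw : |w| < 1) :
    (1 - w) * ∑' n : ℕ, ((n : ℝ) + 1) * hypCoeff s (n + 1) * w ^ n =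
      s * ∑' n, hypCoeff s n * w ^ n - (1 - s) * ∑' n, hypCoeffD s n * w ^ n := by
  have hB := abs_hypCoeff_le hs hs1
  have hE := abs_hypCoeffD_le hs hs1
  have h1 : Summable fun n : ℕ => (n : ℝ) * hypCoeff s n * w ^ n := by
    refine summable_mul_pow_of_le (a := fun n => (n : ℝ) * hypCoeff s n) (fun n => ?_) hw
    rw [abs_mul, Nat.abs_cast]
    nlinarith [hB n, (n.cast_nonneg : (0 : ℝ) ≤ n), abs_nonneg (hypCoeff s n)]
  have h2 : Summable fun n : ℕ => ((n : ℝ) + 1) * hypCoeff s (n + 1) * w ^ n := by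
    refine summable_mul_pow_of_le (a := fun n => ((n : ℝ) + 1) * hypCoeff s (n + 1))
      (fun n => ?_) hw
    rw [abs_mul, abs_of_nonneg (by positivity)]
    exact mul_le_of_le_one_right (by positivity) (hB _)
  have h3 := summable_mul_pow_of_le (one_le_of_le_one hB) hw
  have h4 := summable_mul_pow_of_le (one_le_of_le_one hE) hw
  rw [sub_mul, one_mul, mul_tsum_succ_mul_pow hB hw, ← Summable.tsum_sub h2 h1,
    ← tsum_mul_left, ← tsum_mul_left,
    ← Summable.tsum_sub (h3.mul_left s) (h4.mul_left (1 - s))]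
  refine tsum_congr fun n => ?_
  have e1 := succ_mul_hypCoeff_succ (s := s) n
  have e2 := add_mul_hypCoeff (s := s) n
  linear_combination w ^ n * e1 - w ^ n * e2

end hyp

/-- A positive decreasing solution of `(C² - 1) f'' + 2 C f' + λ f = 0`, the equation satisfied
by radial eigenfunctions of the hyperbolic Laplacian in the variable `C = cosh r`. -/
theorem exists_spherical {lam : ℝ} (h0 : 0 < lam) (h1 : lam ≤ 1 / 4) :
    ∃ f f₁ f₂ : ℝ → ℝ, (∀ C, 0 < C → HasDerivAt f (f₁ C) C) ∧
      (∀ C, 0 < C → HasDerivAt f₁ (f₂ C) C) ∧ ContinuousOn f₂ (Ioi 0) ∧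
      (∀ C, 1 ≤ C → 0 < f C ∧ f C ≤ 1 ∧ f₁ C < 0 ∧ f₁ C ^ 2 * (C ^ 2 - 1) ≤ 1) ∧ 0 < f₂ 1 ∧
      ∀ C, 0 < C → (C ^ 2 - 1) * f₂ C + 2 * C * f₁ C + lam * f C = 0 := by
  set s : ℝ := (1 - √(1 - 4 * lam)) / 2 with hsdef
  have hsq : √(1 - 4 * lam) ^ 2 = 1 - 4 * lam := Real.sq_sqrt (by linarith)
  have hsq0 := Real.sqrt_nonneg (1 - 4 * lam)
  have hs0 : 0 < s := by
    have : √(1 - 4 * lam) < 1 := by nlinarith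
    rw [hsdef]; linarith
  have hs2 : s ≤ 1 / 2 := by rw [hsdef]; linarith
  have hs1 : s ≤ 1 := by linarith
  have hlam : lam = s * (1 - s) := by rw [hsdef]; nlinarith
  clear_value s
  set B : ℝ → ℝ := fun w => ∑' n, hypCoeff s n * w ^ n with hB
  set Q : ℝ → ℝ := fun w => ∑' n, hypCoeffD s n * w ^ n with hQ
  set B' : ℝ → ℝ := fun w => ∑' n : ℕ, ((n : ℝ) + 1) * hypCoeff s (n + 1) * w ^ n with hB'
  set Q' : ℝ → ℝ := fun w => ∑' n : ℕ, ((n : ℝ) + 1) * hypCoeffD s (n + 1) * w ^ n with hQ'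
  have dB : ∀ w, |w| < 1 → HasDerivAt B (B' w) w := fun w hw =>
    hasDerivAt_tsum_mul_pow (one_le_of_le_one (abs_hypCoeff_le hs0 hs1)) hw
  have dQ : ∀ w, |w| < 1 → HasDerivAt Q (Q' w) w := fun w hw =>
    hasDerivAt_tsum_mul_pow (one_le_of_le_one (abs_hypCoeffD_le hs0 hs1)) hw
  have cQ' : ∀ w, |w| < 1 → ContinuousAt Q' w := fun w hw =>
    (hasDerivAt_tsum_mul_pow (a := fun n : ℕ => ((n : ℝ) + 1) * hypCoeffD s (n + 1))
      (fun n => by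
        rw [abs_mul, abs_of_nonneg (by positivity)]
        exact mul_le_of_le_one_right (by positivity) (abs_hypCoeffD_le hs0 hs1 _))
      hw).continuousAt
  have i1 : ∀ w, |w| < 1 → B' w = w * Q' w + s * Q w := fun w hw =>
    tsum_hypCoeff_succ hs0 hs1 hw
  have i2 : ∀ w, |w| < 1 → (1 - w) * B' w = s * B w - (1 - s) * Q w := fun w hw =>
    one_sub_mul_tsum_hypCoeff hs0 hs1 hw
  have sB : ∀ w, |w| < 1 → Summable fun n => hypCoeff s n * w ^ n := fun w hw =>
    summable_mul_pow_of_le (one_le_of_le_one (abs_hypCoeff_le hs0 hs1)) hw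
  have sQ : ∀ w, |w| < 1 → Summable fun n => hypCoeffD s n * w ^ n := fun w hw =>
    summable_mul_pow_of_le (one_le_of_le_one (abs_hypCoeffD_le hs0 hs1)) hw
  have zero_val : ∀ a : ℕ → ℝ, ∑' n, a n * (0 : ℝ) ^ n = a 0 := fun a => by
    rw [tsum_eq_single 0 fun n hn => by simp [hn]]; simp
  have B0 : B 0 = 1 := (zero_val _).trans rfl
  have Q0 : Q 0 = s := (zero_val _).trans (by simp [hypCoeffD, hypCoeff])
  have Q'0 : Q' 0 = s ^ 2 * (1 + s) / 2 := by
    refine (zero_val fun n : ℕ => ((n : ℝ) + 1) * hypCoeffD s (n + 1)).trans ?_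
    simp [hypCoeffD, hypCoeff]; ring
  have Bpos : ∀ w, 0 ≤ w → w < 1 → 0 < B w := fun w hw0 hw1 =>
    (sB w (by rwa [abs_of_nonneg hw0])).tsum_pos
      (fun n => mul_nonneg (hypCoeff_pos hs0 n).le (pow_nonneg hw0 n)) 0
      (by simpa using hypCoeff_pos hs0 0)
  have Qpos : ∀ w, 0 ≤ w → w < 1 → 0 < Q w := fun w hw0 hw1 =>
    (sQ w (by rwa [abs_of_nonneg hw0])).tsum_pos
      (fun n => mul_nonneg (hypCoeffD_pos hs0 n).le (pow_nonneg hw0 n)) 0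
      (by simpa using hypCoeffD_pos hs0 0)
  have QB : ∀ w, 0 ≤ w → w < 1 → Q w ≤ B w := fun w hw0 hw1 => by
    have hw : |w| < 1 := by rwa [abs_of_nonneg hw0]
    exact (sQ w hw).tsum_le_tsum (fun n => mul_le_mul_of_nonneg_right
      (hypCoeffD_le hs0 hs1 n) (pow_nonneg hw0 n)) (sB w hw)
  clear_value B Q B' Q'
  set v : ℝ → ℝ := fun C => (C - 1) / (C + 1) with hv
  have v_abs : ∀ C, 0 < C → |v C| < 1 := fun C hC => by
    rw [hv, abs_lt]
    constructor
    · rw [lt_div_iff₀ (by linarith)]; linarith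
    · rw [div_lt_one (by linarith)]; linarith
  have v_sub : ∀ C, 0 < C → 1 - v C = 2 / (C + 1) := fun C hC => by
    rw [hv]; field_simp; ring
  have v_pos : ∀ C, 0 < C → 0 < 1 - v C := fun C hC => by
    rw [v_sub C hC]; positivity
  have dv : ∀ C, 0 < C → HasDerivAt v ((1 - v C) ^ 2 / 2) C := fun C hC => by
    have h := ((hasDerivAt_id C).sub_const 1).div ((hasDerivAt_id C).add_const 1)
      (by simp only [id]; linarith)
    refine h.congr_deriv ?_
    rw [v_sub C hC]; simp only [id]; field_simp; ring
  have dpow : ∀ (e C : ℝ), 0 < C → HasDerivAt (fun C => (1 - v C) ^ e)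
      (-(e / 2) * (1 - v C) ^ (e + 1)) C := fun e C hC => by
    have h := ((dv C hC).const_sub 1).rpow_const (p := e) (Or.inl (v_pos C hC).ne')
    refine h.congr_deriv ?_
    have : (1 - v C) ^ (e + 1) = (1 - v C) ^ (e - 1) * (1 - v C) ^ 2 := by
      rw [← Real.rpow_natCast (1 - v C) 2, ← Real.rpow_add (v_pos C hC)]; congr 1; push_cast; ring
    rw [this]; ring
  have ps : ∀ (e C : ℝ), 0 < C → (1 - v C) ^ (e + 1) = (1 - v C) ^ e * (1 - v C) :=
    fun e C hC => by rw [Real.rpow_add (v_pos C hC), Real.rpow_one]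
  set f : ℝ → ℝ := fun C => (1 - v C) ^ s * B (v C) with hf
  set f₁ : ℝ → ℝ := fun C => -(1 - s) / 2 * ((1 - v C) ^ (s + 1) * Q (v C)) with hf₁
  set f₂ : ℝ → ℝ := fun C => -(1 - s) / 4 * ((1 - v C) ^ (s + 2) *
    ((1 - v C) * Q' (v C) - (s + 1) * Q (v C))) with hf₂
  have df : ∀ C, 0 < C → HasDerivAt f (f₁ C) C := fun C hC => by
    have h := (dpow s C hC).fun_mul ((dB _ (v_abs C hC)).comp C (dv C hC))
    refine h.congr_deriv ?_
    simp only [hf₁, Function.comp]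
    have := i2 _ (v_abs C hC)
    rw [ps s C hC]
    linear_combination (1 / 2) * (1 - v C) ^ s * (1 - v C) * this
  have df₁ : ∀ C, 0 < C → HasDerivAt f₁ (f₂ C) C := fun C hC => by
    have h := ((dpow (s + 1) C hC).fun_mul
      ((dQ _ (v_abs C hC)).comp C (dv C hC))).const_mul (-(1 - s) / 2)
    refine h.congr_deriv ?_
    simp only [hf₂, Function.comp]
    rw [show s + 2 = s + 1 + 1 by ring, ps (s + 1) C hC]
    ring
  have f1 : f 1 = 1 := by simp [hf, hv, B0]
  have neg1 : ∀ C, 1 ≤ C → f₁ C < 0 := fun C hC => by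
    have hC0 : 0 < C := by linarith
    have hq := Qpos (v C) (div_nonneg (by linarith) (by linarith))
      ((le_abs_self _).trans_lt (v_abs C hC0))
    have hp := Real.rpow_pos_of_pos (v_pos C hC0) (s + 1)
    have : 0 < (1 - v C) ^ (s + 1) * Q (v C) := mul_pos hp hq
    simp only [hf₁]
    nlinarith
  have hle : ∀ C, 1 ≤ C → f C ≤ 1 := fun C hC => by
    have : AntitoneOn f (Ici 1) := by
      refine antitoneOn_of_deriv_nonpos (convex_Ici 1)
        (fun x hx => (df x (zero_lt_one.trans_le hx)).continuousAt.continuousWithinAt)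
        (fun x hx => ?_) fun x hx => ?_
      all_goals
        rw [interior_Ici] at hx
        have hx0 : (0 : ℝ) < x := zero_lt_one.trans hx
      · exact (df x hx0).differentiableAt.differentiableWithinAt
      · rw [(df x hx0).deriv]; exact (neg1 x (le_of_lt hx)).le
    have := this (mem_Ici.2 le_rfl) (mem_Ici.2 hC) hC
    rwa [f1] at this
  refine ⟨f, f₁, f₂, df, df₁, ?_, fun C hC => ?_, ?_, fun C hC => ?_⟩
  · intro C hC
    have hC : 0 < C := hC
    have a1 := (dpow (s + 2) C hC).continuousAt
    have a2 := (dv C hC).continuousAt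
    have a3 : ContinuousAt (fun C => Q' (v C)) C :=
      ContinuousAt.comp (g := Q') (cQ' _ (v_abs C hC)) a2
    have a4 : ContinuousAt (fun C => Q (v C)) C :=
      ContinuousAt.comp (g := Q) (dQ _ (v_abs C hC)).continuousAt a2
    exact (continuousAt_const.mul (a1.mul (((continuousAt_const.sub a2).mul a3).sub
      (continuousAt_const.mul a4)))).continuousWithinAt
  · have hC0 : 0 < C := by linarith
    have hv0 : 0 ≤ v C := div_nonneg (by linarith) (by linarith)
    have hv1 : v C < 1 := (le_abs_self _).trans_lt (v_abs C hC0)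
    have hp := Real.rpow_pos_of_pos (v_pos C hC0) s
    have hfp : 0 < f C := mul_pos hp (Bpos _ hv0 hv1)
    refine ⟨hfp, hle C hC, neg1 C hC, ?_⟩
    have hCC : (1 - v C) ^ 2 * (C ^ 2 - 1) = 4 * v C := by
      rw [v_sub C hC0]; simp only [hv]; field_simp; ring
    have e : f₁ C ^ 2 * (C ^ 2 - 1) = (1 - s) ^ 2 * v C * ((1 - v C) ^ s * Q (v C)) ^ 2 := by
      simp only [hf₁]; rw [ps s C hC0]
      linear_combination (1 - s) ^ 2 / 4 * ((1 - v C) ^ s * Q (v C)) ^ 2 * hCC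
    have hQ1 : (1 - v C) ^ s * Q (v C) ≤ 1 :=
      (mul_le_mul_of_nonneg_left (QB _ hv0 hv1) hp.le).trans (hle C hC)
    have hQ0 : 0 ≤ (1 - v C) ^ s * Q (v C) := (mul_pos hp (Qpos _ hv0 hv1)).le
    rw [e]
    refine mul_le_one₀ (mul_le_one₀ (pow_le_one₀ (by linarith) (by linarith)) hv0 hv1.le)
      (by positivity) (pow_le_one₀ hQ0 hQ1)
  · have : v 1 = 0 := by simp [hv]
    simp only [hf₂, this, Q0, Q'0, sub_zero, Real.one_rpow]
    have : 0 < s * (1 - s) * (1 + s) * (2 - s) :=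
      mul_pos (mul_pos (mul_pos hs0 (by linarith)) (by linarith)) (by linarith)
    linarith
  · have e : C * (1 - v C) = 1 + v C := by
      rw [v_sub C hC]; simp only [hv]; field_simp; ring
    have j1 := i1 _ (v_abs C hC)
    have j2 := i2 _ (v_abs C hC)
    have hne := (v_pos C hC).ne'
    have hCe : C = (1 + v C) / (1 - v C) := by rw [eq_div_iff hne, e]
    simp only [hf, hf₁, hf₂]
    rw [show s + 2 = s + 1 + 1 by ring, ps (s + 1) C hC, ps s C hC, hlam]
    generalize v C = w at *
    subst hCe
    field_simp
    linear_combination (1 - s) * (1 - w) ^ s * (4 * (1 - w) * j1 - 4 * j2)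

/-! ### Radial comparison functions -/

lemma pdx_eq_of_hasDerivAt {f : ℝ × ℝ → ℝ} {x : ℝ × ℝ} {d : ℝ} (hf : DifferentiableAt ℝ f x)
    (h : HasDerivAt (fun t => f (t, x.2)) d x.1) : pdx f x = d := by
  have h1 : HasDerivAt (fun t : ℝ => (t, x.2)) ((1 : ℝ), (0 : ℝ)) x.1 :=
    (hasDerivAt_id x.1).prodMk (hasDerivAt_const x.1 x.2)
  exact (hf.hasFDerivAt.comp_hasDerivAt x.1 h1).unique h

lemma pdy_eq_of_hasDerivAt {f : ℝ × ℝ → ℝ} {x : ℝ × ℝ} {d : ℝ} (hf : DifferentiableAt ℝ f x)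
    (h : HasDerivAt (fun t => f (x.1, t)) d x.2) : pdy f x = d := by
  have h1 : HasDerivAt (fun t : ℝ => (x.1, t)) ((0 : ℝ), (1 : ℝ)) x.2 :=
    (hasDerivAt_const x.2 x.1).prodMk (hasDerivAt_id x.2)
  exact (hf.hasFDerivAt.comp_hasDerivAt x.2 h1).unique h

lemma pdx_coshDist {o p : ℝ × ℝ} (ho : o ∈ H2) (hp : p ∈ H2) :
    pdx (coshDist o) p = (p.1 - o.1) / (p.2 * o.2) := by
  rw [(hasFDerivAt_coshDist ho hp).pdx_eq]; simp

lemma pdy_coshDist {o p : ℝ × ℝ} (ho : o ∈ H2) (hp : p ∈ H2) :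
    pdy (coshDist o) p = (p.2 ^ 2 - (p.1 - o.1) ^ 2 - o.2 ^ 2) / (2 * p.2 ^ 2 * o.2) := by
  rw [(hasFDerivAt_coshDist ho hp).pdy_eq]; simp

lemma pdx_pdx_coshDist {o p : ℝ × ℝ} (ho : o ∈ H2) (hp : p ∈ H2) :
    pdx (pdx (coshDist o)) p = 1 / (p.2 * o.2) := by
  have hd : DifferentiableAt ℝ (pdx (coshDist o)) p :=
    ((contDiffOn_pdx isOpen_H2 (contDiffOn_coshDist ho) (m := 1) (by norm_cast)).contDiffAt
      (isOpen_H2.mem_nhds hp)).differentiableAt (by simp)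
  refine pdx_eq_of_hasDerivAt hd ?_
  have h := ((hasDerivAt_id p.1).sub_const o.1).div_const (p.2 * o.2)
  refine h.congr_of_eventuallyEq (Eventually.of_forall fun t => ?_)
  exact pdx_coshDist (p := (t, p.2)) ho hp

lemma pdy_pdy_coshDist {o p : ℝ × ℝ} (ho : o ∈ H2) (hp : p ∈ H2) :
    pdy (pdy (coshDist o)) p = ((p.1 - o.1) ^ 2 + o.2 ^ 2) / (p.2 ^ 3 * o.2) := by
  have hd : DifferentiableAt ℝ (pdy (coshDist o)) p :=
    ((contDiffOn_pdy isOpen_H2 (contDiffOn_coshDist ho) (m := 1) (by norm_cast)).contDiffAt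
      (isOpen_H2.mem_nhds hp)).differentiableAt (by simp)
  have hp' : p.2 ≠ 0 := ne_of_gt hp
  have ho' : o.2 ≠ 0 := ne_of_gt ho
  refine pdy_eq_of_hasDerivAt hd ?_
  have h := (((hasDerivAt_pow 2 p.2).sub_const ((p.1 - o.1) ^ 2)).sub_const (o.2 ^ 2)).fun_div
    (((hasDerivAt_pow 2 p.2).const_mul 2).mul_const o.2) (by positivity)
  refine (h.congr_of_eventuallyEq ?_).congr_deriv ?_
  · filter_upwards [lt_mem_nhds (show (0 : ℝ) < p.2 from hp)] with t ht
    rw [pdy_coshDist (p := (p.1, t)) ho ht]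
  · simp; field_simp; ring

/-- Radial functions satisfying the hyperbolic eigenvalue equation. -/
structure Spherical (lam : ℝ) (f f₁ f₂ : ℝ → ℝ) : Prop where
  d₁ : ∀ C, 0 < C → HasDerivAt f (f₁ C) C
  d₂ : ∀ C, 0 < C → HasDerivAt f₁ (f₂ C) C
  cont : ContinuousOn f₂ (Ioi 0)
  bounds : ∀ C, 1 ≤ C → 0 < f C ∧ f C ≤ 1 ∧ f₁ C < 0 ∧ f₁ C ^ 2 * (C ^ 2 - 1) ≤ 1
  pos_one : 0 < f₂ 1
  ode : ∀ C, 0 < C → (C ^ 2 - 1) * f₂ C + 2 * C * f₁ C + lam * f C = 0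

/-- Positive bounded eigenfunctions on `H2` whose normal derivative is nonpositive along the
boundary of every domain star-shaped about all points of `Ω`. -/
structure Comparison (Ω : Set (ℝ × ℝ)) (lam : ℝ) (Ψ : ℝ × ℝ → ℝ) : Prop where
  smooth : ContDiffOn ℝ 2 Ψ H2
  eigen : ∀ x ∈ H2, pdx (pdx Ψ) x + pdy (pdy Ψ) x = -(lam * Ψ x / x.2 ^ 2)
  pos : ∀ x ∈ H2, 0 < Ψ x
  bdd : ∃ M, ∀ x ∈ H2, Ψ x ≤ M ∧ x.2 ^ 2 * gradSq Ψ x ≤ M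
  normal : ∀ q ∈ H2, ∀ ν, (∀ o ∈ Ω, 0 ≤ coshDistD o q ν) → fderiv ℝ Ψ q ν ≤ 0

section spherical

variable {lam : ℝ} {f f₁ f₂ : ℝ → ℝ} {o x : ℝ × ℝ}

lemma coshDist_pos (ho : o ∈ H2) (hx : x ∈ H2) : 0 < coshDist o x :=
  zero_lt_one.trans_le (one_le_coshDist ho hx)

lemma pdx_spherical (h : Spherical lam f f₁ f₂) (ho : o ∈ H2) (hx : x ∈ H2) :
    pdx (fun y => f (coshDist o y)) x = f₁ (coshDist o x) * pdx (coshDist o) x :=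
  pdx_comp (h.d₁ _ (coshDist_pos ho hx)) (hasFDerivAt_coshDist ho hx).differentiableAt

lemma pdy_spherical (h : Spherical lam f f₁ f₂) (ho : o ∈ H2) (hx : x ∈ H2) :
    pdy (fun y => f (coshDist o y)) x = f₁ (coshDist o x) * pdy (coshDist o) x :=
  pdy_comp (h.d₁ _ (coshDist_pos ho hx)) (hasFDerivAt_coshDist ho hx).differentiableAt

lemma pdx_pdx_spherical (h : Spherical lam f f₁ f₂) (ho : o ∈ H2) (hx : x ∈ H2) :
    pdx (pdx fun y => f (coshDist o y)) x =
      f₂ (coshDist o x) * pdx (coshDist o) x ^ 2 + f₁ (coshDist o x) * pdx (pdx (coshDist o)) x := by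
  have hC := (hasFDerivAt_coshDist ho hx).differentiableAt
  have hd : DifferentiableAt ℝ (pdx (coshDist o)) x :=
    ((contDiffOn_pdx isOpen_H2 (contDiffOn_coshDist ho) (m := 1) (by norm_cast)).contDiffAt
      (isOpen_H2.mem_nhds hx)).differentiableAt (by simp)
  have h2 := h.d₂ _ (coshDist_pos ho hx)
  have e : (pdx fun y => f (coshDist o y)) =ᶠ[𝓝 x]
      fun y => f₁ (coshDist o y) * pdx (coshDist o) y := by
    filter_upwards [isOpen_H2.mem_nhds hx] with y hy using pdx_spherical h ho hy
  rw [e.pdx_eq, pdx_mul (f := fun y => f₁ (coshDist o y))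
    (h2.comp_hasFDerivAt x hC.hasFDerivAt).differentiableAt hd, pdx_comp h2 hC]
  ring

lemma pdy_pdy_spherical (h : Spherical lam f f₁ f₂) (ho : o ∈ H2) (hx : x ∈ H2) :
    pdy (pdy fun y => f (coshDist o y)) x =
      f₂ (coshDist o x) * pdy (coshDist o) x ^ 2 + f₁ (coshDist o x) * pdy (pdy (coshDist o)) x := by
  have hC := (hasFDerivAt_coshDist ho hx).differentiableAt
  have hd : DifferentiableAt ℝ (pdy (coshDist o)) x :=
    ((contDiffOn_pdy isOpen_H2 (contDiffOn_coshDist ho) (m := 1) (by norm_cast)).contDiffAt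
      (isOpen_H2.mem_nhds hx)).differentiableAt (by simp)
  have h2 := h.d₂ _ (coshDist_pos ho hx)
  have e : (pdy fun y => f (coshDist o y)) =ᶠ[𝓝 x]
      fun y => f₁ (coshDist o y) * pdy (coshDist o) y := by
    filter_upwards [isOpen_H2.mem_nhds hx] with y hy using pdy_spherical h ho hy
  rw [e.pdy_eq, pdy_mul (f := fun y => f₁ (coshDist o y))
    (h2.comp_hasFDerivAt x hC.hasFDerivAt).differentiableAt hd, pdy_comp h2 hC]
  ring

lemma contDiffOn_two_of_hasDerivAt (h : Spherical lam f f₁ f₂) : ContDiffOn ℝ 2 f (Ioi 0) := by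
  have h1 : ContDiffOn ℝ 1 f₁ (Ioi 0) := by
    rw [show (1 : WithTop ℕ∞) = 0 + 1 by simp, contDiffOn_succ_iff_deriv_of_isOpen isOpen_Ioi]
    refine ⟨fun x hx => (h.d₂ x hx).differentiableAt.differentiableWithinAt, by simp, ?_⟩
    rw [contDiffOn_zero]
    exact h.cont.congr fun x hx => (h.d₂ x hx).deriv
  rw [show (2 : WithTop ℕ∞) = 1 + 1 by norm_num, contDiffOn_succ_iff_deriv_of_isOpen isOpen_Ioi]
  exact ⟨fun x hx => (h.d₁ x hx).differentiableAt.differentiableWithinAt, by simp,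
    h1.congr fun x hx => (h.d₁ x hx).deriv⟩

lemma Spherical.comparison (h : Spherical lam f f₁ f₂) {Ω : Set (ℝ × ℝ)} (hΩ : Ω ⊆ H2)
    (ho : o ∈ Ω) : Comparison Ω lam fun y => f (coshDist o y) := by
  have hoH := hΩ ho
  have ho' : (0 : ℝ) < o.2 := hoH
  have sq : ∀ x ∈ H2, x.2 ^ 2 * (pdx (coshDist o) x ^ 2 + pdy (coshDist o) x ^ 2) =
      coshDist o x ^ 2 - 1 := fun x hx => by
    rw [(hasFDerivAt_coshDist hoH hx).pdx_eq, (hasFDerivAt_coshDist hoH hx).pdy_eq]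
    exact sq_coshDistD hoH hx
  refine ⟨?_, fun x hx => ?_, fun x hx => ?_, ⟨1, fun x hx => ⟨?_, ?_⟩⟩, fun q hq ν hν => ?_⟩
  · exact (contDiffOn_two_of_hasDerivAt h).comp
      ((contDiffOn_coshDist hoH).of_le (by norm_cast))
      fun x hx => coshDist_pos hoH hx
  · have hx' : (0 : ℝ) < x.2 := hx
    rw [pdx_pdx_spherical h hoH hx, pdy_pdy_spherical h hoH hx, eq_comm, ← sub_eq_zero]
    have lap : x.2 ^ 2 * (pdx (pdx (coshDist o)) x + pdy (pdy (coshDist o)) x) =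
        2 * coshDist o x := by
      rw [pdx_pdx_coshDist hoH hx, pdy_pdy_coshDist hoH hx, coshDist]
      field_simp; ring
    have ode := h.ode _ (coshDist_pos hoH hx)
    have s := sq x hx
    field_simp
    linear_combination -ode + f₂ (coshDist o x) * (-s) - f₁ (coshDist o x) * lap
  · exact (h.bounds _ (one_le_coshDist hoH hx)).1
  · exact (h.bounds _ (one_le_coshDist hoH hx)).2.1
  · have := (h.bounds _ (one_le_coshDist hoH hx)).2.2.2
    rw [gradSq, pdx_spherical h hoH hx, pdy_spherical h hoH hx]
    rw [← sq x hx] at this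
    linarith
  · have hd : HasFDerivAt (fun y => f (coshDist o y)) (f₁ (coshDist o q) • coshDistD o q) q :=
      (h.d₁ _ (coshDist_pos hoH hq)).comp_hasFDerivAt q (hasFDerivAt_coshDist hoH hq)
    rw [hd.fderiv, smul_apply, smul_eq_mul]
    exact mul_nonpos_of_nonpos_of_nonneg (h.bounds _ (one_le_coshDist hoH hq)).2.2.1.le (hν o ho)

end spherical

namespace Comparison

variable {Ω : Set (ℝ × ℝ)} {lam : ℝ} {Ψ Φ : ℝ × ℝ → ℝ}

lemma diffAt (h : Comparison Ω lam Ψ) {x : ℝ × ℝ} (hx : x ∈ H2) : DifferentiableAt ℝ Ψ x :=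
  (h.smooth.contDiffAt (isOpen_H2.mem_nhds hx)).differentiableAt (by simp)

lemma diffAt_pdx (h : Comparison Ω lam Ψ) {x : ℝ × ℝ} (hx : x ∈ H2) :
    DifferentiableAt ℝ (pdx Ψ) x :=
  ((contDiffOn_pdx isOpen_H2 h.smooth (m := 1) (by norm_num)).contDiffAt
    (isOpen_H2.mem_nhds hx)).differentiableAt (by simp)

lemma diffAt_pdy (h : Comparison Ω lam Ψ) {x : ℝ × ℝ} (hx : x ∈ H2) :
    DifferentiableAt ℝ (pdy Ψ) x :=
  ((contDiffOn_pdy isOpen_H2 h.smooth (m := 1) (by norm_num)).contDiffAt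
    (isOpen_H2.mem_nhds hx)).differentiableAt (by simp)

lemma pdx_pdx_smul (h : Comparison Ω lam Ψ) (c : ℝ) {x : ℝ × ℝ} (hx : x ∈ H2) :
    pdx (pdx fun y => c * Ψ y) x = c * pdx (pdx Ψ) x := by
  have e : (pdx fun y => c * Ψ y) =ᶠ[𝓝 x] fun y => c * pdx Ψ y := by
    filter_upwards [isOpen_H2.mem_nhds hx] with y hy using pdx_const_mul c (h.diffAt hy)
  rw [e.pdx_eq, pdx_const_mul c (h.diffAt_pdx hx)]

lemma pdy_pdy_smul (h : Comparison Ω lam Ψ) (c : ℝ) {x : ℝ × ℝ} (hx : x ∈ H2) :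
    pdy (pdy fun y => c * Ψ y) x = c * pdy (pdy Ψ) x := by
  have e : (pdy fun y => c * Ψ y) =ᶠ[𝓝 x] fun y => c * pdy Ψ y := by
    filter_upwards [isOpen_H2.mem_nhds hx] with y hy using pdy_const_mul c (h.diffAt hy)
  rw [e.pdy_eq, pdy_const_mul c (h.diffAt_pdy hx)]

lemma pdx_pdx_add (h : Comparison Ω lam Ψ) (h' : Comparison Ω lam Φ) {x : ℝ × ℝ} (hx : x ∈ H2) :
    pdx (pdx fun y => Ψ y + Φ y) x = pdx (pdx Ψ) x + pdx (pdx Φ) x := by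
  have e : (pdx fun y => Ψ y + Φ y) =ᶠ[𝓝 x] fun y => pdx Ψ y + pdx Φ y := by
    filter_upwards [isOpen_H2.mem_nhds hx] with y hy using pdx_add (h.diffAt hy) (h'.diffAt hy)
  rw [e.pdx_eq, pdx_add (h.diffAt_pdx hx) (h'.diffAt_pdx hx)]

lemma pdy_pdy_add (h : Comparison Ω lam Ψ) (h' : Comparison Ω lam Φ) {x : ℝ × ℝ} (hx : x ∈ H2) :
    pdy (pdy fun y => Ψ y + Φ y) x = pdy (pdy Ψ) x + pdy (pdy Φ) x := by
  have e : (pdy fun y => Ψ y + Φ y) =ᶠ[𝓝 x] fun y => pdy Ψ y + pdy Φ y := by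
    filter_upwards [isOpen_H2.mem_nhds hx] with y hy using pdy_add (h.diffAt hy) (h'.diffAt hy)
  rw [e.pdy_eq, pdy_add (h.diffAt_pdy hx) (h'.diffAt_pdy hx)]

lemma smul (h : Comparison Ω lam Ψ) {c : ℝ} (hc : 0 < c) :
    Comparison Ω lam fun y => c * Ψ y := by
  obtain ⟨M, hM⟩ := h.bdd
  refine ⟨contDiffOn_const.mul h.smooth, fun x hx => ?_, fun x hx => mul_pos hc (h.pos x hx),
    ⟨max (c * M) (c ^ 2 * M), fun x hx => ⟨?_, ?_⟩⟩, fun q hq ν hν => ?_⟩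
  · rw [h.pdx_pdx_smul c hx, h.pdy_pdy_smul c hx, ← mul_add, h.eigen x hx]; ring
  · exact (mul_le_mul_of_nonneg_left (hM x hx).1 hc.le).trans (le_max_left _ _)
  · rw [gradSq, pdx_const_mul c (h.diffAt hx), pdy_const_mul c (h.diffAt hx)]
    refine le_trans (le_of_eq ?_)
      ((mul_le_mul_of_nonneg_left (hM x hx).2 (sq_nonneg c)).trans (le_max_right _ _))
    rw [gradSq]; ring
  · rw [((h.diffAt hq).hasFDerivAt.const_mul c).fderiv, smul_apply, smul_eq_mul]
    exact mul_nonpos_of_nonneg_of_nonpos hc.le (h.normal q hq ν hν)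

lemma add (h : Comparison Ω lam Ψ) (h' : Comparison Ω lam Φ) :
    Comparison Ω lam fun y => Ψ y + Φ y := by
  obtain ⟨M, hM⟩ := h.bdd
  obtain ⟨M', hM'⟩ := h'.bdd
  refine ⟨h.smooth.add h'.smooth, fun x hx => ?_,
    fun x hx => add_pos (h.pos x hx) (h'.pos x hx),
    ⟨max (M + M') (2 * M + 2 * M'), fun x hx => ⟨?_, ?_⟩⟩, fun q hq ν hν => ?_⟩
  · rw [h.pdx_pdx_add h' hx, h.pdy_pdy_add h' hx]
    linear_combination h.eigen x hx + h'.eigen x hx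
  · exact (add_le_add (hM x hx).1 (hM' x hx).1).trans (le_max_left _ _)
  · rw [gradSq, pdx_add (h.diffAt hx) (h'.diffAt hx), pdy_add (h.diffAt hx) (h'.diffAt hx)]
    refine le_trans ?_ (le_max_right _ _)
    have h1 := (hM x hx).2
    have h2 := (hM' x hx).2
    rw [gradSq] at h1 h2
    have : 0 ≤ x.2 ^ 2 * ((pdx Ψ x - pdx Φ x) ^ 2 + (pdy Ψ x - pdy Φ x) ^ 2) := by positivity
    linarith
  · rw [((h.diffAt hq).hasFDerivAt.fun_add (h'.diffAt hq).hasFDerivAt).fderiv, add_apply]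
    exact add_nonpos (h.normal q hq ν hν) (h'.normal q hq ν hν)

end Comparison

/-- At every point of `Ω` there are two comparison functions with the same positive value, a
critical point, and different second derivatives. -/
lemma exists_comparison_pair {Ω : Set (ℝ × ℝ)} (hΩ : Ω ⊆ H2) (hopen : IsOpen Ω) {lam : ℝ}
    (h0 : 0 < lam) (h1 : lam ≤ 1 / 4) {p : ℝ × ℝ} (hp : p ∈ Ω) {a : ℝ} (ha : 0 < a) :
    ∃ Ψ Φ : ℝ × ℝ → ℝ, (Comparison Ω lam Ψ ∧ Ψ p = a ∧ pdx Ψ p = 0 ∧ pdy Ψ p = 0) ∧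
      (Comparison Ω lam Φ ∧ Φ p = a ∧ pdx Φ p = 0 ∧ pdy Φ p = 0) ∧
      pdx (pdx Ψ) p ≠ pdx (pdx Φ) p := by
  obtain ⟨f, f₁, f₂, H⟩ := exists_spherical h0 h1
  have h : Spherical lam f f₁ f₂ := ⟨H.1, H.2.1, H.2.2.1, H.2.2.2.1, H.2.2.2.2.1, H.2.2.2.2.2⟩
  have hpH := hΩ hp
  have hp2 : (0 : ℝ) < p.2 := hpH
  obtain ⟨k, hk1, hkΩ, hkΩ', hkf⟩ : ∃ k : ℝ, 1 < k ∧ (p.1, p.2 * k) ∈ Ω ∧ (p.1, p.2 / k) ∈ Ω ∧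
      0 < f₂ ((k + 1 / k) / 2) := by
    have c1 : ContinuousAt (fun k : ℝ => (p.1, p.2 * k)) 1 := by fun_prop
    have c2 : ContinuousAt (fun k : ℝ => (p.1, p.2 / k)) 1 :=
      continuousAt_const.prodMk (continuousAt_const.div continuousAt_id one_ne_zero)
    have c3 : ContinuousAt (fun k : ℝ => (k + 1 / k) / 2) 1 :=
      (continuousAt_id.add (continuousAt_const.div continuousAt_id one_ne_zero)).div_const 2
    have e3 : ((1 : ℝ) + 1 / 1) / 2 = 1 := by norm_num
    have c4 : ContinuousAt (fun k : ℝ => f₂ ((k + 1 / k) / 2)) 1 :=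
      ContinuousAt.comp (g := f₂)
        (by rw [e3]; exact h.cont.continuousAt (Ioi_mem_nhds one_pos)) c3
    have m1 := c1.preimage_mem_nhds (by simpa using hopen.mem_nhds hp)
    have m2 := c2.preimage_mem_nhds (by simpa using hopen.mem_nhds hp)
    have m4 := c4.preimage_mem_nhds (Ioi_mem_nhds (by rw [e3]; exact h.pos_one))
    have ev : ∀ᶠ k in 𝓝[>] (1 : ℝ), 1 < k ∧ (p.1, p.2 * k) ∈ Ω ∧ (p.1, p.2 / k) ∈ Ω ∧
        0 < f₂ ((k + 1 / k) / 2) := by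
      filter_upwards [self_mem_nhdsWithin, nhdsWithin_le_nhds m1, nhdsWithin_le_nhds m2,
        nhdsWithin_le_nhds m4] with k a1 a2 a3 a4 using ⟨a1, a2, a3, a4⟩
    exact ev.exists
  have hk0 : 0 < k := by linarith
  set C : ℝ := (k + 1 / k) / 2 with hC
  have hC1 : 1 < C := by
    rw [hC]; rw [lt_div_iff₀ two_pos, ← sub_pos]
    have : k + 1 / k - 1 * 2 = (k - 1) ^ 2 / k := by field_simp; ring
    rw [this]
    have : 0 < k - 1 := by linarith
    positivity
  set q : ℝ × ℝ := (p.1, p.2 * k) with hq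
  set q' : ℝ × ℝ := (p.1, p.2 / k) with hq'
  have eq1 : coshDist q p = C := by
    simp only [coshDist, hq, hC]; field_simp; ring
  have eq2 : coshDist q' p = C := by
    simp only [coshDist, hq', hC]; field_simp; ring
  have eq0 : coshDist p p = 1 := by
    simp only [coshDist]; field_simp; ring
  have hfC := (h.bounds C hC1.le).1
  have hf1 := (h.bounds 1 le_rfl).1
  have k0 := h.comparison hΩ hp
  have k1 := h.comparison hΩ hkΩ
  have k2 := h.comparison hΩ hkΩ'
  have kk := k1.add k2
  refine ⟨_, _, ⟨k0.smul (c := a / f 1) (by positivity), ?_, ?_, ?_⟩,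
    ⟨kk.smul (c := a / (2 * f C)) (by positivity), ?_, ?_, ?_⟩, ?_⟩
  · simp only [eq0]; field_simp
  · rw [pdx_const_mul _ (k0.diffAt hpH), pdx_spherical h hpH hpH, pdx_coshDist hpH hpH]; simp
  · rw [pdy_const_mul _ (k0.diffAt hpH), pdy_spherical h hpH hpH, pdy_coshDist hpH hpH]; simp
  · simp only [eq1, eq2]; field_simp; ring
  · rw [pdx_const_mul _ (kk.diffAt hpH), pdx_add (k1.diffAt hpH) (k2.diffAt hpH),
      pdx_spherical h (hΩ hkΩ) hpH, pdx_spherical h (hΩ hkΩ') hpH, pdx_coshDist (hΩ hkΩ) hpH,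
      pdx_coshDist (hΩ hkΩ') hpH]
    simp [hq, hq']
  · rw [pdy_const_mul _ (kk.diffAt hpH), pdy_add (k1.diffAt hpH) (k2.diffAt hpH),
      pdy_spherical h (hΩ hkΩ) hpH, pdy_spherical h (hΩ hkΩ') hpH, pdy_coshDist (hΩ hkΩ) hpH,
      pdy_coshDist (hΩ hkΩ') hpH, eq1, eq2]
    simp only [hq, hq']
    field_simp; ring
  · have ode1 := h.ode 1 one_pos
    have odeC := h.ode C (by linarith)
    rw [k0.pdx_pdx_smul _ hpH, kk.pdx_pdx_smul _ hpH, k1.pdx_pdx_add k2 hpH,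
      pdx_pdx_spherical h hpH hpH, pdx_pdx_spherical h (hΩ hkΩ) hpH,
      pdx_pdx_spherical h (hΩ hkΩ') hpH, pdx_coshDist hpH hpH, pdx_coshDist (hΩ hkΩ) hpH,
      pdx_coshDist (hΩ hkΩ') hpH, pdx_pdx_coshDist hpH hpH, pdx_pdx_coshDist (hΩ hkΩ) hpH,
      pdx_pdx_coshDist (hΩ hkΩ') hpH, eq0, eq1, eq2]
    have e1 : a / f 1 * (f₂ 1 * ((p.1 - p.1) / (p.2 * p.2)) ^ 2 + f₁ 1 * (1 / (p.2 * p.2))) =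
        -(a * lam / (2 * p.2 ^ 2)) := by
      have : f₁ 1 = -(lam * f 1) / 2 := by linarith
      rw [this]; simp; field_simp
    have e2 : a / (2 * f C) * (f₂ C * ((p.1 - q.1) / (p.2 * q.2)) ^ 2 + f₁ C * (1 / (p.2 * q.2)) +
        (f₂ C * ((p.1 - q'.1) / (p.2 * q'.2)) ^ 2 + f₁ C * (1 / (p.2 * q'.2)))) =
        a * (2 * C * f₁ C) / (2 * f C * p.2 ^ 2) := by
      simp only [hq, hq', hC, sub_self]; field_simp; ring
    rw [e1, e2]
    intro e
    have e' : 2 * C * f₁ C = -(lam * f C) := by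
      field_simp at e
      linarith
    rw [e'] at odeC
    have : 0 < (C ^ 2 - 1) * f₂ C := mul_pos (by nlinarith) hkf
    linarith

/-! ### Energy estimate on a component where `u` lies below a comparison function -/

section indicatorSq

variable {Ω W : Set (ℝ × ℝ)} {w : ℝ × ℝ → ℝ}

/-- If `w` vanishes on the part of the boundary of `W` inside `Ω`, then the square of `w`, cut off
to `W`, is differentiable. -/
lemma hasFDerivAt_indicator_sq (hW : IsOpen W)
    (hw : ∀ x ∈ Ω, DifferentiableAt ℝ w x) (hfr : ∀ x ∈ Ω, x ∈ closure W → x ∉ W → w x = 0)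
    {x : ℝ × ℝ} (hx : x ∈ Ω) :
    HasFDerivAt (W.indicator fun y => w y ^ 2)
      (W.indicator (fun y => (2 * w y) • fderiv ℝ w y) x) x := by
  by_cases hxW : x ∈ W
  · rw [indicator_of_mem hxW]
    have h := ((hw x hx).hasFDerivAt.pow 2).congr_of_eventuallyEq
      (f₁ := W.indicator fun y => w y ^ 2)
      (by filter_upwards [hW.mem_nhds hxW] with y hy; rw [indicator_of_mem hy])
    refine h.congr_fderiv ?_
    simp
  · rw [indicator_of_notMem hxW]
    by_cases hxc : x ∈ closure W
    · have h0 := hfr x hx hxc hxW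
      have h2 : HasFDerivAt (fun y => w y ^ 2) (0 : ℝ × ℝ →L[ℝ] ℝ) x := by
        have h := (hw x hx).hasFDerivAt.pow 2
        simpa [h0] using h
      rw [hasFDerivAt_iff_isLittleO] at h2 ⊢
      refine Asymptotics.IsLittleO.of_norm_left (Asymptotics.IsBigO.trans_isLittleO ?_ h2)
      refine Asymptotics.isBigO_of_le _ fun y => ?_
      rw [norm_norm]
      simp only [indicator_of_notMem hxW, h0, zero_apply, sub_zero, ne_eq, OfNat.ofNat_ne_zero,
        not_false_eq_true, zero_pow]
      exact norm_indicator_le_norm_self _ _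
    · refine (hasFDerivAt_const (0 : ℝ) x).congr_of_eventuallyEq ?_
      filter_upwards [isClosed_closure.isOpen_compl.mem_nhds hxc] with y hy
      exact indicator_of_notMem (fun h => hy (subset_closure h)) _

lemma continuousOn_indicator_of_frontier {E : Type*} [NormedAddCommGroup E] {F : ℝ × ℝ → E}
    (hΩ : IsOpen Ω) (hW : IsOpen W)
    (hF : ContinuousOn F Ω) (hfr : ∀ x ∈ Ω, x ∈ closure W → x ∉ W → F x = 0) :
    ContinuousOn (W.indicator F) Ω := by
  intro x hx
  have hc := hF.continuousAt (hΩ.mem_nhds hx)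
  refine ContinuousAt.continuousWithinAt ?_
  by_cases hxW : x ∈ W
  · refine hc.congr ?_
    filter_upwards [hW.mem_nhds hxW] with y hy
    rw [indicator_of_mem hy]
  · by_cases hxc : x ∈ closure W
    · have h0 := hfr x hx hxc hxW
      rw [ContinuousAt, indicator_of_notMem hxW]
      rw [ContinuousAt, h0] at hc
      exact squeeze_zero_norm (fun y => norm_indicator_le_norm_self _ _) (by simpa using hc.norm)
    · refine (continuousAt_const (y := (0 : E))).congr ?_
      filter_upwards [isClosed_closure.isOpen_compl.mem_nhds hxc] with y hy
      exact (indicator_of_notMem (fun h => hy (subset_closure h)) _).symm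

lemma contDiffOn_indicator_sq (hΩ : IsOpen Ω) (hW : IsOpen W) (hw : ContDiffOn ℝ 1 w Ω)
    (hfr : ∀ x ∈ Ω, x ∈ closure W → x ∉ W → w x = 0) :
    ContDiffOn ℝ 1 (W.indicator fun y => w y ^ 2) Ω := by
  have hd : ∀ x ∈ Ω, DifferentiableAt ℝ w x := fun x hx =>
    (hw.contDiffAt (hΩ.mem_nhds hx)).differentiableAt (by simp)
  rw [show (1 : WithTop ℕ∞) = 0 + 1 by simp, contDiffOn_succ_iff_fderiv_of_isOpen hΩ]
  refine ⟨fun x hx =>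
    (hasFDerivAt_indicator_sq hW hd hfr hx).differentiableAt.differentiableWithinAt,
    by simp, ?_⟩
  rw [contDiffOn_zero]
  refine ContinuousOn.congr (f := W.indicator (fun y => (2 * w y) • fderiv ℝ w y)) ?_
    fun x hx => (hasFDerivAt_indicator_sq hW hd hfr hx).fderiv
  refine continuousOn_indicator_of_frontier hΩ hW ?_ fun x hx hxc hxW => ?_
  · exact (continuousOn_const.mul hw.continuousOn).smul
      (hw.continuousOn_fderiv_of_isOpen hΩ le_rfl)
  · simp [hfr x hx hxc hxW]

end indicatorSq

section ratio

variable {Ω D : Set (ℝ × ℝ)} {lam : ℝ} {u Ψ : ℝ × ℝ → ℝ}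

lemma MixedEigen.contDiffOn_ratio (h : MixedEigen Ω D lam u) (hΨ : Comparison Ω lam Ψ) :
    ContDiffOn ℝ 1 (fun x => u x / Ψ x) Ω :=
  (h.smooth.of_le (by norm_cast)).div
    ((hΨ.smooth.mono h.subH).of_le (by norm_num)) fun x hx => (hΨ.pos x (h.subH hx)).ne'

lemma MixedEigen.pdx_ratio (h : MixedEigen Ω D lam u) (hΨ : Comparison Ω lam Ψ) {x : ℝ × ℝ}
    (hx : x ∈ Ω) : Ψ x ^ 2 * pdx (fun y => u y / Ψ y) x = Ψ x * pdx u x - u x * pdx Ψ x := by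
  have hp := hΨ.pos x (h.subH hx)
  have hg := ((h.contDiffOn_ratio hΨ).contDiffAt (h.contAt hx)).differentiableAt (by simp)
  have e : (fun y => u y / Ψ y * Ψ y) =ᶠ[𝓝 x] u := by
    filter_upwards [h.contAt hx] with y hy
    exact div_mul_cancel₀ _ (hΨ.pos y (h.subH hy)).ne'
  have := pdx_mul hg (hΨ.diffAt (h.subH hx))
  rw [e.pdx_eq] at this
  rw [this]; field_simp; ring

lemma MixedEigen.pdy_ratio (h : MixedEigen Ω D lam u) (hΨ : Comparison Ω lam Ψ) {x : ℝ × ℝ}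
    (hx : x ∈ Ω) : Ψ x ^ 2 * pdy (fun y => u y / Ψ y) x = Ψ x * pdy u x - u x * pdy Ψ x := by
  have hp := hΨ.pos x (h.subH hx)
  have hg := ((h.contDiffOn_ratio hΨ).contDiffAt (h.contAt hx)).differentiableAt (by simp)
  have e : (fun y => u y / Ψ y * Ψ y) =ᶠ[𝓝 x] u := by
    filter_upwards [h.contAt hx] with y hy
    exact div_mul_cancel₀ _ (hΨ.pos y (h.subH hy)).ne'
  have := pdy_mul hg (hΨ.diffAt (h.subH hx))
  rw [e.pdy_eq] at this
  rw [this]; field_simp; ring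

/-- The Wronskian field of `u` and a comparison function is continuously differentiable and
divergence free. -/
lemma MixedEigen.wronskian (h : MixedEigen Ω D lam u) (hΨ : Comparison Ω lam Ψ) :
    ContDiffOn ℝ 1 (fun x => Ψ x * pdx u x - u x * pdx Ψ x) Ω ∧
    ContDiffOn ℝ 1 (fun x => Ψ x * pdy u x - u x * pdy Ψ x) Ω ∧
    ∀ x ∈ Ω, pdx (fun x => Ψ x * pdx u x - u x * pdx Ψ x) x +
      pdy (fun x => Ψ x * pdy u x - u x * pdy Ψ x) x = 0 := by
  have u1 : ContDiffOn ℝ 1 u Ω := h.smooth.of_le (by norm_cast)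
  have ux : ContDiffOn ℝ 1 (pdx u) Ω := contDiffOn_pdx h.isOpen h.smooth (m := 1) (by norm_cast)
  have uy : ContDiffOn ℝ 1 (pdy u) Ω := contDiffOn_pdy h.isOpen h.smooth (m := 1) (by norm_cast)
  have P1 : ContDiffOn ℝ 1 Ψ Ω := (hΨ.smooth.mono h.subH).of_le (by norm_num)
  have Px : ContDiffOn ℝ 1 (pdx Ψ) Ω :=
    (contDiffOn_pdx isOpen_H2 hΨ.smooth (m := 1) (by norm_num)).mono h.subH
  have Py : ContDiffOn ℝ 1 (pdy Ψ) Ω :=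
    (contDiffOn_pdy isOpen_H2 hΨ.smooth (m := 1) (by norm_num)).mono h.subH
  refine ⟨(P1.mul ux).sub (u1.mul Px), (P1.mul uy).sub (u1.mul Py), fun x hx => ?_⟩
  have d : ∀ {F : ℝ × ℝ → ℝ}, ContDiffOn ℝ 1 F Ω → DifferentiableAt ℝ F x := fun hF =>
    (hF.contDiffAt (h.contAt hx)).differentiableAt (by simp)
  rw [pdx_sub (d (P1.mul ux)) (d (u1.mul Px)), pdy_sub (d (P1.mul uy)) (d (u1.mul Py)),
    pdx_mul (d P1) (d ux), pdx_mul (d u1) (d Px), pdy_mul (d P1) (d uy), pdy_mul (d u1) (d Py)]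
  linear_combination Ψ x * h.laplace hx - u x * hΨ.eigen x (h.subH hx)

end ratio

/-- On an open set `W` away from `D` where `u` lies below a comparison function, with equality on
the boundary inside `Ω`, the ratio of both functions has no gradient. -/
theorem MixedEigen.ratio_critical {Ω D : Set (ℝ × ℝ)} {lam : ℝ} {u Ψ : ℝ × ℝ → ℝ}
    (h : MixedEigen Ω D lam u) (hpos : ∀ x ∈ Ω, 0 < u x) (hΨ : Comparison Ω lam Ψ)
    {W V : Set (ℝ × ℝ)} (hW : IsOpen W) (hWΩ : W ⊆ Ω) (hlt : ∀ x ∈ W, u x < Ψ x)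
    (hfr : ∀ x ∈ Ω, x ∈ closure W → x ∉ W → u x = Ψ x) (hV : IsOpen V) (hDV : D ⊆ V)
    (hVW : Disjoint V W) :
    ∀ x ∈ W, pdx (fun y => u y / Ψ y) x = 0 ∧ pdy (fun y => u y / Ψ y) x = 0 := by
  obtain ⟨o, hoΩ⟩ := h.ne
  have ho := h.subH hoΩ
  obtain ⟨M, hM⟩ := hΨ.bdd
  obtain ⟨M₀, hM₀, hcut⟩ := exists_gradSq_cutoff_le ho
  set g : ℝ × ℝ → ℝ := fun y => u y / Ψ y with hg
  have hgC := h.contDiffOn_ratio hΨ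
  obtain ⟨L1C, L2C, hdiv⟩ := h.wronskian hΨ
  have gx : ∀ x ∈ Ω, Ψ x ^ 2 * pdx g x = Ψ x * pdx u x - u x * pdx Ψ x :=
    fun x hx => h.pdx_ratio hΨ hx
  have gy : ∀ x ∈ Ω, Ψ x ^ 2 * pdy g x = Ψ x * pdy u x - u x * pdy Ψ x :=
    fun x hx => h.pdy_ratio hΨ hx
  have bd := fun v => h.continuousOn_bd v
  set S := closure Ω ∩ H2 with hS
  have hSΩ : Ω ⊆ S := fun x hx => ⟨subset_closure hx, h.subH hx⟩
  set L₁ : ℝ × ℝ → ℝ := fun x => Ψ x * pdx u x - u x * pdx Ψ x with hL₁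
  set L₂ : ℝ × ℝ → ℝ := fun x => Ψ x * pdy u x - u x * pdy Ψ x with hL₂
  set K₁ : ℝ × ℝ → ℝ := fun q => Ψ q * fderivWithin ℝ u S q (1, 0) - u q * pdx Ψ q with hK₁
  set K₂ : ℝ × ℝ → ℝ := fun q => Ψ q * fderivWithin ℝ u S q (0, 1) - u q * pdy Ψ q with hK₂
  have e₁ : ∀ x ∈ Ω, K₁ x = L₁ x := fun x hx => by
    simp only [hK₁, hL₁, hS, h.fderivWithin_eq hx]; rfl
  have e₂ : ∀ x ∈ Ω, K₂ x = L₂ x := fun x hx => by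
    simp only [hK₂, hL₂, hS, h.fderivWithin_eq hx]; rfl
  set w : ℝ × ℝ → ℝ := fun x => 1 - g x with hw
  have hwC : ContDiffOn ℝ 1 w Ω := contDiffOn_const.sub hgC
  have hw0 : ∀ x ∈ Ω, x ∈ closure W → x ∉ W → w x = 0 := fun x hx h1 h2 => by
    simp only [hw, hg, hfr x hx h1 h2, div_self (hΨ.pos x (h.subH hx)).ne', sub_self]
  have hwpos : ∀ x ∈ W, 0 < w x := fun x hx => by
    simp only [hw, hg, sub_pos, div_lt_one (hΨ.pos x (h.subH (hWΩ hx))), hlt x hx]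
  have hwle : ∀ x ∈ Ω, w x ≤ 1 := fun x hx => by
    have := div_pos (hpos x hx) (hΨ.pos x (h.subH hx))
    simp only [hw, hg]; linarith
  have dg : ∀ x ∈ Ω, DifferentiableAt ℝ g x := fun x hx =>
    (hgC.contDiffAt (h.contAt hx)).differentiableAt (by simp)
  have dw : ∀ x ∈ Ω, DifferentiableAt ℝ w x := fun x hx =>
    (hwC.contDiffAt (h.contAt hx)).differentiableAt (by simp)
  set η₀ : ℝ × ℝ → ℝ := W.indicator fun y => w y ^ 2 with hη₀
  have hη₀C : ContDiffOn ℝ 1 η₀ Ω := contDiffOn_indicator_sq h.isOpen hW hwC hw0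
  have η₀nn : ∀ x, 0 ≤ η₀ x := fun x => indicator_nonneg (fun y _ => sq_nonneg _) x
  have η₀le : ∀ x, η₀ x ≤ 1 := fun x => by
    by_cases hx : x ∈ W
    · rw [hη₀, indicator_of_mem hx]
      exact pow_le_one₀ (hwpos x hx).le (hwle x (hWΩ hx))
    · rw [hη₀, indicator_of_notMem hx]; exact zero_le_one
  have dη₀ : ∀ x ∈ Ω, ∀ v, fderiv ℝ η₀ x v = W.indicator (fun y => -(2 * w y * fderiv ℝ g y v)) x := by
    intro x hx v
    rw [(hasFDerivAt_indicator_sq hW dw hw0 hx).fderiv]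
    by_cases hxW : x ∈ W
    · rw [indicator_of_mem hxW, indicator_of_mem hxW]
      have : fderiv ℝ w x = -fderiv ℝ g x := by
        rw [hw, fderiv_const_sub]
      rw [this]; simp
    · rw [indicator_of_notMem hxW, indicator_of_notMem hxW]; simp
  set J : ℝ × ℝ → ℝ := W.indicator fun y => 2 * w y * (L₁ y * pdx g y + L₂ y * pdy g y) with hJ
  have gxC : ContinuousOn (pdx g) Ω :=
    (contDiffOn_pdx h.isOpen hgC (m := 0) (by simp)).continuousOn
  have gyC : ContinuousOn (pdy g) Ω :=
    (contDiffOn_pdy h.isOpen hgC (m := 0) (by simp)).continuousOn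
  have hJC : ContinuousOn J Ω := by
    refine continuousOn_indicator_of_frontier h.isOpen hW ?_ fun x hx h1 h2 => by
      simp [hw0 x hx h1 h2]
    exact (continuousOn_const.mul hwC.continuousOn).mul
      ((L1C.continuousOn.mul gxC).add (L2C.continuousOn.mul gyC))
  have hJW : ∀ x ∈ W, J x = 2 * w x * (Ψ x ^ 2 * (pdx g x ^ 2 + pdy g x ^ 2)) := fun x hx => by
    rw [hJ, indicator_of_mem hx]
    have a := gx x (hWΩ hx)
    have b := gy x (hWΩ hx)
    simp only [hL₁, hL₂, ← a, ← b]
    ring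
  have hJnn : ∀ x ∈ Ω, 0 ≤ J x := fun x hx => by
    by_cases hxW : x ∈ W
    · rw [hJW x hxW]
      have := hwpos x hxW
      positivity
    · rw [hJ, indicator_of_notMem hxW]
  set B : ℝ × ℝ → ℝ := fun x => 4 * gradSq u x + 4 * M * (1 / x.2 ^ 2) with hB
  have hBint : IntegrableOn B Ω := (h.h1.const_mul 4).add (h.area.const_mul (4 * M))
  have hM0 : 0 ≤ M := (hΨ.pos o ho).le.trans (hM o ho).1
  have gradΨ : ∀ x ∈ Ω, gradSq Ψ x ≤ M * (1 / x.2 ^ 2) := fun x hx => by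
    have hx2 : (0 : ℝ) < x.2 := h.subH hx
    have := (hM x (h.subH hx)).2
    rw [mul_one_div, le_div_iff₀ (by positivity)]; linarith
  have hBnn : ∀ x ∈ Ω, 0 ≤ B x := fun x hx => by
    simp only [hB, gradSq]; positivity
  have hJB : ∀ x ∈ Ω, |J x| ≤ B x := fun x hx => by
    rw [abs_of_nonneg (hJnn x hx)]
    by_cases hxW : x ∈ W
    · have hΨp := hΨ.pos x (h.subH hx)
      have hxx := gx x hx
      have hyy := gy x hx
      have w0 := hwpos x hxW
      have w1 := hwle x hx
      have ux := hpos x hx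
      have ul := hlt x hxW
      have gΨ := gradΨ x hx
      have ax : Ψ x * pdx g x = pdx u x - g x * pdx Ψ x := by
        have : Ψ x * (Ψ x * pdx g x) = Ψ x * (pdx u x - g x * pdx Ψ x) := by
          have : Ψ x * g x = u x := mul_div_cancel₀ _ hΨp.ne'
          linear_combination hxx + pdx Ψ x * this
        exact mul_left_cancel₀ hΨp.ne' this
      have ay : Ψ x * pdy g x = pdy u x - g x * pdy Ψ x := by
        have : Ψ x * (Ψ x * pdy g x) = Ψ x * (pdy u x - g x * pdy Ψ x) := by
          have : Ψ x * g x = u x := mul_div_cancel₀ _ hΨp.ne'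
          linear_combination hyy + pdy Ψ x * this
        exact mul_left_cancel₀ hΨp.ne' this
      have g0 : 0 ≤ g x := div_nonneg ux.le hΨp.le
      have g1 : g x ≤ 1 := by linarith [show w x = 1 - g x from rfl]
      have g2 : g x ^ 2 ≤ 1 := pow_le_one₀ g0 g1
      rw [hJW x hxW]
      have e : Ψ x ^ 2 * (pdx g x ^ 2 + pdy g x ^ 2) =
          (pdx u x - g x * pdx Ψ x) ^ 2 + (pdy u x - g x * pdy Ψ x) ^ 2 := by
        rw [← ax, ← ay]; ring
      have b : (pdx u x - g x * pdx Ψ x) ^ 2 + (pdy u x - g x * pdy Ψ x) ^ 2 ≤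
          2 * gradSq u x + 2 * gradSq Ψ x := by
        have : g x ^ 2 * gradSq Ψ x ≤ 1 * gradSq Ψ x :=
          mul_le_mul_of_nonneg_right g2 (by rw [gradSq]; positivity)
        simp only [gradSq] at this ⊢
        nlinarith [sq_nonneg (pdx u x + g x * pdx Ψ x), sq_nonneg (pdy u x + g x * pdy Ψ x)]
      rw [e]
      have nn : 0 ≤ (pdx u x - g x * pdx Ψ x) ^ 2 + (pdy u x - g x * pdy Ψ x) ^ 2 := by positivity
      simp only [hB]
      nlinarith
    · rw [hJ, indicator_of_notMem hxW]; exact hBnn x hx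
  set G : ℝ × ℝ → ℝ := fun x => M₀ ^ 2 / 2 * (1 / x.2 ^ 2) + M ^ 2 * gradSq u x
    + M * (u x ^ 2 / x.2 ^ 2) with hG
  have hGint : IntegrableOn G Ω :=
    ((h.area.const_mul (M₀ ^ 2 / 2)).add (h.h1.const_mul (M ^ 2))).add (h.l2.const_mul M)
  have hJint : IntegrableOn J Ω := integrableOn_of_abs_le h.isOpen hJC hBint hJB
  have key : ∀ n : ℕ, ∫ x in Ω, cutoff o n x * J x ≤ 1 / ((n : ℝ) + 1) * ∫ x in Ω, G x := by
    intro n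
    have hn : (0 : ℝ) < (n : ℝ) + 1 := by positivity
    have χC : ContDiffOn ℝ 1 (cutoff o n) Ω :=
      ((contDiffOn_cutoff ho).mono h.subH).of_le (by norm_cast)
    have dχ : ∀ x ∈ Ω, DifferentiableAt ℝ (cutoff o n) x := fun x hx =>
      (χC.contDiffAt (h.contAt hx)).differentiableAt (by simp)
    have dη : ∀ x ∈ Ω, DifferentiableAt ℝ η₀ x := fun x hx =>
      (hη₀C.contDiffAt (h.contAt hx)).differentiableAt (by simp)
    set R : ℝ × ℝ → ℝ := fun x =>
      η₀ x * (pdx (cutoff o n) x * L₁ x + pdy (cutoff o n) x * L₂ x) with hR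
    have hRC : ContinuousOn R Ω := hη₀C.continuousOn.mul
      (((contDiffOn_pdx h.isOpen χC (m := 0) (by simp)).continuousOn.mul L1C.continuousOn).add
        ((contDiffOn_pdy h.isOpen χC (m := 0) (by simp)).continuousOn.mul L2C.continuousOn))
    have hRG : ∀ x ∈ Ω, |R x| ≤ 1 / ((n : ℝ) + 1) * G x := by
      intro x hx
      have hx2 : (0 : ℝ) < x.2 := h.subH hx
      have c := hcut n x (h.subH hx)
      have gΨ := gradΨ x hx
      have Ψ1 := (hM x (h.subH hx)).1
      have Ψ0 := hΨ.pos x (h.subH hx)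
      have hΨM : Ψ x ^ 2 ≤ M ^ 2 := pow_le_pow_left₀ Ψ0.le Ψ1 2
      have l : L₁ x ^ 2 + L₂ x ^ 2 ≤ 2 * (M ^ 2 * gradSq u x) + 2 * (M * (u x ^ 2 / x.2 ^ 2)) := by
        have a1 : L₁ x ^ 2 + L₂ x ^ 2 ≤ 2 * (Ψ x ^ 2 * gradSq u x) + 2 * (u x ^ 2 * gradSq Ψ x) := by
          simp only [hL₁, hL₂, gradSq]
          nlinarith [sq_nonneg (Ψ x * pdx u x + u x * pdx Ψ x),
            sq_nonneg (Ψ x * pdy u x + u x * pdy Ψ x)]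
        have a2 : Ψ x ^ 2 * gradSq u x ≤ M ^ 2 * gradSq u x :=
          mul_le_mul_of_nonneg_right hΨM (by rw [gradSq]; positivity)
        have a3 : u x ^ 2 * gradSq Ψ x ≤ u x ^ 2 * (M * (1 / x.2 ^ 2)) :=
          mul_le_mul_of_nonneg_left gΨ (sq_nonneg _)
        have a4 : u x ^ 2 * (M * (1 / x.2 ^ 2)) = M * (u x ^ 2 / x.2 ^ 2) := by ring
        linarith
      have cs : |pdx (cutoff o n) x * L₁ x + pdy (cutoff o n) x * L₂ x| ≤
          ((n + 1) * gradSq (cutoff o n) x + (L₁ x ^ 2 + L₂ x ^ 2) / (n + 1)) / 2 := by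
        have hh : ∀ a b : ℝ, |a * b| ≤ ((n + 1) * a ^ 2 + b ^ 2 / (n + 1)) / 2 := fun a b => by
          rw [abs_mul, ← sq_abs a, ← sq_abs b]
          have : ((n + 1) * |a| ^ 2 + |b| ^ 2 / (n + 1)) / 2 - |a| * |b| =
              ((n + 1) * |a| - |b|) ^ 2 / (2 * (n + 1)) := by field_simp; ring
          have p : 0 ≤ ((n + 1) * |a| - |b|) ^ 2 / (2 * ((n : ℝ) + 1)) := by positivity
          linarith
        refine (abs_add_le _ _).trans ((add_le_add (hh _ _) (hh _ _)).trans (le_of_eq ?_))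
        rw [gradSq]; ring
      have c' : ((n : ℝ) + 1) * gradSq (cutoff o n) x ≤ M₀ ^ 2 * (1 / x.2 ^ 2) / (n + 1) := by
        refine (mul_le_mul_of_nonneg_left c hn.le).trans (le_of_eq ?_)
        field_simp
      simp only [hR]
      rw [abs_mul, abs_of_nonneg (η₀nn x)]
      refine (mul_le_of_le_one_left (abs_nonneg _) (η₀le x)).trans (cs.trans ?_)
      have : 1 / ((n : ℝ) + 1) * G x = (M₀ ^ 2 * (1 / x.2 ^ 2) / (n + 1) +
          (2 * (M ^ 2 * gradSq u x) + 2 * (M * (u x ^ 2 / x.2 ^ 2))) / (n + 1)) / 2 := by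
        simp only [hG]; ring
      rw [this]
      gcongr
    have hRint : IntegrableOn R Ω :=
      integrableOn_of_abs_le h.isOpen hRC (hGint.const_mul _) hRG
    have hχJint : IntegrableOn (fun x => cutoff o n x * J x) Ω := by
      refine integrableOn_of_abs_le h.isOpen (χC.continuousOn.mul hJC) hBint fun x hx => ?_
      rw [abs_mul, abs_of_nonneg (cutoff_nonneg x)]
      exact (mul_le_of_le_one_left (abs_nonneg _) (cutoff_le_one x)).trans (hJB x hx)
    have divE : ∀ x ∈ Ω, pdx (fun y => cutoff o n y * η₀ y * K₁ y) x +
        pdy (fun y => cutoff o n y * η₀ y * K₂ y) x = R x - cutoff o n x * J x := by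
      intro x hx
      have E1 : (fun y => cutoff o n y * η₀ y * K₁ y) =ᶠ[𝓝 x]
          fun y => cutoff o n y * η₀ y * L₁ y := by
        filter_upwards [h.contAt hx] with y hy; rw [e₁ y hy]
      have E2 : (fun y => cutoff o n y * η₀ y * K₂ y) =ᶠ[𝓝 x]
          fun y => cutoff o n y * η₀ y * L₂ y := by
        filter_upwards [h.contAt hx] with y hy; rw [e₂ y hy]
      have dL1 : DifferentiableAt ℝ L₁ x := (L1C.contDiffAt (h.contAt hx)).differentiableAt (by simp)
      have dL2 : DifferentiableAt ℝ L₂ x := (L2C.contDiffAt (h.contAt hx)).differentiableAt (by simp)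
      have dp := (dχ x hx).fun_mul (dη x hx)
      rw [E1.pdx_eq, E2.pdy_eq, pdx_mul dp dL1, pdy_mul dp dL2, pdx_mul (dχ x hx) (dη x hx),
        pdy_mul (dχ x hx) (dη x hx)]
      have a1 : pdx η₀ x = W.indicator (fun y => -(2 * w y * pdx g y)) x := dη₀ x hx _
      have a2 : pdy η₀ x = W.indicator (fun y => -(2 * w y * pdy g y)) x := dη₀ x hx _
      have a3 : J x = -(pdx η₀ x * L₁ x + pdy η₀ x * L₂ x) := by
        rw [a1, a2, hJ]
        by_cases hxW : x ∈ W
        · simp only [indicator_of_mem hxW]; ring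
        · simp only [indicator_of_notMem hxW]; ring
      rw [a3]
      simp only [hR]
      linear_combination cutoff o n x * η₀ x * hdiv x hx
    have hint : IntegrableOn (fun x => pdx (fun y => cutoff o n y * η₀ y * K₁ y) x +
        pdy (fun y => cutoff o n y * η₀ y * K₂ y) x) Ω :=
      (hRint.sub hχJint).congr_fun (fun x hx => (divE x hx).symm) h.isOpen.measurableSet
    have hΨS : ContinuousOn Ψ S := hΨ.smooth.continuousOn.mono inter_subset_right
    have hΨx : ContinuousOn (pdx Ψ) S :=
      (contDiffOn_pdx isOpen_H2 hΨ.smooth (m := 0) (by simp)).continuousOn.mono inter_subset_right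
    have hΨy : ContinuousOn (pdy Ψ) S :=
      (contDiffOn_pdy isOpen_H2 hΨ.smooth (m := 0) (by simp)).continuousOn.mono inter_subset_right
    have huS : ContinuousOn u S := h.c1.continuousOn
    have unn : ∀ q ∈ S, 0 ≤ u q := fun q hq => by
      have ht : Tendsto u (𝓝[Ω] q) (𝓝 (u q)) := (huS q hq).mono hSΩ
      have : (𝓝[Ω] q).NeBot := mem_closure_iff_nhdsWithin_neBot.1 hq.1
      exact ge_of_tendsto ht
        (by filter_upwards [self_mem_nhdsWithin] with y hy using (hpos y hy).le)
    have gr := green_nonneg h.subH h.ne h.isOpen h.conv (T := cutoffSupp o n \ V)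
      (K₁ := K₁) (K₂ := K₂) (η := fun x => cutoff o n x * η₀ x) h.closedD
      ((isCompact_cutoffSupp ho).diff hV) (fun x hx => hx.1.1)
      (disjoint_left.2 fun x hx hxD => hx.2 (hDV hxD))
      ((hΨS.mul (bd _)).sub (huS.mul hΨx)) ((hΨS.mul (bd _)).sub (huS.mul hΨy))
      (L1C.congr e₁) (L2C.congr e₂) (fun q hq ν hν hstar => ?_) (χC.mul hη₀C) (M := 1)
      (fun x _ => mul_nonneg (cutoff_nonneg x) (η₀nn x))
      (fun x _ => mul_le_one₀ (cutoff_le_one x) (η₀nn x) (η₀le x)) (fun x hx hxT => ?_) hint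
    · rw [setIntegral_congr_fun h.isOpen.measurableSet divE, integral_sub hRint hχJint] at gr
      have : ∫ x in Ω, R x ≤ ∫ x in Ω, 1 / ((n : ℝ) + 1) * G x :=
        setIntegral_mono_on hRint (hGint.const_mul _) h.isOpen.measurableSet
          fun x hx => (le_abs_self _).trans (hRG x hx)
      rw [integral_const_mul] at this
      linarith
    · have hqS : q ∈ S := ⟨frontier_subset_closure hq.1.1, hq.1.2⟩
      have n1 := h.neumann q hq ν hν
      have n2 := hΨ.normal q hq.1.2 ν hstar
      rw [clm_prod_apply] at n1
      rw [fderiv_eq_pd] at n2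
      simp only [hK₁, hK₂]
      have := mul_nonpos_of_nonneg_of_nonpos (unn q hqS) n2
      linear_combination this - Ψ q * n1
    · by_cases hc : x ∈ cutoffSupp o n
      · have hxV : x ∈ V := by by_contra hxV; exact hxT ⟨hc, hxV⟩
        have : x ∉ W := disjoint_left.1 hVW hxV
        simp [hη₀, indicator_of_notMem this]
      · rw [cutoff_eq_zero ho (h.subH hx) hc]; simp
  have lim : Tendsto (fun n : ℕ => ∫ x in Ω, cutoff o n x * J x) atTop (𝓝 (∫ x in Ω, J x)) := by
    refine tendsto_integral_of_dominated_convergence B (fun n => ?_) hBint (fun n => ?_) ?_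
    · exact (((contDiffOn_cutoff ho).mono h.subH).continuousOn.mul hJC).aestronglyMeasurable
        h.isOpen.measurableSet
    · refine (ae_restrict_iff' h.isOpen.measurableSet).2 (Eventually.of_forall fun x hx => ?_)
      rw [Real.norm_eq_abs, abs_mul, abs_of_nonneg (cutoff_nonneg x)]
      exact (mul_le_of_le_one_left (abs_nonneg _) (cutoff_le_one x)).trans (hJB x hx)
    · refine Eventually.of_forall fun x => ?_
      simpa using (tendsto_cutoff (o := o) x).mul_const (J x)
  have lim0 : Tendsto (fun n : ℕ => 1 / ((n : ℝ) + 1) * ∫ x in Ω, G x) atTop (𝓝 0) := by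
    simpa using tendsto_one_div_add_atTop_nhds_zero_nat.mul_const (∫ x in Ω, G x)
  have hle : ∫ x in Ω, J x ≤ 0 := le_of_tendsto_of_tendsto' lim lim0 key
  have hJ0 := eq_zero_of_setIntegral_nonpos h.isOpen hJC hJnn hJint hle
  intro x hx
  have h0 := hJ0 x (hWΩ hx)
  rw [hJW x hx] at h0
  have w0 := hwpos x hx
  have Ψ0 := hΨ.pos x (h.subH (hWΩ hx))
  have : pdx g x ^ 2 + pdy g x ^ 2 = 0 := by
    by_contra hne
    have : 0 < pdx g x ^ 2 + pdy g x ^ 2 := lt_of_le_of_ne (by positivity) (Ne.symm hne)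
    have : 0 < 2 * w x * (Ψ x ^ 2 * (pdx g x ^ 2 + pdy g x ^ 2)) := by positivity
    linarith
  constructor <;> nlinarith [sq_nonneg (pdx g x), sq_nonneg (pdy g x)]

/-! ### The region where `u` lies below a comparison function -/

lemma fderiv_eq_zero_of_pd {f : ℝ × ℝ → ℝ} {x : ℝ × ℝ} (h1 : pdx f x = 0) (h2 : pdy f x = 0) :
    fderiv ℝ f x = 0 :=
  ContinuousLinearMap.ext fun v => by rw [fderiv_eq_pd, h1, h2]; simp

section below

variable {Ω D : Set (ℝ × ℝ)} {lam : ℝ} {u Ψ : ℝ × ℝ → ℝ}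

lemma MixedEigen.isOpen_below (h : MixedEigen Ω D lam u) (hΨ : Comparison Ω lam Ψ) :
    IsOpen {x ∈ Ω | u x < Ψ x} := by
  rw [isOpen_iff_mem_nhds]
  rintro x ⟨hx, hlt⟩
  have cu := h.smooth.continuousOn.continuousAt (h.contAt hx)
  have cΨ := hΨ.smooth.continuousOn.continuousAt (isOpen_H2.mem_nhds (h.subH hx))
  filter_upwards [h.contAt hx, cu.eventually_lt cΨ hlt] with y hy hlt using ⟨hy, hlt⟩

/-- Near each Dirichlet point the domain is connected and `u` is below the comparison function. -/
lemma MixedEigen.exists_connected_near (h : MixedEigen Ω D lam u) (hΨ : Comparison Ω lam Ψ)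
    {q : ℝ × ℝ} (hq : q ∈ D) :
    ∃ N : Set (ℝ × ℝ), IsOpen N ∧ q ∈ N ∧ IsPreconnected (N ∩ Ω) ∧
      ∀ x ∈ N ∩ Ω, u x < Ψ x := by
  have hqH := (h.subD hq).2
  have hqc : q ∈ closure Ω ∩ H2 := ⟨frontier_subset_closure (h.subD hq).1, hqH⟩
  have cu := h.c1.continuousOn q hqc
  have cΨ := (hΨ.smooth.continuousOn.mono (inter_subset_right (s := closure Ω))) q hqc
  have hlt : u q < Ψ q := by rw [h.dirichlet q hq]; exact hΨ.pos q hqH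
  obtain ⟨U, hU, hUlt⟩ := mem_nhdsWithin_iff_exists_mem_nhds_inter.1 (cu.eventually_lt cΨ hlt)
  have hpre : parabInv ⁻¹' U ∩ {z | z.1 ^ 2 < z.2} ∈ 𝓝 (parab q) := by
    refine inter_mem (continuous_parabInv.continuousAt.preimage_mem_nhds ?_)
      (isOpen_aboveParabola.mem_nhds (parab_mem hqH))
    rwa [parabInv_parab hqH]
  obtain ⟨r, hr, hball⟩ := Metric.mem_nhds_iff.1 hpre
  have hN : parab ⁻¹' Metric.ball (parab q) r ∩ H2 ∩ Ω =
      parabInv '' (Metric.ball (parab q) r ∩ klein Ω) := by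
    ext x
    constructor
    · rintro ⟨⟨hx1, hx2⟩, hx3⟩
      exact ⟨parab x, ⟨hx1, (parab_mem_klein hx2).2 hx3⟩, parabInv_parab hx2⟩
    · rintro ⟨z, ⟨hz1, hz2⟩, rfl⟩
      refine ⟨⟨?_, parabInv_mem hz2.1⟩, hz2.2⟩
      rwa [mem_preimage, parab_parabInv hz2.1]
  refine ⟨parab ⁻¹' Metric.ball (parab q) r ∩ H2,
    (Metric.isOpen_ball.preimage continuous_parab).inter isOpen_H2,
    ⟨Metric.mem_ball_self hr, hqH⟩, ?_, ?_⟩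
  · rw [hN]
    exact ((convex_ball _ _).inter (convex_klein h.subH h.conv)).isPreconnected.image _
      continuous_parabInv.continuousOn
  · rw [hN]
    rintro x ⟨z, ⟨hz1, hz2⟩, rfl⟩
    exact hUlt ⟨(hball hz1).1, subset_closure hz2.2, parabInv_mem hz2.1⟩

/-- Only one component of the region where `u` lies below a comparison function can have a point
of equality inside `Ω` in its closure. -/
theorem MixedEigen.exists_component (h : MixedEigen Ω D lam u) (hpos : ∀ x ∈ Ω, 0 < u x)
    (hΨ : Comparison Ω lam Ψ) {A : Set (ℝ × ℝ)} (hA : A = {x ∈ Ω | u x < Ψ x}) :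
    ∃ c, ∀ n ∈ A, ∀ p ∈ Ω, p ∈ closure (connectedComponentIn A n) → u p = Ψ p →
      connectedComponentIn A n = connectedComponentIn A c := by
  have hAo : IsOpen A := hA ▸ h.isOpen_below hΨ
  choose! N hNo hqN hNc hNlt using fun q (hq : q ∈ D) => h.exists_connected_near hΨ hq
  have hNA : ∀ q ∈ D, N q ∩ Ω ⊆ A := fun q hq x hx => hA ▸ ⟨hx.2, hNlt q hq x hx⟩
  have hmeet : ∀ q ∈ D, ∀ U, IsOpen U → q ∈ U → (U ∩ Ω).Nonempty := fun q hq U hU hqU =>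
    mem_closure_iff.1 (frontier_subset_closure (h.subD hq).1) U hU hqU
  choose! a ha using fun q (hq : q ∈ D) => hmeet q hq (N q) (hNo q hq) (hqN q hq)
  have hC : ∀ q ∈ D, ∀ x ∈ N q ∩ Ω, connectedComponentIn A (a q) = connectedComponentIn A x :=
    fun q hq x hx => connectedComponentIn_eq
      ((hNc q hq).subset_connectedComponentIn (ha q hq) (hNA q hq) hx)
  have hall : ∀ q ∈ D, ∀ q' ∈ D,
      connectedComponentIn A (a q) = connectedComponentIn A (a q') := by
    intro q hq q' hq'
    refine h.connD.isPreconnected.induction₂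
      (fun q q' => connectedComponentIn A (a q) = connectedComponentIn A (a q'))
      (fun q hq => ?_) (fun _ _ _ _ _ _ => Eq.trans) (fun _ _ _ _ => Eq.symm) hq hq'
    filter_upwards [self_mem_nhdsWithin, mem_nhdsWithin_of_mem_nhds ((hNo q hq).mem_nhds (hqN q hq))]
      with q' hq' hqq'
    obtain ⟨x, ⟨hx1, hx2⟩, hx3⟩ := hmeet q' hq' (N q ∩ N q') ((hNo q hq).inter (hNo q' hq'))
      ⟨hqq', hqN q' hq'⟩
    rw [hC q hq x ⟨hx1, hx3⟩, hC q' hq' x ⟨hx2, hx3⟩]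
  obtain ⟨q₀, hq₀⟩ := h.neD
  refine ⟨a q₀, fun n hn p hp hpc hpe => ?_⟩
  by_contra hne
  set W := connectedComponentIn A n with hW
  have hWA : W ⊆ A := connectedComponentIn_subset A n
  have hWΩ : W ⊆ Ω := fun x hx => (hA ▸ hWA hx : x ∈ {x ∈ Ω | u x < Ψ x}).1
  have hlt : ∀ x ∈ W, u x < Ψ x := fun x hx => (hA ▸ hWA hx : x ∈ {x ∈ Ω | u x < Ψ x}).2
  have hWo : IsOpen W := hAo.connectedComponentIn
  have hfr : ∀ x ∈ Ω, x ∈ closure W → x ∉ W → u x = Ψ x := by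
    intro x hx hxc hxW
    have cu := h.smooth.continuousOn.continuousAt (h.contAt hx)
    have cΨ := hΨ.smooth.continuousOn.continuousAt (isOpen_H2.mem_nhds (h.subH hx))
    refine le_antisymm ?_ (not_lt.1 fun hxlt => hxW ?_)
    · have : (𝓝[W] x).NeBot := mem_closure_iff_nhdsWithin_neBot.1 hxc
      exact le_of_tendsto_of_tendsto (cu.mono_left nhdsWithin_le_nhds)
        (cΨ.mono_left nhdsWithin_le_nhds)
        (by filter_upwards [self_mem_nhdsWithin] with y hy using (hlt y hy).le)
    · have hxA : x ∈ A := hA ▸ ⟨hx, hxlt⟩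
      obtain ⟨y, hy1, hy2⟩ := mem_closure_iff.1 hxc (connectedComponentIn A x)
        hAo.connectedComponentIn (mem_connectedComponentIn hxA)
      rw [hW, connectedComponentIn_eq hy2, ← connectedComponentIn_eq hy1]
      exact mem_connectedComponentIn hxA
  have crit := h.ratio_critical hpos hΨ hWo hWΩ hlt hfr (V := ⋃ q ∈ D, N q)
    (isOpen_biUnion hNo) (fun q hq => mem_biUnion hq (hqN q hq)) (by
      refine disjoint_left.2 fun x hxV hxW => hne ?_
      obtain ⟨q, hq, hxq⟩ := mem_iUnion₂.1 hxV
      rw [hW, connectedComponentIn_eq hxW, ← hC q hq x ⟨hxq, hWΩ hxW⟩, hall q hq q₀ hq₀])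
  have gC := h.contDiffOn_ratio hΨ
  obtain ⟨k, hk⟩ := hWo.exists_is_const_of_fderiv_eq_zero isPreconnected_connectedComponentIn
    ((gC.mono hWΩ).differentiableOn (by simp)) fun x hx =>
      fderiv_eq_zero_of_pd (crit x hx).1 (crit x hx).2
  have hnW : n ∈ W := mem_connectedComponentIn hn
  have k1 : k < 1 := by
    rw [← hk n hnW, div_lt_one (hΨ.pos n (h.subH (hWΩ hnW)))]; exact hlt n hnW
  have : (𝓝[W] p).NeBot := mem_closure_iff_nhdsWithin_neBot.1 hpc
  have t1 : Tendsto (fun x => u x / Ψ x) (𝓝[W] p) (𝓝 (u p / Ψ p)) :=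
    (gC.continuousOn.continuousAt (h.contAt hp)).mono_left nhdsWithin_le_nhds
  have t2 : Tendsto (fun x => u x / Ψ x) (𝓝[W] p) (𝓝 k) :=
    tendsto_const_nhds.congr' (by filter_upwards [self_mem_nhdsWithin] with y hy using (hk y hy).symm)
  have := tendsto_nhds_unique t1 t2
  rw [hpe, div_self (hΨ.pos p (h.subH hp)).ne'] at this
  linarith

end below

/-! ### Winding numbers of loops in the plane -/

section winding

open Complex

/-- `L` is a continuous logarithm of `w ↦ (b - w) / (a - w)` off the set `Γ`, vanishing at
infinity. -/
structure IsLogQuotient (Γ : Set ℂ) (a b : ℂ) (L : ℂ → ℂ) : Prop where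
  compact : IsCompact Γ
  left_mem : a ∈ Γ
  right_mem : b ∈ Γ
  continuousOn : ContinuousOn L Γᶜ
  exp_eq : ∀ w ∉ Γ, exp (L w) = (b - w) / (a - w)
  tendsto : Tendsto L (cocompact ℂ) (𝓝 0)

lemma IsLogQuotient.symm {Γ : Set ℂ} {a b : ℂ} {L : ℂ → ℂ} (h : IsLogQuotient Γ a b L) :
    IsLogQuotient Γ b a (fun w => -L w) where
  compact := h.compact
  left_mem := h.right_mem
  right_mem := h.left_mem
  continuousOn := h.continuousOn.neg
  exp_eq w hw := by rw [Complex.exp_neg, h.exp_eq w hw, inv_div]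
  tendsto := by simpa using h.tendsto.neg

lemma IsLogQuotient.trans {Γ Γ' : Set ℂ} {a b c : ℂ} {L L' : ℂ → ℂ} (h : IsLogQuotient Γ a b L)
    (h' : IsLogQuotient Γ' b c L') : IsLogQuotient (Γ ∪ Γ') a c (fun w => L w + L' w) where
  compact := h.compact.union h'.compact
  left_mem := Or.inl h.left_mem
  right_mem := Or.inr h'.right_mem
  continuousOn := (h.continuousOn.mono (compl_subset_compl.2 subset_union_left)).add
    (h'.continuousOn.mono (compl_subset_compl.2 subset_union_right))
  exp_eq w hw := by
    rw [mem_union, not_or] at hw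
    have : b - w ≠ 0 := fun h0 => hw.1 (sub_eq_zero.1 h0 ▸ h.right_mem)
    rw [Complex.exp_add, h.exp_eq w hw.1, h'.exp_eq w hw.2]
    rw [mul_comm, div_mul_div_cancel₀ this]
  tendsto := by simpa using h.tendsto.add h'.tendsto

lemma div_mem_slitPlane {a b w : ℂ} (hw : w ∉ segment ℝ a b) :
    (b - w) / (a - w) ∈ slitPlane := by
  have ha : a - w ≠ 0 := fun h => hw (sub_eq_zero.1 h ▸ left_mem_segment ℝ a b)
  by_contra hs
  rw [mem_slitPlane_iff_not_le_zero, not_not] at hs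
  obtain ⟨hre, him⟩ := Complex.le_def.1 hs
  simp only [zero_re, zero_im] at hre him
  set s := ((b - w) / (a - w)).re with hsdef
  have he : (b - w) / (a - w) = (s : ℂ) := Complex.ext rfl (by simpa using him)
  rw [div_eq_iff ha] at he
  refine hw ⟨-s / (1 - s), 1 / (1 - s), by apply div_nonneg <;> linarith,
    by apply div_nonneg <;> linarith, ?_, ?_⟩
  · rw [← add_div, div_eq_one_iff_eq (by linarith)]; ring
  · have h1 : (1 : ℂ) - s ≠ 0 := by
      norm_cast; linarith
    simp only [Complex.real_smul]
    push_cast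
    field_simp
    linear_combination he

lemma tendsto_sub_div_sub (a b : ℂ) :
    Tendsto (fun w => (b - w) / (a - w)) (cocompact ℂ) (𝓝 1) := by
  have h1 : Tendsto (fun w : ℂ => a - w) (cocompact ℂ) (cocompact ℂ) :=
    (Homeomorph.subLeft a).isClosedEmbedding.tendsto_cocompact
  have h2 : Tendsto (fun w : ℂ => 1 + (b - a) * (a - w)⁻¹) (cocompact ℂ) (𝓝 (1 + (b - a) * 0)) :=
    tendsto_const_nhds.add (tendsto_const_nhds.mul ((tendsto_inv₀_cobounded (α := ℂ)).comp
      (by rwa [Metric.cobounded_eq_cocompact])))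
  rw [mul_zero, add_zero] at h2
  refine h2.congr' ?_
  have : ∀ᶠ w in cocompact ℂ, w ≠ a := (isCompact_singleton (x := a)).compl_mem_cocompact
  filter_upwards [this] with w hw
  have : a - w ≠ 0 := sub_ne_zero.2 (Ne.symm hw)
  field_simp; ring

lemma isLogQuotient_segment (a b : ℂ) :
    IsLogQuotient (segment ℝ a b) a b (fun w => log ((b - w) / (a - w))) where
  compact := by
    rw [segment_eq_image]
    exact isCompact_Icc.image (by fun_prop)
  left_mem := left_mem_segment ℝ a b
  right_mem := right_mem_segment ℝ a b
  continuousOn := by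
    refine ContinuousOn.clog (ContinuousOn.div (by fun_prop) (by fun_prop) fun w hw h => hw ?_)
      fun w hw => div_mem_slitPlane hw
    exact sub_eq_zero.1 h ▸ left_mem_segment ℝ a b
  exp_eq w hw := exp_log (slitPlane_ne_zero (div_mem_slitPlane hw))
  tendsto := by
    have := (continuousAt_clog (x := 1) (by simp)).tendsto.comp (tendsto_sub_div_sub a b)
    simpa [Function.comp_def] using this

/-- Two points of a connected open set are joined by a logarithm branched inside the set. -/
lemma exists_isLogQuotient {A : Set ℂ} (hA : IsOpen A) (hc : IsPreconnected A) {a b : ℂ}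
    (ha : a ∈ A) (hb : b ∈ A) : ∃ Γ L, Γ ⊆ A ∧ IsLogQuotient Γ a b L := by
  refine hc.induction₂ (fun a b => ∃ Γ L, Γ ⊆ A ∧ IsLogQuotient Γ a b L) (fun x hx => ?_)
    (fun x y z _ _ _ => ?_) (fun x y _ _ => ?_) ha hb
  · obtain ⟨r, hr, hball⟩ := Metric.isOpen_iff.1 hA x hx
    refine mem_nhdsWithin_of_mem_nhds ?_
    filter_upwards [Metric.ball_mem_nhds x hr] with y hy
    exact ⟨_, _, ((convex_ball x r).segment_subset (Metric.mem_ball_self hr) hy).trans hball,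
      isLogQuotient_segment x y⟩
  · rintro ⟨Γ, L, hΓ, h⟩ ⟨Γ', L', hΓ', h'⟩
    exact ⟨_, _, union_subset hΓ hΓ', h.trans h'⟩
  · rintro ⟨Γ, L, hΓ, h⟩
    exact ⟨_, _, hΓ, h.symm⟩

lemma IsLogQuotient.eq_zero_of_norm_lt {Γ : Set ℂ} {a : ℂ} {L : ℂ → ℂ}
    (h : IsLogQuotient Γ a a L) {z : ℂ} (hz : z ∉ Γ) (hz1 : ‖L z‖ < 1) : L z = 0 := by
  have he := h.exp_eq z hz
  have haz : a - z ≠ 0 := fun h0 => hz (sub_eq_zero.1 h0 ▸ h.left_mem)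
  rw [div_self haz] at he
  obtain ⟨n, hn⟩ := Complex.exp_eq_one_iff.1 he
  rw [hn] at hz1 ⊢
  have h2 : ‖(n : ℂ) * (2 * Real.pi * I)‖ = |(n : ℝ)| * (2 * Real.pi) := by
    simp [abs_of_pos Real.pi_pos]
  have : |(n : ℝ)| < 1 := by
    have := Real.pi_gt_three
    rw [h2] at hz1
    nlinarith [abs_nonneg (n : ℝ)]
  have : n = 0 := by
    rw [← Int.abs_lt_one_iff]; exact_mod_cast this
  simp [this]

lemma IsLogQuotient.isOpen_zero {Γ : Set ℂ} {a : ℂ} {L : ℂ → ℂ} (h : IsLogQuotient Γ a a L) :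
    IsOpen {w | w ∉ Γ ∧ L w = 0} := by
  rw [isOpen_iff_mem_nhds]
  rintro w ⟨hw, hL⟩
  have hΓ : Γᶜ ∈ 𝓝 w := h.compact.isClosed.isOpen_compl.mem_nhds hw
  have hc := (h.continuousOn.continuousAt hΓ).norm
  rw [ContinuousAt, hL, norm_zero] at hc
  filter_upwards [hΓ, hc.eventually_lt_const (show (0 : ℝ) < 1 by norm_num)] with z hz hz1
    using ⟨hz, h.eq_zero_of_norm_lt hz hz1⟩

lemma IsLogQuotient.isOpen_ne_zero {Γ : Set ℂ} {a b : ℂ} {L : ℂ → ℂ} (h : IsLogQuotient Γ a b L) :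
    IsOpen {w | w ∉ Γ ∧ L w ≠ 0} :=
  h.continuousOn.isOpen_inter_preimage h.compact.isClosed.isOpen_compl isOpen_ne

lemma IsLogQuotient.eventually_eq_zero {Γ : Set ℂ} {a : ℂ} {L : ℂ → ℂ}
    (h : IsLogQuotient Γ a a L) : ∀ᶠ w in cocompact ℂ, L w = 0 := by
  have hc := h.tendsto.norm
  rw [norm_zero] at hc
  filter_upwards [h.compact.compl_mem_cocompact,
    hc.eventually_lt_const (show (0 : ℝ) < 1 by norm_num)] with z hz hz1
    using h.eq_zero_of_norm_lt hz hz1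

/-- The winding number vanishes on connected unbounded sets avoiding the loop. -/
lemma IsLogQuotient.eq_zero_of_unbounded {Γ : Set ℂ} {a : ℂ} {L : ℂ → ℂ}
    (h : IsLogQuotient Γ a a L) {R : Set ℂ} (hR : IsPreconnected R) (hRΓ : Disjoint R Γ)
    (hunb : ∃ᶠ w in cocompact ℂ, w ∈ R) {w : ℂ} (hw : w ∈ R) : L w = 0 := by
  obtain ⟨z, hz, hz0⟩ := (hunb.and_eventually h.eventually_eq_zero).exists
  refine (hR.subset_left_of_subset_union h.isOpen_zero h.isOpen_ne_zero ?_ ?_ ?_ hw).2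
  · exact disjoint_left.2 fun x hx hx' => hx'.2 hx.2
  · intro x hx
    have := disjoint_left.1 hRΓ hx
    by_cases h0 : L x = 0
    · exact Or.inl ⟨this, h0⟩
    · exact Or.inr ⟨this, h0⟩
  · exact ⟨z, hz, disjoint_left.1 hRΓ hz, hz0⟩

/-- The limit of the logarithms of a segment seen from both of its sides. -/
lemma tendsto_log_jump {ρ : ℝ} (hρ : 0 < ρ) :
    Tendsto (fun ε : ℝ => log (1 + I * (ρ / ε : ℝ)) - log (1 - I * (ρ / ε : ℝ)))
      (𝓝[>] 0) (𝓝 (Real.pi * I)) := by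
  have e : ∀ ε : ℝ, 0 < ε → log (1 + I * (ρ / ε : ℝ)) - log (1 - I * (ρ / ε : ℝ)) =
      2 * (arg (ε + I * ρ) : ℂ) * I := by
    intro ε hε
    have hs : (1 : ℂ) + I * (ρ / ε : ℝ) ∈ slitPlane := Or.inl (by simp)
    have hc : (1 : ℂ) - I * (ρ / ε : ℝ) = (starRingEnd ℂ) (1 + I * (ρ / ε : ℝ)) := by
      simp [sub_eq_add_neg]
    rw [hc, log_conj _ (slitPlane_arg_ne_pi hs)]
    have ha : arg (1 + I * (ρ / ε : ℝ)) = arg (ε + I * ρ) := by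
      rw [← arg_real_mul (1 + I * ((ρ / ε : ℝ) : ℂ)) hε]
      congr 1
      have : (ε : ℂ) ≠ 0 := by exact_mod_cast hε.ne'
      push_cast; field_simp
    rw [← ha, ← log_im]
    apply Complex.ext <;> simp
    ring
  have hI : I * ρ ∈ slitPlane := Or.inr (by simp [hρ.ne'])
  have hlim : Tendsto (fun ε : ℝ => arg (ε + I * ρ)) (𝓝[>] 0) (𝓝 (Real.pi / 2)) := by
    have h1 : ContinuousAt (fun ε : ℝ => arg (ε + I * ρ)) 0 :=
      ContinuousAt.comp (g := arg) (continuousAt_arg (by simpa using hI)) (by fun_prop)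
    have h2 : arg (I * ρ) = Real.pi / 2 := by
      rw [mul_comm, arg_real_mul _ hρ, arg_I]
    have := h1.tendsto
    rw [ofReal_zero, zero_add, h2] at this
    exact this.mono_left nhdsWithin_le_nhds
  have h3 : Tendsto (fun ε : ℝ => 2 * (arg (ε + I * ρ) : ℂ) * I) (𝓝[>] 0)
      (𝓝 (2 * ((Real.pi / 2 : ℝ) : ℂ) * I)) :=
    (((continuous_ofReal.tendsto _).comp hlim).const_mul 2).mul_const I
  rw [show 2 * ((Real.pi / 2 : ℝ) : ℂ) * I = Real.pi * I by push_cast; ring] at h3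
  refine h3.congr' ?_
  filter_upwards [self_mem_nhdsWithin] with ε hε using (e ε hε).symm

/-- A connected open set which meets both ends of a segment through the point `p`, but avoids `p`,
separates the two sides of the segment near `p`. -/
theorem exists_separated {A : Set ℂ} (hA : IsOpen A) (hc : IsPreconnected A) {p d : ℂ} {ρ : ℝ}
    (hd : d ≠ 0) (hρ : 0 < ρ) (hp : p ∉ A)
    (hseg : ∀ t : ℝ, t ≠ 0 → |t| ≤ ρ → p + t * d ∈ A) :
    ∃ T Z : Set ℂ, IsCompact T ∧ IsOpen Z ∧ T ⊆ insert p A ∧ Disjoint Z T ∧ closure Z ⊆ Z ∪ T ∧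
      (∀ R : Set ℂ, IsPreconnected R → Disjoint R T → (∃ᶠ w in cocompact ℂ, w ∈ R) →
        Disjoint R Z) ∧ (∀ᶠ w in cocompact ℂ, w ∉ Z) ∧
      ∀ᶠ ε : ℝ in 𝓝[>] 0, p + ε * (I * d) ∉ T → p - ε * (I * d) ∉ T →
        p + ε * (I * d) ∈ Z ∨ p - ε * (I * d) ∈ Z := by
  set a := p + ρ * d with ha
  set b := p - ρ * d with hb
  have haA : a ∈ A := hseg ρ hρ.ne' (abs_of_pos hρ).le
  have hbA : b ∈ A := by
    have := hseg (-ρ) (by linarith) (by rw [abs_neg, abs_of_pos hρ])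
    rwa [show p + ((-ρ : ℝ) : ℂ) * d = b by rw [hb]; push_cast; ring] at this
  obtain ⟨Γ, L, hΓA, hL⟩ := exists_isLogQuotient hA hc haA hbA
  have h1 := isLogQuotient_segment p a
  have h2 := isLogQuotient_segment b p
  have hloop := (h1.trans hL).trans h2
  set T := segment ℝ p a ∪ Γ ∪ segment ℝ b p with hT
  set W : ℂ → ℂ := fun w => log ((a - w) / (p - w)) + L w + log ((p - w) / (b - w)) with hW
  have hsa : segment ℝ p a ⊆ insert p A := by
    rintro z ⟨s, t, hs, ht, hst, rfl⟩
    rcases ht.eq_or_lt with rfl | ht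
    · left; rw [add_zero] at hst; simp [hst]
    · right
      have := hseg (t * ρ) (by positivity) (by rw [abs_of_pos (by positivity)]; nlinarith)
      convert this using 1
      rw [ha, ← eq_sub_iff_add_eq] at *
      subst hst
      simp only [real_smul]; push_cast; ring
  have hsb : segment ℝ b p ⊆ insert p A := by
    rintro z ⟨s, t, hs, ht, hst, rfl⟩
    rcases hs.eq_or_lt with rfl | hs
    · left; rw [zero_add] at hst; simp [hst]
    · right
      have := hseg (-(s * ρ)) (by have : 0 < s * ρ := by positivity
                                  linarith)
        (by rw [abs_neg, abs_of_pos (by positivity)]; nlinarith)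
      convert this using 1
      have : t = 1 - s := by linarith
      subst this
      rw [hb]
      simp only [real_smul]; push_cast; ring
  refine ⟨T, {w | w ∉ T ∧ W w ≠ 0}, hloop.compact, hloop.isOpen_ne_zero,
    union_subset (union_subset hsa (hΓA.trans (subset_insert _ _))) hsb,
    disjoint_left.2 fun x hx => hx.1, fun x hx => ?_, fun R hR hRT hunb => ?_, ?_, ?_⟩
  · by_cases hxT : x ∈ T
    · exact Or.inr hxT
    · refine Or.inl ⟨hxT, fun h0 => ?_⟩
      obtain ⟨y, hy, hy'⟩ := mem_closure_iff.1 hx _ hloop.isOpen_zero ⟨hxT, h0⟩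
      exact hy'.2 hy.2
  · exact disjoint_left.2 fun x hx hxZ => hxZ.2 (hloop.eq_zero_of_unbounded hR hRT hunb hx)
  · filter_upwards [hloop.eventually_eq_zero] with w hw hwZ using hwZ.2 hw
  · have hpΓ : Γᶜ ∈ 𝓝 p := hL.compact.isClosed.isOpen_compl.mem_nhds fun h => hp (hΓA h)
    have hLp := hL.continuousOn.continuousAt hpΓ
    have lim1 : Tendsto (fun ε : ℝ => p + ε * (I * d)) (𝓝[>] 0) (𝓝 p) := by
      have : Tendsto (fun ε : ℝ => p + ε * (I * d)) (𝓝 0) (𝓝 (p + (0 : ℝ) * (I * d))) :=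
        Continuous.tendsto (by fun_prop) 0
      simp only [ofReal_zero, zero_mul, add_zero] at this
      exact this.mono_left nhdsWithin_le_nhds
    have lim2 : Tendsto (fun ε : ℝ => p - ε * (I * d)) (𝓝[>] 0) (𝓝 p) := by
      have : Tendsto (fun ε : ℝ => p - ε * (I * d)) (𝓝 0) (𝓝 (p - (0 : ℝ) * (I * d))) :=
        Continuous.tendsto (by fun_prop) 0
      simp only [ofReal_zero, zero_mul, sub_zero] at this
      exact this.mono_left nhdsWithin_le_nhds
    have jump := tendsto_log_jump hρ
    have key : Tendsto (fun ε : ℝ => W (p + ε * (I * d)) - W (p - ε * (I * d))) (𝓝[>] 0)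
        (𝓝 (2 * (Real.pi * I))) := by
      have := ((hLp.tendsto.comp lim1).sub (hLp.tendsto.comp lim2)).add (jump.const_mul 2)
      rw [sub_self, zero_add] at this
      refine this.congr' ?_
      filter_upwards [self_mem_nhdsWithin] with ε hε
      have hε : 0 < ε := hε
      have hεc : (ε : ℂ) ≠ 0 := by exact_mod_cast hε.ne'
      have q1 : (a - (p + ε * (I * d))) / (p - (p + ε * (I * d))) = 1 + I * (ρ / ε : ℝ) := by
        rw [ha]; push_cast
        have : p - (p + ε * (I * d)) = -(ε * (I * d)) := by ring
        rw [this, div_eq_iff (neg_ne_zero.2 (by simp [hεc, hd]))]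
        field_simp; linear_combination (ρ : ℂ) * d * I_sq
      have q2 : (a - (p - ε * (I * d))) / (p - (p - ε * (I * d))) = 1 - I * (ρ / ε : ℝ) := by
        rw [ha]; push_cast
        have : p - (p - ε * (I * d)) = ε * (I * d) := by ring
        rw [this, div_eq_iff (by simp [hεc, hd])]
        field_simp; linear_combination (ρ : ℂ) * d * I_sq
      have q3 : (b - (p + ε * (I * d))) / (p - (p + ε * (I * d))) = 1 - I * (ρ / ε : ℝ) := by
        rw [hb]; push_cast
        have : p - (p + ε * (I * d)) = -(ε * (I * d)) := by ring
        rw [this, div_eq_iff (neg_ne_zero.2 (by simp [hεc, hd]))]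
        field_simp; linear_combination (-ρ : ℂ) * d * I_sq
      have q4 : (b - (p - ε * (I * d))) / (p - (p - ε * (I * d))) = 1 + I * (ρ / ε : ℝ) := by
        rw [hb]; push_cast
        have : p - (p - ε * (I * d)) = ε * (I * d) := by ring
        rw [this, div_eq_iff (by simp [hεc, hd])]
        field_simp; linear_combination (-ρ : ℂ) * d * I_sq
      have s1 : (1 : ℂ) + I * (ρ / ε : ℝ) ∈ slitPlane := Or.inl (by simp)
      have s2 : (1 : ℂ) - I * (ρ / ε : ℝ) ∈ slitPlane := Or.inl (by simp)
      simp only [hW, Function.comp_apply]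
      rw [q1, q2, ← inv_div (b - (p + ε * (I * d))), ← inv_div (b - (p - ε * (I * d))), q3, q4,
        log_inv _ (slitPlane_arg_ne_pi s1), log_inv _ (slitPlane_arg_ne_pi s2)]
      ring
    have hne : (2 * (Real.pi * I) : ℂ) ≠ 0 := by simp [Real.pi_ne_zero]
    filter_upwards [key.eventually_ne hne] with ε hε h1 h2
    by_contra hcon
    rw [not_or] at hcon
    have w1 : W (p + ε * (I * d)) = 0 := by
      by_contra h; exact hcon.1 ⟨h1, h⟩
    have w2 : W (p - ε * (I * d)) = 0 := by
      by_contra h; exact hcon.2 ⟨h2, h⟩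
    rw [w1, w2, sub_self] at hε
    exact hε rfl

end winding

/-! ### Behaviour at a degenerate point of equality -/

section saddle

variable {Ω D : Set (ℝ × ℝ)} {lam : ℝ} {u Ψ : ℝ × ℝ → ℝ}

/-- A function with vanishing value and derivative and positive second derivative along `v` is
positive on the line through `v`, near the base point. -/
lemma eventually_pos_line {z : ℝ × ℝ → ℝ} {p v : ℝ × ℝ} (hz : ContDiffAt ℝ 2 z p) (h0 : z p = 0)
    (h1 : fderiv ℝ z p v = 0) (h2 : 0 < fderiv ℝ (fun y => fderiv ℝ z y v) p v) :
    ∀ᶠ t : ℝ in 𝓝[≠] 0, 0 < z (p + t • v) := by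
  set c := fderiv ℝ (fun y => fderiv ℝ z y v) p v with hc
  have hline : ∀ t : ℝ, HasDerivAt (fun t : ℝ => p + t • v) v t := fun t => by
    simpa using ((hasDerivAt_id t).smul_const v).const_add p
  have lim : Tendsto (fun t : ℝ => p + t • v) (𝓝 0) (𝓝 p) := by
    have := (hline 0).continuousAt.tendsto
    rwa [zero_smul, add_zero] at this
  have hd : ∀ᶠ y in 𝓝 p, DifferentiableAt ℝ z y := by
    filter_upwards [hz.eventually (by simp)] with y hy using hy.differentiableAt (by simp)
  have hz' : DifferentiableAt ℝ (fun y => fderiv ℝ z y v) p :=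
    ((hz.fderiv_right (m := 1) (by norm_num)).differentiableAt (by simp)).clm_apply
      (differentiableAt_const v)
  set f : ℝ → ℝ := fun t => z (p + t • v) - c / 4 * t ^ 2 with hf
  have hf1 : ∀ᶠ t in 𝓝 (0 : ℝ),
      HasDerivAt f (fderiv ℝ z (p + t • v) v - c / 4 * (2 * t)) t := by
    filter_upwards [lim.eventually hd] with t ht
    have := (ht.hasFDerivAt.comp_hasDerivAt t (hline t)).sub
      (((hasDerivAt_pow 2 t)).const_mul (c / 4))
    exact this.congr_deriv (by simp)
  have hf2 : HasDerivAt (fun t : ℝ => fderiv ℝ z (p + t • v) v - c / 4 * (2 * t)) (c / 2) 0 := by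
    have e : HasFDerivAt (fun y => fderiv ℝ z y v) (fderiv ℝ (fun y => fderiv ℝ z y v) p)
        (p + (0 : ℝ) • v) := by
      rw [zero_smul, add_zero]; exact hz'.hasFDerivAt
    have := (e.comp_hasDerivAt (0 : ℝ) (hline 0)).sub
      (((hasDerivAt_id (0 : ℝ)).const_mul 2).const_mul (c / 4))
    refine this.congr_deriv ?_
    rw [← hc]; ring
  have hdd : deriv f =ᶠ[𝓝 0] fun t : ℝ => fderiv ℝ z (p + t • v) v - c / 4 * (2 * t) := by
    filter_upwards [hf1] with t ht using ht.deriv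
  have hmin : IsLocalMin f 0 := by
    refine isLocalMin_of_deriv_deriv_pos ?_ ?_ hf1.self_of_nhds.continuousAt
    · rw [hdd.deriv_eq, hf2.deriv]; exact half_pos h2
    · rw [hdd.self_of_nhds]; simp [h1]
  filter_upwards [nhdsWithin_le_nhds hmin, self_mem_nhdsWithin] with t ht ht0
  have ht0 : t ≠ 0 := ht0
  have f0 : f 0 = 0 := by simp [hf, h0]
  have ht : f 0 ≤ f t := ht
  rw [f0] at ht
  simp only [hf] at ht
  have : 0 < c / 4 * t ^ 2 := by positivity
  linarith

/-- Points outside a geodesically convex set can be joined to infinity by a vertical ray. -/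
lemma exists_ray (hΩ : Ω ⊆ H2) (hconv : GeodesicallyConvex Ω) {x : ℝ × ℝ} (hx : x ∉ Ω) :
    ∃ R : Set ℂ, IsPreconnected R ∧ Complex.equivRealProdCLM.symm x ∈ R ∧
      (∃ᶠ w in cocompact ℂ, w ∈ R) ∧ ∀ w ∈ R, Complex.equivRealProdCLM w ∉ Ω := by
  have hcoc : ∀ l : Filter ℝ, Tendsto (fun t : ℝ => |t|) l atTop →
      Tendsto (fun t : ℝ => (⟨x.1, t⟩ : ℂ)) l (cocompact ℂ) := fun l hl => by
    rw [← Metric.cobounded_eq_cocompact, ← tendsto_norm_atTop_iff_cobounded]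
    exact tendsto_atTop_mono (fun t => by simpa using Complex.abs_im_le_norm ⟨x.1, t⟩) hl
  by_cases hup : ∃ y, x.2 ≤ y ∧ (x.1, y) ∈ Ω
  · obtain ⟨y, hy, hyΩ⟩ := hup
    refine ⟨{w | w.re = x.1 ∧ w.im ≤ x.2}, Convex.isPreconnected ?_, ?_, ?_, ?_⟩
    · exact (convex_hyperplane Complex.reLm.isLinear x.1).inter
        (convex_halfSpace_le Complex.imLm.isLinear x.2)
    · simp [Complex.equivRealProdCLM_symm_apply]
    · exact (hcoc atBot tendsto_abs_atBot_atTop).frequently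
        ((eventually_le_atBot x.2).frequently.mono fun t ht => ⟨rfl, ht⟩)
    · rintro w ⟨hw1, hw2⟩ hw
      have : Complex.equivRealProdCLM w = (x.1, w.im) := by
        rw [← hw1]; rfl
      rw [this] at hw
      exact hx (mem_of_vertical hΩ hconv hw hyΩ hw2 hy)
  · push Not at hup
    refine ⟨{w | w.re = x.1 ∧ x.2 ≤ w.im}, Convex.isPreconnected ?_, ?_, ?_, ?_⟩
    · exact (convex_hyperplane Complex.reLm.isLinear x.1).inter
        (convex_halfSpace_ge Complex.imLm.isLinear x.2)
    · simp [Complex.equivRealProdCLM_symm_apply]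
    · exact (hcoc atTop tendsto_abs_atTop_atTop).frequently
        ((eventually_ge_atTop x.2).frequently.mono fun t ht => ⟨rfl, ht⟩)
    · rintro w ⟨hw1, hw2⟩ hw
      have : Complex.equivRealProdCLM w = (x.1, w.im) := by
        rw [← hw1]; rfl
      rw [this] at hw
      exact hup _ hw2 hw

/-- No compactly contained open set can be a component of the region where `u` lies above a
comparison function. -/
lemma MixedEigen.not_enclosed (h : MixedEigen Ω D lam u) (hΨ : Comparison Ω lam Ψ)
    {P : Set (ℝ × ℝ)} (hP : IsOpen P) (hPne : P.Nonempty) (hPc : IsCompact (closure P))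
    (hPΩ : closure P ⊆ Ω) (hgt : ∀ x ∈ P, Ψ x < u x)
    (hfr : ∀ x ∈ Ω, x ∈ closure P → x ∉ P → u x = Ψ x) (hne : ∃ x ∈ Ω, x ∉ P) : False := by
  set g : ℝ × ℝ → ℝ := fun y => u y / Ψ y with hg
  have hgC := h.contDiffOn_ratio hΨ
  obtain ⟨L1C, L2C, hdiv⟩ := h.wronskian hΨ
  set L₁ : ℝ × ℝ → ℝ := fun x => Ψ x * pdx u x - u x * pdx Ψ x with hL₁
  set L₂ : ℝ × ℝ → ℝ := fun x => Ψ x * pdy u x - u x * pdy Ψ x with hL₂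
  have gx : ∀ x ∈ Ω, Ψ x ^ 2 * pdx g x = L₁ x := fun x hx => h.pdx_ratio hΨ hx
  have gy : ∀ x ∈ Ω, Ψ x ^ 2 * pdy g x = L₂ x := fun x hx => h.pdy_ratio hΨ hx
  have hPsub : P ⊆ Ω := subset_closure.trans hPΩ
  set w : ℝ × ℝ → ℝ := fun x => g x - 1 with hw
  have hwC : ContDiffOn ℝ 1 w Ω := hgC.sub contDiffOn_const
  have hw0 : ∀ x ∈ Ω, x ∈ closure P → x ∉ P → w x = 0 := fun x hx h1 h2 => by
    simp only [hw, hg, hfr x hx h1 h2, div_self (hΨ.pos x (h.subH hx)).ne', sub_self]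
  have hwpos : ∀ x ∈ P, 0 < w x := fun x hx => by
    simp only [hw, hg, sub_pos, one_lt_div (hΨ.pos x (h.subH (hPsub hx))), hgt x hx]
  have dw : ∀ x ∈ Ω, DifferentiableAt ℝ w x := fun x hx =>
    (hwC.contDiffAt (h.contAt hx)).differentiableAt (by simp)
  set η : ℝ × ℝ → ℝ := P.indicator fun y => w y ^ 2 with hη
  have hηC : ContDiffOn ℝ 1 η Ω := contDiffOn_indicator_sq h.isOpen hP hwC hw0
  have dη : ∀ x ∈ Ω, ∀ v, fderiv ℝ η x v = P.indicator (fun y => 2 * w y * fderiv ℝ g y v) x := by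
    intro x hx v
    rw [(hasFDerivAt_indicator_sq hP dw hw0 hx).fderiv]
    by_cases hxP : x ∈ P
    · rw [indicator_of_mem hxP, indicator_of_mem hxP]
      have : fderiv ℝ w x = fderiv ℝ g x := by rw [hw, fderiv_sub_const]
      rw [this]; simp
    · rw [indicator_of_notMem hxP, indicator_of_notMem hxP]; simp
  set J : ℝ × ℝ → ℝ := P.indicator fun y => 2 * w y * (L₁ y * pdx g y + L₂ y * pdy g y) with hJ
  have gxC : ContinuousOn (pdx g) Ω :=
    (contDiffOn_pdx h.isOpen hgC (m := 0) (by simp)).continuousOn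
  have gyC : ContinuousOn (pdy g) Ω :=
    (contDiffOn_pdy h.isOpen hgC (m := 0) (by simp)).continuousOn
  have hJC : ContinuousOn J Ω := by
    refine continuousOn_indicator_of_frontier h.isOpen hP ?_ fun x hx h1 h2 => by
      simp [hw0 x hx h1 h2]
    exact (continuousOn_const.mul hwC.continuousOn).mul
      ((L1C.continuousOn.mul gxC).add (L2C.continuousOn.mul gyC))
  have hJP : ∀ x ∈ P, J x = 2 * w x * (Ψ x ^ 2 * (pdx g x ^ 2 + pdy g x ^ 2)) := fun x hx => by
    rw [hJ, indicator_of_mem hx]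
    simp only [← gx x (hPsub hx), ← gy x (hPsub hx)]
    ring
  have hJnn : ∀ x ∈ Ω, 0 ≤ J x := fun x hx => by
    by_cases hxP : x ∈ P
    · rw [hJP x hxP]
      have := hwpos x hxP
      positivity
    · rw [hJ, indicator_of_notMem hxP]
  have hη0 : ∀ x, x ∉ closure P → η x = 0 := fun x hx =>
    indicator_of_notMem (fun h => hx (subset_closure h)) _
  obtain ⟨i1, z1⟩ := integral_fderiv_eq_zero h.isOpen (hηC.mul L1C) hPc hPΩ
    (fun x _ hx => by simp [hη0 x hx]) (1, 0)
  obtain ⟨i2, z2⟩ := integral_fderiv_eq_zero h.isOpen (hηC.mul L2C) hPc hPΩ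
    (fun x _ hx => by simp [hη0 x hx]) (0, 1)
  have hsum : ∀ x ∈ Ω, fderiv ℝ (fun x => η x * L₁ x) x (1, 0) +
      fderiv ℝ (fun x => η x * L₂ x) x (0, 1) = J x := by
    intro x hx
    have d : ∀ {F : ℝ × ℝ → ℝ}, ContDiffOn ℝ 1 F Ω → DifferentiableAt ℝ F x := fun hF =>
      (hF.contDiffAt (h.contAt hx)).differentiableAt (by simp)
    change pdx (fun x => η x * L₁ x) x + pdy (fun x => η x * L₂ x) x = J x
    rw [pdx_mul (d hηC) (d L1C), pdy_mul (d hηC) (d L2C)]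
    have a1 : pdx η x = P.indicator (fun y => 2 * w y * pdx g y) x := dη x hx _
    have a2 : pdy η x = P.indicator (fun y => 2 * w y * pdy g y) x := dη x hx _
    have a3 : J x = pdx η x * L₁ x + pdy η x * L₂ x := by
      rw [a1, a2, hJ]
      by_cases hxP : x ∈ P
      · simp only [indicator_of_mem hxP]; ring
      · simp only [indicator_of_notMem hxP]; ring
    rw [a3]
    linear_combination η x * hdiv x hx
  have hJint : IntegrableOn J Ω := (i1.add i2).congr_fun hsum h.isOpen.measurableSet
  have hJ0 : ∫ x in Ω, J x = 0 := by
    rw [← setIntegral_congr_fun h.isOpen.measurableSet hsum]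
    exact (integral_add i1 i2).trans (by rw [z1, z2, add_zero])
  have hJz := eq_zero_of_setIntegral_nonpos h.isOpen hJC hJnn hJint hJ0.le
  have dη0 : ∀ x ∈ Ω, fderiv ℝ η x = 0 := by
    intro x hx
    by_cases hxP : x ∈ P
    · have h0 := hJz x hx
      rw [hJP x hxP] at h0
      have w0 := hwpos x hxP
      have Ψ0 := hΨ.pos x (h.subH hx)
      have h0 : pdx g x ^ 2 + pdy g x ^ 2 = 0 := by
        have : 2 * w x * Ψ x ^ 2 ≠ 0 := by positivity
        exact (mul_eq_zero.1 (by linarith : 2 * w x * Ψ x ^ 2 * (pdx g x ^ 2 + pdy g x ^ 2) = 0)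
          ).resolve_left this
      have e1 : pdx g x = 0 := by nlinarith [sq_nonneg (pdx g x), sq_nonneg (pdy g x)]
      have e2 : pdy g x = 0 := by nlinarith [sq_nonneg (pdx g x), sq_nonneg (pdy g x)]
      refine ContinuousLinearMap.ext fun v => ?_
      rw [dη x hx, indicator_of_mem hxP, fderiv_eq_zero_of_pd e1 e2]; simp
    · refine ContinuousLinearMap.ext fun v => ?_
      rw [dη x hx, indicator_of_notMem hxP]; rfl
  obtain ⟨k, hk⟩ := h.isOpen.exists_is_const_of_fderiv_eq_zero h.conn.isPreconnected
    (hηC.differentiableOn (by simp)) dη0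
  obtain ⟨x, hx, hxP⟩ := hne
  obtain ⟨y, hy⟩ := hPne
  have e1 := hk x hx
  have e2 := hk y (hPsub hy)
  rw [hη, indicator_of_notMem hxP] at e1
  rw [hη, indicator_of_mem hy, ← e1] at e2
  exact (pow_pos (hwpos y hy) 2).ne' e2

end saddle

/-! ### Absence of critical points -/

section main

variable {Ω D : Set (ℝ × ℝ)} {lam : ℝ} {u Ψ : ℝ × ℝ → ℝ}

/-- A comparison function cannot touch `u` at a saddle point of the difference. -/
lemma MixedEigen.not_saddle (h : MixedEigen Ω D lam u) (hpos : ∀ x ∈ Ω, 0 < u x)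
    (hΨ : Comparison Ω lam Ψ) {p : ℝ × ℝ} (hp : p ∈ Ω) (hup : u p = Ψ p) {d : ℝ × ℝ} (hd : d ≠ 0)
    (hlt : ∀ᶠ t : ℝ in 𝓝[≠] 0, u (p + t • d) < Ψ (p + t • d))
    (hgt : ∀ᶠ t : ℝ in 𝓝[≠] 0, Ψ (p + t • (-d.2, d.1)) < u (p + t • (-d.2, d.1))) : False := by
  set A : Set (ℝ × ℝ) := {x ∈ Ω | u x < Ψ x} with hA
  have hAo : IsOpen A := h.isOpen_below hΨ
  obtain ⟨c, hc⟩ := h.exists_component hpos hΨ hA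
  have lim : ∀ v : ℝ × ℝ, Tendsto (fun t : ℝ => p + t • v) (𝓝 0) (𝓝 p) := fun v => by
    have : Tendsto (fun t : ℝ => p + t • v) (𝓝 0) (𝓝 (p + (0 : ℝ) • v)) :=
      Continuous.tendsto (by fun_prop) 0
    rwa [zero_smul, add_zero] at this
  have hev : ∀ᶠ t : ℝ in 𝓝[≠] 0, p + t • d ∈ A := by
    filter_upwards [hlt, nhdsWithin_le_nhds ((lim d).eventually (h.contAt hp))] with t h1 h2
      using ⟨h2, h1⟩
  obtain ⟨r, hr, hrA⟩ := Metric.mem_nhdsWithin_iff.1 hev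
  have hrA' : ∀ t : ℝ, t ≠ 0 → |t| ≤ r / 2 → p + t • d ∈ A := fun t ht htr =>
    hrA ⟨by rw [Metric.mem_ball, Real.dist_eq, sub_zero]; linarith, ht⟩
  have hside : ∀ e : ℝ × ℝ, (∀ t : ℝ, t ∈ Ioc 0 (r / 2) → p + t • e ∈ A) →
      ∀ t : ℝ, t ∈ Ioc 0 (r / 2) → p + t • e ∈ connectedComponentIn A c := by
    intro e he
    have hm : r / 2 ∈ Ioc 0 (r / 2) := ⟨half_pos hr, le_rfl⟩
    have hsub : (fun t : ℝ => p + t • e) '' Ioc 0 (r / 2) ⊆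
        connectedComponentIn A (p + (r / 2) • e) := by
      refine IsPreconnected.subset_connectedComponentIn
        (isPreconnected_Ioc.image _ (by fun_prop)) ⟨_, hm, rfl⟩ ?_
      rintro _ ⟨t, ht, rfl⟩
      exact he t ht
    rw [← hc _ (he _ hm) p hp ?_ hup]
    · exact fun t ht => hsub ⟨t, ht, rfl⟩
    · refine mem_closure_of_tendsto ((lim e).mono_left (nhdsWithin_le_nhds (s := Ioi 0))) ?_
      filter_upwards [Ioc_mem_nhdsGT (half_pos hr)] with t ht using hsub ⟨t, ht, rfl⟩
  set W := connectedComponentIn A c with hW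
  have hWA : W ⊆ A := connectedComponentIn_subset A c
  have hdW : ∀ t : ℝ, t ≠ 0 → |t| ≤ r / 2 → p + t • d ∈ W := by
    intro t ht htr
    rcases lt_or_gt_of_ne ht with h0 | h0
    · have := hside (-d) (fun s hs => by
        have := hrA' (-s) (by linarith [hs.1]) (by rw [abs_neg, abs_of_pos hs.1]; exact hs.2)
        simpa using this) (-t) ⟨by linarith, by rwa [abs_of_neg h0] at htr⟩
      simpa using this
    · exact hside d (fun s hs => hrA' s hs.1.ne' (by rw [abs_of_pos hs.1]; exact hs.2)) t
        ⟨h0, by rwa [abs_of_pos h0] at htr⟩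
  set e := Complex.equivRealProdCLM with he
  have hpA : p ∉ A := fun hpA => hpA.2.ne hup
  obtain ⟨T, Z, hTc, hZo, hTA, hZT, hZcl, hZR, hZb, hZp⟩ := exists_separated (A := e ⁻¹' W)
    (p := e.symm p) (d := e.symm d) (ρ := r / 2)
    (hAo.connectedComponentIn.preimage e.continuous)
    (by rw [← e.image_symm_eq_preimage]
        exact isPreconnected_connectedComponentIn.image _ e.symm.continuous.continuousOn)
    (by simpa using hd) (half_pos hr)
    (fun hpW => hpA (hWA (by simpa using hpW)))
    (fun t ht htr => by
      have := hdW t ht htr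
      rw [mem_preimage, ← Complex.real_smul, ← map_smul, ← map_add, e.apply_symm_apply]
      exact this)
  have hTΩ : ∀ w ∈ T, e w ∈ Ω ∧ u (e w) ≤ Ψ (e w) := by
    intro w hw
    rcases hTA hw with rfl | hw
    · rw [e.apply_symm_apply]; exact ⟨hp, hup.le⟩
    · exact ⟨(hWA hw).1, (hWA hw).2.le⟩
  have hZΩ : ∀ w ∈ Z, e w ∈ Ω := by
    intro w hw
    by_contra hwΩ
    obtain ⟨R, hR1, hR2, hR3, hR4⟩ := exists_ray h.subH h.conv hwΩ
    rw [← he, e.symm_apply_apply] at hR2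
    exact disjoint_left.1 (hZR R hR1 (disjoint_left.2 fun x hx hxT => hR4 x hx (hTΩ x hxT).1) hR3)
      hR2 hw
  set P : Set (ℝ × ℝ) := {x ∈ Ω | Ψ x < u x} ∩ e.symm ⁻¹' Z with hP
  have cu : ∀ x ∈ Ω, ContinuousAt u x := fun x hx =>
    h.smooth.continuousOn.continuousAt (h.contAt hx)
  have cΨ : ∀ x ∈ Ω, ContinuousAt Ψ x := fun x hx =>
    hΨ.smooth.continuousOn.continuousAt (isOpen_H2.mem_nhds (h.subH hx))
  have hPo : IsOpen P := by
    refine IsOpen.inter ?_ (hZo.preimage e.symm.continuous)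
    rw [isOpen_iff_mem_nhds]
    rintro x ⟨hx, hlt⟩
    filter_upwards [h.contAt hx, (cΨ x hx).eventually_lt (cu x hx) hlt] with y hy hy'
      using ⟨hy, hy'⟩
  have hclZ : ∀ x ∈ closure P, e.symm x ∈ Z ∪ T := fun x hx =>
    hZcl (map_mem_closure e.symm.continuous hx fun y hy => hy.2)
  have hPΩ : closure P ⊆ Ω := by
    intro x hx
    have : e (e.symm x) ∈ Ω := (hclZ x hx).elim (hZΩ _) fun h => (hTΩ _ h).1
    rwa [e.apply_symm_apply] at this
  refine h.not_enclosed hΨ hPo ?_ ?_ hPΩ (fun x hx => hx.1.2) ?_ ⟨p, hp, fun hpP => ?_⟩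
  · have lim' : ∀ v : ℝ × ℝ, Tendsto (fun t : ℝ => p + t • v) (𝓝[>] 0) (𝓝 p) := fun v =>
      (lim v).mono_left nhdsWithin_le_nhds
    have gt1 : ∀ᶠ t : ℝ in 𝓝[>] 0, Ψ (p + t • (-d.2, d.1)) < u (p + t • (-d.2, d.1)) :=
      hgt.filter_mono (nhdsWithin_mono (0 : ℝ)
        (show Ioi (0 : ℝ) ⊆ {0}ᶜ from fun t ht => ne_of_gt ht))
    have gt2 : ∀ᶠ t : ℝ in 𝓝[>] 0, Ψ (p - t • (-d.2, d.1)) < u (p - t • (-d.2, d.1)) := by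
      have hn : Tendsto (fun t : ℝ => -t) (𝓝[>] 0) (𝓝[≠] 0) := by
        refine tendsto_nhdsWithin_iff.2 ⟨?_, ?_⟩
        · have : Tendsto (fun t : ℝ => -t) (𝓝 0) (𝓝 (-0)) := continuous_neg.tendsto 0
          rw [neg_zero] at this
          exact this.mono_left nhdsWithin_le_nhds
        · filter_upwards [self_mem_nhdsWithin] with t ht
          exact neg_ne_zero.2 (ne_of_gt ht)
      filter_upwards [hn.eventually hgt] with t ht
      simpa [sub_eq_add_neg] using ht
    have hrot : e.symm (-d.2, d.1) = Complex.I * e.symm d := by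
      simp only [he, Complex.equivRealProdCLM_symm_apply]
      push_cast
      linear_combination (d.2 : ℂ) * (-Complex.I_sq)
    have m1 : ∀ᶠ t : ℝ in 𝓝[>] 0, p + t • (-d.2, d.1) ∈ Ω := (lim' _).eventually (h.contAt hp)
    have m2 : ∀ᶠ t : ℝ in 𝓝[>] 0, p - t • (-d.2, d.1) ∈ Ω := by
      filter_upwards [(lim' (-(-d.2, d.1))).eventually (h.contAt hp)] with t ht
      rwa [smul_neg, ← sub_eq_add_neg] at ht
    obtain ⟨t, hZt, g1, g2, mm1, mm2⟩ :=
      (hZp.and (gt1.and (gt2.and (m1.and m2)))).exists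
    have e1 : e.symm p + t * (Complex.I * e.symm d) = e.symm (p + t • (-d.2, d.1)) := by
      rw [map_add, map_smul, hrot, Complex.real_smul]
    have e2 : e.symm p - t * (Complex.I * e.symm d) = e.symm (p - t • (-d.2, d.1)) := by
      rw [map_sub, map_smul, hrot, Complex.real_smul]
    rw [e1, e2] at hZt
    have hnT : ∀ x, Ψ x < u x → e.symm x ∉ T := fun x hx hxT => by
      have := (hTΩ _ hxT).2
      rw [e.apply_symm_apply] at this
      linarith
    rcases hZt (hnT _ g1) (hnT _ g2) with hz | hz
    · exact ⟨_, ⟨mm1, g1⟩, hz⟩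
    · exact ⟨_, ⟨mm2, g2⟩, hz⟩
  · obtain ⟨K, hK, hKZ⟩ := mem_cocompact.1 hZb
    have hcK : IsCompact (e '' K) := hK.image e.continuous
    refine hcK.of_isClosed_subset isClosed_closure (closure_minimal (fun x hx => ?_) hcK.isClosed)
    refine ⟨e.symm x, ?_, e.apply_symm_apply x⟩
    by_contra hxK
    exact hKZ hxK hx.2
  · intro x hx hxc hxP
    have hge : Ψ x ≤ u x := by
      have : (𝓝[P] x).NeBot := mem_closure_iff_nhdsWithin_neBot.1 hxc
      have hmem : ∀ᶠ y in 𝓝[P] x, y ∈ P := self_mem_nhdsWithin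
      have hle : ∀ᶠ y in 𝓝[P] x, Ψ y ≤ u y := hmem.mono fun y hy => hy.1.2.le
      exact le_of_tendsto_of_tendsto ((cΨ x hx).mono_left nhdsWithin_le_nhds)
        ((cu x hx).mono_left nhdsWithin_le_nhds) hle
    refine le_antisymm (not_lt.1 fun hgt' => ?_) hge
    rcases hclZ x hxc with hxZ | hxT
    · exact hxP ⟨⟨hx, hgt'⟩, hxZ⟩
    · have := (hTΩ _ hxT).2
      rw [e.apply_symm_apply] at this
      linarith
  · exact hpP.1.2.ne' hup

/-- A positive mixed eigenfunction with small eigenvalue has no critical points. -/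
theorem MixedEigen.fderiv_ne_zero_of_pos (h : MixedEigen Ω D lam u) (hlam : lam ≤ 1 / 4)
    (hpos : ∀ x ∈ Ω, 0 < u x) {p : ℝ × ℝ} (hp : p ∈ Ω) : fderiv ℝ u p ≠ 0 := by
  intro hcrit
  obtain ⟨Ψ, hΨ, hΨp, hx, hy, hne⟩ : ∃ Ψ, Comparison Ω lam Ψ ∧ Ψ p = u p ∧ pdx Ψ p = 0 ∧
      pdy Ψ p = 0 ∧ pdx (pdx u) p ≠ pdx (pdx Ψ) p := by
    obtain ⟨Ψ, Φ, ⟨a1, a2, a3, a4⟩, ⟨b1, b2, b3, b4⟩, hne⟩ :=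
      exists_comparison_pair h.subH h.isOpen h.pos hlam hp (hpos p hp)
    by_cases h0 : pdx (pdx u) p = pdx (pdx Ψ) p
    · exact ⟨Φ, b1, b2, b3, b4, fun h1 => hne (h0.symm.trans h1)⟩
    · exact ⟨Ψ, a1, a2, a3, a4, h0⟩
  have hpH := h.subH hp
  have u2 : ContDiffAt ℝ 2 u p := (h.smooth.contDiffAt (h.contAt hp)).of_le (by norm_cast)
  have Ψ2 : ContDiffAt ℝ 2 Ψ p := hΨ.smooth.contDiffAt (isOpen_H2.mem_nhds hpH)
  have fΨ : fderiv ℝ Ψ p = 0 := fderiv_eq_zero_of_pd hx hy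
  have dd : ∀ {F : ℝ × ℝ → ℝ}, ContDiffAt ℝ 2 F p → ∀ v,
      DifferentiableAt ℝ (fun y => fderiv ℝ F y v) p := fun hF v =>
    ((hF.fderiv_right (m := 1) (by norm_num)).differentiableAt (by simp)).clm_apply
      (differentiableAt_const v)
  have ev : ∀ {F : ℝ × ℝ → ℝ}, ContDiffAt ℝ 2 F p → ∀ᶠ y in 𝓝 p, DifferentiableAt ℝ F y :=
    fun hF => by filter_upwards [hF.eventually (by simp)] with y hy using hy.differentiableAt (by simp)
  have sub2 : ∀ {F G : ℝ × ℝ → ℝ}, ContDiffAt ℝ 2 F p → ContDiffAt ℝ 2 G p → ∀ v,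
      fderiv ℝ (fun y => fderiv ℝ (fun x => F x - G x) y v) p =
      fderiv ℝ (fun y => fderiv ℝ F y v) p - fderiv ℝ (fun y => fderiv ℝ G y v) p := by
    intro F G hF hG v
    have : (fun y => fderiv ℝ (fun x => F x - G x) y v) =ᶠ[𝓝 p]
        fun y => fderiv ℝ F y v - fderiv ℝ G y v := by
      filter_upwards [ev hF, ev hG] with y h1 h2
      rw [fderiv_fun_sub h1 h2]; rfl
    rw [this.fderiv_eq, fderiv_fun_sub (dd hF v) (dd hG v)]
  have pos : ∀ {F G : ℝ × ℝ → ℝ}, ContDiffAt ℝ 2 F p → ContDiffAt ℝ 2 G p → F p = G p →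
      fderiv ℝ F p = 0 → fderiv ℝ G p = 0 → ∀ v,
      fderiv ℝ (fun y => fderiv ℝ G y v) p v < fderiv ℝ (fun y => fderiv ℝ F y v) p v →
      ∀ᶠ t : ℝ in 𝓝[≠] 0, G (p + t • v) < F (p + t • v) := by
    intro F G hF hG e eF eG v hv
    have := eventually_pos_line (z := fun x => F x - G x) (v := v) (hF.sub hG)
      (by simp [e]) (by rw [fderiv_fun_sub (ev hF).self_of_nhds (ev hG).self_of_nhds, eF, eG]; simp)
      (by rw [sub2 hF hG]; simpa using hv)
    filter_upwards [this] with t ht using sub_pos.1 ht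
  have l1 := h.laplace hp
  have l2 := hΨ.eigen p hpH
  rw [hΨp] at l2
  rcases lt_or_gt_of_ne hne with hlt | hgt
  · have hlt' : pdy (pdy Ψ) p < pdy (pdy u) p := by linarith
    refine h.not_saddle hpos hΨ hp hΨp.symm (d := (1, 0)) (by simp)
      (pos Ψ2 u2 hΨp fΨ hcrit (1, 0) hlt) ?_
    have := pos u2 Ψ2 hΨp.symm hcrit fΨ (0, 1) hlt'
    simpa using this
  · have hlt' : pdy (pdy u) p < pdy (pdy Ψ) p := by linarith
    refine h.not_saddle hpos hΨ hp hΨp.symm (d := (0, 1)) (by simp)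
      (pos Ψ2 u2 hΨp fΨ hcrit (0, 1) hlt') ?_
    refine pos u2 Ψ2 hΨp.symm hcrit fΨ (-1, 0) ?_
    have e : ∀ F : ℝ × ℝ → ℝ, fderiv ℝ (fun y => fderiv ℝ F y (-1, 0)) p (-1, 0) =
        pdx (pdx F) p := by
      intro F
      have e1 : ((-1, 0) : ℝ × ℝ) = -(1, 0) := by simp
      have e2 : (fun y => fderiv ℝ F y (-1, 0)) = fun y => -pdx F y := by
        funext y; rw [e1, map_neg]; rfl
      rw [e2, fderiv_fun_neg, e1, map_neg]
      simp [pdx]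
    simpa [e] using hgt

end main

/-- **Theorem (mixed hot spots, small eigenvalue).** On a nonempty open connected
geodesically convex domain `Ω ⊆ ℍ²` of finite hyperbolic area, with a nonempty closed
connected Dirichlet subarc `D ⊆ ∂Ω ∩ ℍ²`, a nonzero mixed eigenfunction whose eigenvalue
`λ ∈ (0, 1/4]` is the least element of the mixed spectrum (in the variational sense)
has no interior critical points. -/
theorem mixed_hot_spots_small_eigenvalue
    (Ω : Set (ℝ × ℝ)) (hΩH : Ω ⊆ H2) (hne : Ω.Nonempty) (hopen : IsOpen Ω)
    (hconn : IsConnected Ω) (hconv : GeodesicallyConvex Ω)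
    (harea : IntegrableOn (fun p : ℝ × ℝ => 1 / p.2 ^ 2) Ω volume)
    (D : Set (ℝ × ℝ)) (hD : D ⊆ frontier Ω ∩ H2) (hDne : D.Nonempty)
    (hDclosed : IsClosed D) (hDconn : IsConnected D)
    (lam : ℝ) (hlampos : 0 < lam) (hlamle : lam ≤ 1 / 4)
    (u : ℝ × ℝ → ℝ)
    (hnonzero : ∃ p ∈ Ω, u p ≠ 0)
    (hsmooth : ContDiffOn ℝ (⊤ : ℕ∞) u Ω)
    (hC1 : ContDiffOn ℝ 1 u (closure Ω ∩ H2))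
    (hL2 : IntegrableOn (fun p : ℝ × ℝ => u p ^ 2 / p.2 ^ 2) Ω volume)
    (hH1 : IntegrableOn (gradSq u) Ω volume)
    (heigen : ∀ p ∈ Ω, -hypLap u p = lam * u p)
    (hdirichlet : ∀ q ∈ D, u q = 0)
    (hneumann : ∀ q ∈ (frontier Ω ∩ H2) \ D, ∀ ν : ℝ × ℝ, IsOutwardNormalAt Ω q ν →
      fderivWithin ℝ u (closure Ω ∩ H2) q ν = 0)
    (hleast : ∀ w : ℝ × ℝ → ℝ, ContDiffOn ℝ (⊤ : ℕ∞) w Ω →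
      (∃ V : Set (ℝ × ℝ), IsOpen V ∧ D ⊆ V ∧ ∀ x ∈ V ∩ closure Ω, w x = 0) →
      IntegrableOn (fun p : ℝ × ℝ => w p ^ 2 / p.2 ^ 2) Ω volume →
      IntegrableOn (gradSq w) Ω volume →
      lam * ∫ p in Ω, w p ^ 2 / p.2 ^ 2 ≤ ∫ p in Ω, gradSq w p) :
    ∀ p ∈ Ω, fderiv ℝ u p ≠ 0 := by
  have h : MixedEigen Ω D lam u := ⟨hΩH, hne, hopen, hconn, hconv, harea, hD, hDne, hDclosed,
    hDconn, hlampos, hsmooth, hC1, hL2, hH1, heigen, hdirichlet, hneumann, hleast⟩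
  intro p hp
  obtain ⟨q, hq, huq⟩ := hnonzero
  rcases huq.lt_or_gt with hneg | hpos
  · have := h.neg.fderiv_ne_zero_of_pos hlamle (h.neg.pos_of_pos hq (neg_pos.2 hneg)) hp
    rwa [fderiv_fun_neg, neg_ne_zero] at this
  · exact h.fderiv_ne_zero_of_pos hlamle (h.pos_of_pos hq hpos) hp
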